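/- Let d≥1 and let G_t(x) = (4πt)^{−d/2} exp(−|x|²/(4t)) be the heat kernel on ℝ^d. Define the operator A₂ by (A₂ f)(t,·) = ∫₀^t ∇²( G_{t−s} ∗ f(s,·) ) ds, where ∇² denotes the full second spatial derivative and ∗ spatial convolution. Then for every T ∈ (0,∞] and all 1 < p, r < ∞, A₂ is bounded from L^r(0,T;L^p(ℝ^d)) to L^r(0,T;L^p(ℝ^d)): there is a constant C = C(d,p,r), independent of T, such that ‖A₂ f‖_{L^r(0,T;L^p)} ≤ C ‖f‖_{L^r(0,T;L^p)} for all f ∈ L^r(0,T;L^p(ℝ^d)). -/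

import Mathlib

open MeasureTheory Set ENNReal Real

noncomputable section

/-- The heat kernel `G_t(x) = (4πt)^{−d/2} exp(−|x|²/(4t))` on `ℝ^d`. -/
def heatKernel (d : ℕ) (t : ℝ) (x : EuclideanSpace ℝ (Fin d)) : ℝ :=
  (4 * Real.pi * t) ^ (-(d : ℝ) / 2) * Real.exp (-‖x‖ ^ 2 / (4 * t))

/-- The operator `A₂ f (t,·) = ∫₀^t ∇²(G_{t−s} ∗ f(s,·)) ds`, with `∇²` the full
second spatial derivative and `∗` spatial convolution. -/
def A2 (d : ℕ) (f : ℝ → EuclideanSpace ℝ (Fin d) → ℝ) (t : ℝ)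
    (y : EuclideanSpace ℝ (Fin d)) :
    ContinuousMultilinearMap ℝ (fun _ : Fin 2 => EuclideanSpace ℝ (Fin d)) ℝ :=
  ∫ s in Ioo (0:ℝ) t,
    iteratedFDeriv ℝ 2 (fun y' => ∫ z, heatKernel d (t - s) (y' - z) * f s z) y

section MixedNorm

open Filter Topology

variable {S Y : Type*} [MeasurableSpace S] [MeasurableSpace Y]

/-- **Minkowski's integral inequality**. -/
theorem lintegral_rpow_lintegral_le {μ : Measure S} {ν : Measure Y} [SigmaFinite μ] [SigmaFinite ν]
    {q : ℝ} (hq : 1 < q) {F : S → Y → ℝ≥0∞} (hF : Measurable (Function.uncurry F)) :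
    (∫⁻ y, (∫⁻ s, F s y ∂μ) ^ q ∂ν) ^ (1 / q) ≤ ∫⁻ s, (∫⁻ y, F s y ^ q ∂ν) ^ (1 / q) ∂μ := by
  have hq0 : 0 < q := by linarith
  set A := ∫⁻ s, (∫⁻ y, F s y ^ q ∂ν) ^ (1 / q) ∂μ with hA
  have hFm : Measurable fun y => ∫⁻ s, F s y ∂μ := hF.lintegral_prod_left'
  set H : Y → ℝ≥0∞ := fun y => ∫⁻ s, F s y ∂μ with hH
  let Hn : ℕ → Y → ℝ≥0∞ := fun n => (spanningSets ν n).indicator fun y => min (H y) n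
  have hHnm : ∀ n, Measurable (Hn n) := fun n =>
    (hFm.min measurable_const).indicator (measurableSet_spanningSets ν n)
  have hHnH : ∀ n y, Hn n y ≤ H y := fun n y =>
    (indicator_le_self' (fun _ _ => zero_le) y).trans (min_le_left _ _)
  have hbound : ∀ n, ∫⁻ y, Hn n y ^ q ∂ν ≤ A ^ q := by
    intro n
    set X := ∫⁻ y, Hn n y ^ q ∂ν with hX
    have hXtop : X ≠ ∞ := by
      have : X ≤ ∫⁻ y, (spanningSets ν n).indicator (fun _ => (n : ℝ≥0∞) ^ q) y ∂ν := by
        refine lintegral_mono fun y => ?_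
        by_cases hy : y ∈ spanningSets ν n
        · simp only [Hn, indicator_of_mem hy]
          exact ENNReal.rpow_le_rpow (min_le_right _ _) hq0.le
        · simp [Hn, indicator_of_notMem hy, hq0]
      refine ne_top_of_le_ne_top ?_ this
      rw [lintegral_indicator_const (measurableSet_spanningSets ν n)]
      exact ENNReal.mul_ne_top (by simp [hq0.le])
        (measure_spanningSets_lt_top ν n).ne
    have hconj := Real.HolderConjugate.conjExponent hq
    set q' := q.conjExponent
    have hq' : (q - 1) * q' = q := by
      have := hconj.sub_one_mul_conj; linarith
    have h1 : X ≤ A * X ^ (1 / q') := by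
      calc X = ∫⁻ y, Hn n y * Hn n y ^ (q - 1) ∂ν := by
            refine lintegral_congr fun y => ?_
            nth_rw 2 [← ENNReal.rpow_one (Hn n y)]
            rw [← ENNReal.rpow_add_of_nonneg _ _ zero_le_one (by linarith)]
            congr 1; ring
        _ ≤ ∫⁻ y, (∫⁻ s, F s y * Hn n y ^ (q - 1) ∂μ) ∂ν := by
            refine lintegral_mono fun y => ?_
            have hm : Measurable fun s => F s y := hF.comp measurable_prodMk_right
            rw [lintegral_mul_const _ hm]
            exact mul_le_mul_left (hHnH n y) _
        _ = ∫⁻ s, (∫⁻ y, F s y * Hn n y ^ (q - 1) ∂ν) ∂μ := by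
            refine lintegral_lintegral_swap (f := fun y s => F s y * Hn n y ^ (q - 1)) ?_
            exact ((hF.comp measurable_swap).mul
              (((hHnm n).comp measurable_fst).pow_const _)).aemeasurable
        _ ≤ ∫⁻ s, (∫⁻ y, F s y ^ q ∂ν) ^ (1 / q) * X ^ (1 / q') ∂μ := by
            refine lintegral_mono fun s => ?_
            refine (ENNReal.lintegral_mul_le_Lp_mul_Lq ν hconj
              (hF.comp measurable_prodMk_left).aemeasurable
              ((hHnm n).pow_const (q - 1)).aemeasurable).trans (le_of_eq ?_)
            simp only [← ENNReal.rpow_mul, hq', hX]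
            rfl
        _ = A * X ^ (1 / q') := by
            have hm : Measurable fun s => (∫⁻ y, F s y ^ q ∂ν) ^ (1 / q) :=
              (hF.pow_const q).lintegral_prod_right'.pow_const _
            rw [lintegral_mul_const _ hm]
    rcases eq_or_ne X 0 with h0 | h0
    · simp [h0]
    have h2 : X ^ (1 / q) ≤ A := by
      have hX' : X ^ (1 / q') ≠ 0 := by
        simp [h0, hXtop]
      have hX'' : X ^ (1 / q') ≠ ∞ := ENNReal.rpow_ne_top_of_nonneg (by
        have := hconj.symm.pos; positivity) hXtop
      have : X ^ (1 / q) * X ^ (1 / q') = X := by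
        rw [← ENNReal.rpow_add _ _ h0 hXtop]
        have := hconj.inv_add_inv_eq_one
        rw [one_div, one_div, this, ENNReal.rpow_one]
      rw [← ENNReal.mul_le_mul_iff_left hX' hX'', this]
      exact h1
    calc X = (X ^ (1 / q)) ^ q := by
          rw [← ENNReal.rpow_mul, one_div_mul_cancel hq0.ne', ENNReal.rpow_one]
      _ ≤ A ^ q := ENNReal.rpow_le_rpow h2 hq0.le
  have hle : ∫⁻ y, H y ^ q ∂ν ≤ A ^ q := by
    calc ∫⁻ y, H y ^ q ∂ν ≤ ∫⁻ y, liminf (fun n => Hn n y ^ q) atTop ∂ν := by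
          refine lintegral_mono fun y => le_of_eq (Tendsto.liminf_eq ?_).symm
          refine (ENNReal.continuous_rpow_const.tendsto _).comp ?_
          have hmem : ∀ᶠ n in atTop, y ∈ spanningSets ν n := by
            have hy : y ∈ ⋃ n, spanningSets ν n := by simp [iUnion_spanningSets]
            obtain ⟨m, hm⟩ := mem_iUnion.1 hy
            filter_upwards [eventually_ge_atTop m] with n hn
            exact monotone_spanningSets ν hn hm
          have : Tendsto (fun n : ℕ => min (H y) (n : ℝ≥0∞)) atTop (𝓝 (min (H y) ∞)) :=
            tendsto_const_nhds.min ENNReal.tendsto_nat_nhds_top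
          rw [min_eq_left le_top] at this
          refine this.congr' ?_
          filter_upwards [hmem] with n hn
          simp [Hn, indicator_of_mem hn]
      _ ≤ liminf (fun n => ∫⁻ y, Hn n y ^ q ∂ν) atTop :=
          lintegral_liminf_le fun n => (hHnm n).pow_const q
      _ ≤ A ^ q := by
          refine (liminf_le_liminf (Eventually.of_forall hbound)).trans ?_
          simp
  calc (∫⁻ y, H y ^ q ∂ν) ^ (1 / q) ≤ (A ^ q) ^ (1 / q) :=
        ENNReal.rpow_le_rpow hle (by positivity)
    _ = A := by rw [← ENNReal.rpow_mul, mul_one_div_cancel hq0.ne', ENNReal.rpow_one]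

/-- The `L^q` norm of the slice `F (s, ·)`. -/
def sliceNorm (ν : Measure Y) (q : ℝ) (F : S × Y → ℝ≥0∞) (s : S) : ℝ≥0∞ :=
  (∫⁻ y, F (s, y) ^ q ∂ν) ^ (1 / q)

/-- The `r`-th power of the mixed norm of `F` in `L^r(S; L^q(Y))`. -/
def mixedEnergy (μ : Measure S) (ν : Measure Y) (r q : ℝ) (F : S × Y → ℝ≥0∞) : ℝ≥0∞ :=
  ∫⁻ s, sliceNorm ν q F s ^ r ∂μ

variable {μ : Measure S} {ν : Measure Y} {q r : ℝ}

theorem measurable_sliceNorm [SFinite ν] {F : S × Y → ℝ≥0∞} (hF : Measurable F) :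
    Measurable (sliceNorm ν q F) :=
  (hF.pow_const q).lintegral_prod_right'.pow_const _

theorem sliceNorm_rpow (hq : 0 < q) (F : S × Y → ℝ≥0∞) (s : S) :
    sliceNorm ν q F s ^ q = ∫⁻ y, F (s, y) ^ q ∂ν := by
  rw [sliceNorm, ← ENNReal.rpow_mul, one_div_mul_cancel hq.ne', ENNReal.rpow_one]

theorem sliceNorm_mono_ae (hq : 0 < q) {F G : S × Y → ℝ≥0∞} {s : S}
    (h : ∀ᵐ y ∂ν, F (s, y) ≤ G (s, y)) : sliceNorm ν q F s ≤ sliceNorm ν q G s :=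
  ENNReal.rpow_le_rpow (lintegral_mono_ae (h.mono fun _ hy => ENNReal.rpow_le_rpow hy hq.le))
    (by positivity)

theorem sliceNorm_mono (hq : 0 < q) {F G : S × Y → ℝ≥0∞} {s : S}
    (h : ∀ y, F (s, y) ≤ G (s, y)) : sliceNorm ν q F s ≤ sliceNorm ν q G s :=
  sliceNorm_mono_ae hq (Eventually.of_forall h)

theorem sliceNorm_add_le (hq : 1 ≤ q) {F G : S × Y → ℝ≥0∞} (hF : Measurable F) (hG : Measurable G)
    (s : S) : sliceNorm ν q (fun x => F x + G x) s ≤ sliceNorm ν q F s + sliceNorm ν q G s :=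
  ENNReal.lintegral_Lp_add_le (hF.comp measurable_prodMk_left).aemeasurable
    (hG.comp measurable_prodMk_left).aemeasurable hq

theorem mixedEnergy_mono_ae [SFinite ν] (hq : 0 < q) (hr : 0 < r) {F G : S × Y → ℝ≥0∞}
    (h : ∀ᵐ x ∂μ.prod ν, F x ≤ G x) : mixedEnergy μ ν r q F ≤ mixedEnergy μ ν r q G := by
  refine lintegral_mono_ae ?_
  filter_upwards [Measure.ae_ae_of_ae_prod h] with s hs
  exact ENNReal.rpow_le_rpow (sliceNorm_mono_ae hq hs) hr.le

theorem mixedEnergy_self [SFinite ν] (hq : 0 < q) {F : S × Y → ℝ≥0∞} (hF : Measurable F) :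
    mixedEnergy μ ν q q F = ∫⁻ x, F x ^ q ∂μ.prod ν := by
  rw [lintegral_prod _ (hF.pow_const q).aemeasurable]
  exact lintegral_congr fun s => sliceNorm_rpow hq F s

theorem mixedEnergy_liminf_le [SFinite ν] (hq : 0 < q) (hr : 0 < r) {F : ℕ → S × Y → ℝ≥0∞}
    (hF : ∀ n, Measurable (F n)) :
    mixedEnergy μ ν r q (fun x => liminf (fun n => F n x) atTop) ≤
      liminf (fun n => mixedEnergy μ ν r q (F n)) atTop := by
  have hpow : ∀ {a : ℝ}, 0 < a → ∀ u : ℕ → ℝ≥0∞,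
      (liminf u atTop) ^ a = liminf (fun n => u n ^ a) atTop := fun ha u =>
    (ENNReal.monotone_rpow_of_nonneg ha.le).map_liminf_of_continuousAt u
      ENNReal.continuous_rpow_const.continuousAt
  calc mixedEnergy μ ν r q (fun x => liminf (fun n => F n x) atTop)
      ≤ ∫⁻ s, liminf (fun n => sliceNorm ν q (F n) s ^ r) atTop ∂μ := by
        refine lintegral_mono fun s => ?_
        rw [← hpow hr]
        refine ENNReal.rpow_le_rpow ?_ hr.le
        simp only [sliceNorm]
        rw [← hpow (by positivity)]
        refine ENNReal.rpow_le_rpow ?_ (by positivity)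
        simp only [hpow hq]
        exact lintegral_liminf_le fun n => ((hF n).comp measurable_prodMk_left).pow_const q
    _ ≤ _ := lintegral_liminf_le fun n => (measurable_sliceNorm (hF n)).pow_const r

theorem ae_lt_top_of_mixedEnergy [SFinite ν] (hq : 0 < q) (hr : 0 < r) {F : S × Y → ℝ≥0∞}
    (hF : Measurable F) (h : mixedEnergy μ ν r q F < ∞) : ∀ᵐ x ∂μ.prod ν, F x < ∞ := by
  rw [Measure.ae_prod_iff_ae_ae (measurableSet_lt hF measurable_const)]
  filter_upwards [ae_lt_top ((measurable_sliceNorm (ν := ν) (q := q) hF).pow_const r) h.ne]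
    with s hs
  have h1 : sliceNorm ν q F s ^ q < ∞ := by
    refine ENNReal.rpow_lt_top_of_nonneg hq.le ?_
    rintro h0
    simp [h0, hr] at hs
  rw [sliceNorm_rpow hq] at h1
  filter_upwards [ae_lt_top ((hF.comp measurable_prodMk_left).pow_const q) h1.ne] with y hy
  by_contra h2
  simp only [not_lt, top_le_iff] at h2
  simp [h2, hq] at hy

end MixedNorm

section Young

open Filter Topology

variable {G : Type*} [AddCommGroup G] [MeasurableSpace G]

/-- The convolution `x ↦ ∫ k (x - w) f (w) dw` of two real functions. -/
def kernelConv (m : Measure G) (k f : G → ℝ) (x : G) : ℝ := ∫ w, k (x - w) * f w ∂m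

/-- The convolution `x ↦ ∫ k (x - w) f (w) dw` of two functions with values in `[0, ∞]`. -/
def lowerConv (m : Measure G) (k f : G → ℝ≥0∞) (x : G) : ℝ≥0∞ := ∫⁻ w, k (x - w) * f w ∂m

theorem enorm_kernelConv_le (m : Measure G) (k f : G → ℝ) (x : G) :
    ‖kernelConv m k f x‖ₑ ≤ lowerConv m (fun w => ‖k w‖ₑ) (fun w => ‖f w‖ₑ) x := by
  refine (enorm_integral_le_lintegral_enorm _).trans (le_of_eq ?_)
  simp [lowerConv, enorm_mul]

section

variable [MeasurableSub₂ G] {m : Measure G} [SFinite m]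

theorem measurable_kernelConv {k f : G → ℝ} (hk : Measurable k) (hf : Measurable f) :
    Measurable (kernelConv m k f) := by
  have : Measurable (Function.uncurry fun x w => k (x - w) * f w) :=
    (hk.comp measurable_sub).mul (hf.comp measurable_snd)
  exact (this.stronglyMeasurable.integral_prod_right (ν := m)).measurable

theorem measurable_lowerConv {k f : G → ℝ≥0∞} (hk : Measurable k) (hf : Measurable f) :
    Measurable (lowerConv m k f) := by
  have : Measurable (Function.uncurry fun x w => k (x - w) * f w) :=
    (hk.comp measurable_sub).mul (hf.comp measurable_snd)
  exact this.lintegral_prod_right'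

end

/-- **Young's convolution inequality** `L¹ * L^q ⊆ L^q`. -/
theorem lintegral_rpow_lowerConv_le [MeasurableAdd₂ G] [MeasurableNeg G] {m : Measure G} [SigmaFinite m]
    [m.IsAddLeftInvariant] [m.IsNegInvariant] {q : ℝ} (hq : 1 < q) {k f : G → ℝ≥0∞}
    (hk : Measurable k) (hf : Measurable f) :
    (∫⁻ y, lowerConv m k f y ^ q ∂m) ^ (1 / q) ≤
      (∫⁻ y, k y ∂m) * (∫⁻ y, f y ^ q ∂m) ^ (1 / q) := by
  have hq0 : 0 < q := by linarith
  have h1 : ∀ y, lowerConv m k f y = ∫⁻ z, k z * f (y - z) ∂m := by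
    intro y
    rw [lowerConv, ← lintegral_sub_left_eq_self _ y]
    simp
  simp only [h1]
  refine (lintegral_rpow_lintegral_le hq (F := fun z y => k z * f (y - z)) ?_).trans ?_
  · exact (hk.comp measurable_fst).mul (hf.comp (measurable_snd.sub measurable_fst))
  · rw [← lintegral_mul_const _ hk]
    refine lintegral_mono fun z => ?_
    simp only [ENNReal.mul_rpow_of_nonneg _ _ hq0.le]
    have hm : Measurable fun y => f (y - z) ^ q := (hf.comp (measurable_id.sub_const z)).pow_const q
    rw [lintegral_const_mul _ hm,
      ENNReal.mul_rpow_of_nonneg _ _ (by positivity), ← ENNReal.rpow_mul,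
      mul_one_div_cancel hq0.ne', ENNReal.rpow_one,
      lintegral_sub_right_eq_self (fun y => f y ^ q) z]

end Young

instance Prod.instMeasurableSub₂ {S Y : Type*} [MeasurableSpace S] [MeasurableSpace Y] [Sub S]
    [Sub Y] [MeasurableSub₂ S] [MeasurableSub₂ Y] : MeasurableSub₂ (S × Y) :=
  ⟨((measurable_fst.comp measurable_fst).sub (measurable_fst.comp measurable_snd)).prodMk
    ((measurable_snd.comp measurable_fst).sub (measurable_snd.comp measurable_snd))⟩

section MixedYoung

open Filter Topology

variable {S Y : Type*} [MeasurableSpace S] [MeasurableSpace Y] [AddCommGroup Y]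
  [MeasurableAdd₂ Y] [MeasurableNeg Y]
  {μ : Measure S} {ν : Measure Y} [SigmaFinite μ] [SigmaFinite ν]
  [ν.IsAddLeftInvariant] [ν.IsNegInvariant] {q r : ℝ}

theorem lintegral_rpow_lintegral_conv_le (hq : 1 < q) {L : S → Y → ℝ≥0∞} {F : S × Y → ℝ≥0∞}
    (hL : Measurable (Function.uncurry L)) (hF : Measurable F) :
    (∫⁻ y, (∫⁻ s, ∫⁻ z, L s (y - z) * F (s, z) ∂ν ∂μ) ^ q ∂ν) ^ (1 / q) ≤
      ∫⁻ s, (∫⁻ y, L s y ∂ν) * sliceNorm ν q F s ∂μ := by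
  refine (lintegral_rpow_lintegral_le hq
    (F := fun s y => ∫⁻ z, L s (y - z) * F (s, z) ∂ν) ?_).trans ?_
  · have : Measurable fun p : (S × Y) × Y => L p.1.1 (p.1.2 - p.2) * F (p.1.1, p.2) :=
      (hL.comp ((measurable_fst.comp measurable_fst).prodMk
        ((measurable_snd.comp measurable_fst).sub measurable_snd))).mul
      (hF.comp ((measurable_fst.comp measurable_fst).prodMk measurable_snd))
    exact this.lintegral_prod_right'
  · refine lintegral_mono fun s => ?_
    exact lintegral_rpow_lowerConv_le hq (k := L s) (f := fun z => F (s, z))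
      (hL.comp measurable_prodMk_left) (hF.comp measurable_prodMk_left)

variable [AddCommGroup S] [MeasurableAdd₂ S] [MeasurableNeg S] [μ.IsAddLeftInvariant]
  [μ.IsNegInvariant]

theorem sliceNorm_lowerConv_le (hq : 1 < q) {K F : S × Y → ℝ≥0∞}
    (hK : Measurable K) (hF : Measurable F) (s : S) :
    sliceNorm ν q (lowerConv (μ.prod ν) K F) s ≤
      lowerConv μ (fun s => ∫⁻ y, K (s, y) ∂ν) (sliceNorm ν q F) s := by
  refine le_trans (le_of_eq ?_) (lintegral_rpow_lintegral_conv_le hq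
    (L := fun s' y => K (s - s', y)) (F := F) ?_ hF)
  · simp only [sliceNorm, lowerConv]
    congr 2 with y
    rw [lintegral_prod]
    · rfl
    · exact ((hK.comp (measurable_const.sub measurable_id)).mul hF).aemeasurable
  · exact hK.comp ((measurable_const.sub measurable_fst).prodMk measurable_snd)

theorem mixedEnergy_lowerConv_le (hq : 1 < q) (hr : 1 < r) {K F : S × Y → ℝ≥0∞}
    (hK : Measurable K) (hF : Measurable F) :
    mixedEnergy μ ν r q (lowerConv (μ.prod ν) K F) ≤
      (∫⁻ x, K x ∂μ.prod ν) ^ r * mixedEnergy μ ν r q F := by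
  have hr0 : 0 < r := by linarith
  have h := lintegral_rpow_lowerConv_le (m := μ) hr
    (hK.lintegral_prod_right' (ν := ν)) (measurable_sliceNorm (ν := ν) (q := q) hF)
  calc mixedEnergy μ ν r q (lowerConv (μ.prod ν) K F)
      ≤ ∫⁻ s, lowerConv μ (fun s => ∫⁻ y, K (s, y) ∂ν) (sliceNorm ν q F) s ^ r ∂μ :=
        lintegral_mono fun s => ENNReal.rpow_le_rpow (sliceNorm_lowerConv_le hq hK hF s) hr0.le
    _ = ((∫⁻ s, lowerConv μ (fun s => ∫⁻ y, K (s, y) ∂ν) (sliceNorm ν q F) s ^ r ∂μ)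
          ^ (1 / r)) ^ r := by
        rw [← ENNReal.rpow_mul, one_div_mul_cancel hr0.ne', ENNReal.rpow_one]
    _ ≤ _ := ENNReal.rpow_le_rpow h hr0.le
    _ = _ := by
        rw [ENNReal.mul_rpow_of_nonneg _ _ hr0.le, ← ENNReal.rpow_mul,
          one_div_mul_cancel hr0.ne', ENNReal.rpow_one, lintegral_prod _ hK.aemeasurable]
        rfl

theorem ae_integrable_kernelConv (hq : 1 < q) (hr : 1 < r) {k f : S × Y → ℝ}
    (hk : Measurable k) (hki : Integrable k (μ.prod ν)) (hf : Measurable f)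
    (hfi : mixedEnergy μ ν r q (fun x => ‖f x‖ₑ) < ∞) :
    ∀ᵐ x ∂μ.prod ν, Integrable (fun w => k (x - w) * f w) (μ.prod ν) := by
  have h1 : mixedEnergy μ ν r q
      (lowerConv (μ.prod ν) (fun w => ‖k w‖ₑ) (fun w => ‖f w‖ₑ)) < ∞ := by
    refine (mixedEnergy_lowerConv_le hq hr hk.enorm hf.enorm).trans_lt ?_
    refine ENNReal.mul_lt_top (ENNReal.rpow_lt_top_of_nonneg (by linarith) ?_) hfi
    exact hki.hasFiniteIntegral.ne
  filter_upwards [ae_lt_top_of_mixedEnergy (by linarith) (by linarith)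
    (measurable_lowerConv hk.enorm hf.enorm) h1] with x hx
  refine ⟨((hk.comp (measurable_const.sub measurable_id)).mul hf).aestronglyMeasurable, ?_⟩
  simpa [HasFiniteIntegral, enorm_mul, lowerConv] using hx

/-- Convolution with `k` is bounded on `L^r(S; L^q(Y))`. -/
def MixedBound (μ : Measure S) (ν : Measure Y) (k : S × Y → ℝ) (r q : ℝ) (C : ℝ≥0∞) : Prop :=
  ∀ f : S × Y → ℝ, Measurable f → mixedEnergy μ ν r q (fun x => ‖f x‖ₑ) < ∞ →
    mixedEnergy μ ν r q (fun x => ‖kernelConv (μ.prod ν) k f x‖ₑ) ≤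
      C * mixedEnergy μ ν r q (fun x => ‖f x‖ₑ)

theorem MixedBound.of_bounded (hq : 1 < q) (hr : 1 < r) {k : S × Y → ℝ}
    (hk : Measurable k) (hki : Integrable k (μ.prod ν)) {C : ℝ≥0∞}
    (h : ∀ f : S × Y → ℝ, Measurable f → (∃ M, ∀ x, ‖f x‖ ≤ M) →
      μ.prod ν (Function.support f) < ∞ →
      mixedEnergy μ ν r q (fun x => ‖f x‖ₑ) < ∞ →
      mixedEnergy μ ν r q (fun x => ‖kernelConv (μ.prod ν) k f x‖ₑ) ≤
        C * mixedEnergy μ ν r q (fun x => ‖f x‖ₑ)) :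
    MixedBound μ ν k r q C := by
  intro f hf hfi
  have hq0 : 0 < q := by linarith
  have hr0 : 0 < r := by linarith
  let A : ℕ → Set (S × Y) := fun n => {x | ‖f x‖ ≤ n} ∩ spanningSets (μ.prod ν) n
  have hA : ∀ n, MeasurableSet (A n) := fun n =>
    (measurableSet_le hf.norm measurable_const).inter (measurableSet_spanningSets _ n)
  have hAev : ∀ x, ∀ᶠ n in atTop, x ∈ A n := by
    intro x
    have hx : x ∈ ⋃ n, spanningSets (μ.prod ν) n := by simp [iUnion_spanningSets]
    obtain ⟨a, ha⟩ := mem_iUnion.1 hx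
    obtain ⟨b, hb⟩ := exists_nat_ge ‖f x‖
    filter_upwards [eventually_ge_atTop a, eventually_ge_atTop b] with n hn hn'
    exact ⟨hb.trans (by exact_mod_cast hn'), monotone_spanningSets _ hn ha⟩
  let fn : ℕ → S × Y → ℝ := fun n => (A n).indicator f
  have hfn : ∀ n, Measurable (fn n) := fun n => hf.indicator (hA n)
  have hle : ∀ n x, ‖fn n x‖ₑ ≤ ‖f x‖ₑ := fun n x => enorm_indicator_le_enorm_self _ _
  have hen : ∀ n, mixedEnergy μ ν r q (fun x => ‖fn n x‖ₑ) ≤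
      mixedEnergy μ ν r q (fun x => ‖f x‖ₑ) := fun n =>
    mixedEnergy_mono_ae hq0 hr0 (Eventually.of_forall fun x => hle n x)
  have hb : ∀ n, mixedEnergy μ ν r q (fun x => ‖kernelConv (μ.prod ν) k (fn n) x‖ₑ) ≤
      C * mixedEnergy μ ν r q (fun x => ‖f x‖ₑ) := by
    intro n
    refine (h (fn n) (hfn n) ⟨n, fun x => ?_⟩ ?_ ((hen n).trans_lt hfi)).trans
      (mul_le_mul_right (hen n) _)
    · by_cases hx : x ∈ A n
      · simpa [fn, indicator_of_mem hx] using hx.1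
      · simp [fn, indicator_of_notMem hx]
    · refine (measure_mono ?_).trans_lt (measure_spanningSets_lt_top (μ.prod ν) n)
      exact (support_indicator_subset).trans inter_subset_right
  calc mixedEnergy μ ν r q (fun x => ‖kernelConv (μ.prod ν) k f x‖ₑ)
      ≤ mixedEnergy μ ν r q
          (fun x => liminf (fun n => ‖kernelConv (μ.prod ν) k (fn n) x‖ₑ) atTop) := by
        refine mixedEnergy_mono_ae hq0 hr0 ?_
        filter_upwards [ae_integrable_kernelConv hq hr hk hki hf hfi] with x hx
        refine le_of_eq (Tendsto.liminf_eq ?_).symm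
        refine (continuous_enorm.tendsto _).comp ?_
        refine tendsto_integral_of_dominated_convergence (fun w => ‖k (x - w) * f w‖)
          (fun n => ((hk.comp (measurable_const.sub measurable_id)).mul
            (hfn n)).aestronglyMeasurable) hx.norm (fun n => Eventually.of_forall fun w => ?_)
          (Eventually.of_forall fun w => ?_)
        · rw [norm_mul, norm_mul]
          exact mul_le_mul_of_nonneg_left (norm_indicator_le_norm_self _ _) (norm_nonneg _)
        · refine tendsto_const_nhds.congr' ?_
          filter_upwards [hAev w] with n hn
          simp [fn, indicator_of_mem hn]
    _ ≤ _ := mixedEnergy_liminf_le hq0 hr0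
          fun n => (measurable_kernelConv hk (hfn n)).enorm
    _ ≤ _ := by
        refine (liminf_le_liminf (Eventually.of_forall hb)).trans ?_
        simp

end MixedYoung

instance Prod.instMeasurableNeg {S Y : Type*} [MeasurableSpace S] [MeasurableSpace Y] [Neg S]
    [Neg Y] [MeasurableNeg S] [MeasurableNeg Y] : MeasurableNeg (S × Y) :=
  ⟨measurable_fst.neg.prodMk measurable_snd.neg⟩

instance Measure.prod.instIsNegInvariant {S Y : Type*} [MeasurableSpace S] [MeasurableSpace Y]
    [AddGroup S] [AddGroup Y] [MeasurableNeg S] [MeasurableNeg Y] (μ : Measure S) (ν : Measure Y)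
    [SigmaFinite μ] [SigmaFinite ν] [μ.IsNegInvariant] [ν.IsNegInvariant] :
    (μ.prod ν).IsNegInvariant :=
  ⟨((Measure.measurePreserving_neg μ).prod (Measure.measurePreserving_neg ν)).map_eq⟩

section Duality

open Filter Topology

variable {S Y : Type*} [MeasurableSpace S] [MeasurableSpace Y]
  {μ : Measure S} {ν : Measure Y} {q r q' r' : ℝ} [SigmaFinite μ] [SigmaFinite ν]

/-- **Hölder's inequality** for mixed norms. -/
theorem lintegral_mul_le_mixedEnergy (hr : r.HolderConjugate r') (hq : q.HolderConjugate q')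
    {F G : S × Y → ℝ≥0∞} (hF : Measurable F) (hG : Measurable G) :
    ∫⁻ x, F x * G x ∂μ.prod ν ≤
      mixedEnergy μ ν r q F ^ (1 / r) * mixedEnergy μ ν r' q' G ^ (1 / r') := by
  have hm : Measurable fun x => F x * G x := hF.mul hG
  rw [lintegral_prod _ hm.aemeasurable]
  calc ∫⁻ s, ∫⁻ y, F (s, y) * G (s, y) ∂ν ∂μ
      ≤ ∫⁻ s, sliceNorm ν q F s * sliceNorm ν q' G s ∂μ := lintegral_mono fun s =>
        ENNReal.lintegral_mul_le_Lp_mul_Lq ν hq (hF.comp measurable_prodMk_left).aemeasurable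
          (hG.comp measurable_prodMk_left).aemeasurable
    _ ≤ _ := ENNReal.lintegral_mul_le_Lp_mul_Lq μ hr (measurable_sliceNorm hF).aemeasurable
          (measurable_sliceNorm hG).aemeasurable

/-- The function at which the mixed Hölder inequality is attained, for a given first factor `F`. -/
def dualFunction (ν : Measure Y) (r q : ℝ) (F : S × Y → ℝ) (x : S × Y) : ℝ :=
  F x * ‖F x‖ ^ (q - 2) * (sliceNorm ν q (fun x => ‖F x‖ₑ) x.1).toReal ^ (r - q)

theorem measurable_dualFunction {F : S × Y → ℝ} (hF : Measurable F) :
    Measurable (dualFunction ν r q F) :=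
  (hF.mul (hF.norm.pow_const _)).mul
    (((measurable_sliceNorm hF.enorm).comp measurable_fst).ennreal_toReal.pow_const _)

theorem enorm_dualFunction (hq : 1 < q) {F : S × Y → ℝ} {x : S × Y}
    (h0 : sliceNorm ν q (fun x => ‖F x‖ₑ) x.1 ≠ 0) (h1 : sliceNorm ν q (fun x => ‖F x‖ₑ) x.1 ≠ ∞) :
    ‖dualFunction ν r q F x‖ₑ =
      ‖F x‖ₑ ^ (q - 1) * sliceNorm ν q (fun x => ‖F x‖ₑ) x.1 ^ (r - q) := by
  set N := sliceNorm ν q (fun x => ‖F x‖ₑ) x.1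
  have hN : 0 < N.toReal := ENNReal.toReal_pos h0 h1
  have e1 : ‖N.toReal ^ (r - q)‖ₑ = N ^ (r - q) := by
    rw [Real.enorm_of_nonneg (by positivity), ← ENNReal.ofReal_rpow_of_pos hN,
      ENNReal.ofReal_toReal h1]
  have e2 : ‖F x * ‖F x‖ ^ (q - 2)‖ₑ = ‖F x‖ₑ ^ (q - 1) := by
    rcases eq_or_ne (F x) 0 with hx | hx
    · simp [hx, hq]
    · have hx' : 0 < ‖F x‖ := norm_pos_iff.2 hx
      rw [enorm_mul, Real.enorm_of_nonneg (by positivity : 0 ≤ ‖F x‖ ^ (q - 2)),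
        ← ENNReal.ofReal_rpow_of_pos hx', ofReal_norm]
      nth_rw 1 [← ENNReal.rpow_one ‖F x‖ₑ]
      rw [← ENNReal.rpow_add _ _ (by simpa using hx) enorm_ne_top]
      congr 1; ring
  rw [dualFunction, enorm_mul, e1, e2]

theorem sliceNorm_dualFunction_le (hq : q.HolderConjugate q') {F : S × Y → ℝ}
    (hF : Measurable F) {s : S} (h1 : sliceNorm ν q (fun x => ‖F x‖ₑ) s ≠ ∞) :
    sliceNorm ν q' (fun x => ‖dualFunction ν r q F x‖ₑ) s ≤
      sliceNorm ν q (fun x => ‖F x‖ₑ) s ^ (r - 1) := by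
  have hq0 := hq.pos
  have hq0' := hq.symm.pos
  rcases eq_or_ne (sliceNorm ν q (fun x => ‖F x‖ₑ) s) 0 with h0 | h0
  · have h2 : ∫⁻ y, ‖F (s, y)‖ₑ ^ q ∂ν = 0 := by
      rw [← sliceNorm_rpow hq0 (fun x => ‖F x‖ₑ), h0, ENNReal.zero_rpow_of_pos hq0]
    have hm : Measurable fun y => ‖F (s, y)‖ₑ ^ q :=
      ((hF.comp measurable_prodMk_left).enorm).pow_const q
    rw [lintegral_eq_zero_iff hm] at h2
    refine le_trans (le_of_eq ?_) zero_le
    rw [sliceNorm]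
    have : (0 : ℝ≥0∞) ^ (1 / q') = 0 := ENNReal.zero_rpow_of_pos (by positivity)
    rw [← this]
    congr 1
    rw [lintegral_eq_zero_iff']
    · filter_upwards [h2] with y hy
      simp only [Pi.zero_apply, ENNReal.rpow_eq_zero_iff, enorm_eq_zero, enorm_ne_top,
        false_and, or_false] at hy ⊢
      exact ⟨by simp [dualFunction, hy.1], hq0'⟩
    · exact (((measurable_dualFunction hF).comp measurable_prodMk_left).enorm.pow_const
        _).aemeasurable
  · refine le_of_eq ?_
    have hm : Measurable fun y => ‖F (s, y)‖ₑ ^ q :=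
      ((hF.comp measurable_prodMk_left).enorm).pow_const q
    rw [sliceNorm]
    simp only [fun y => enorm_dualFunction (r := r) hq.lt (x := (s, y)) h0 h1,
      ENNReal.mul_rpow_of_nonneg _ _ hq0'.le, ← ENNReal.rpow_mul, hq.sub_one_mul_conj]
    rw [lintegral_mul_const _ hm, ← sliceNorm_rpow hq0 (fun x => ‖F x‖ₑ),
      ← ENNReal.rpow_add _ _ h0 h1, ← ENNReal.rpow_mul]
    congr 1
    have := hq.sub_one_mul_conj
    field_simp
    linarith

theorem le_lintegral_mul_dualFunction (hq : 1 < q) (hr : 0 < r) {F : S × Y → ℝ}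
    (hF : Measurable F) {s : S} (h1 : sliceNorm ν q (fun x => ‖F x‖ₑ) s ≠ ∞) :
    sliceNorm ν q (fun x => ‖F x‖ₑ) s ^ r ≤
      ∫⁻ y, ‖F (s, y)‖ₑ * ‖dualFunction ν r q F (s, y)‖ₑ ∂ν := by
  have hq0 : 0 < q := by linarith
  rcases eq_or_ne (sliceNorm ν q (fun x => ‖F x‖ₑ) s) 0 with h0 | h0
  · simp [h0, hr]
  have hm : Measurable fun y => ‖F (s, y)‖ₑ ^ q :=
    ((hF.comp measurable_prodMk_left).enorm).pow_const q
  refine le_of_eq ?_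
  have : ∀ y, ‖F (s, y)‖ₑ * ‖dualFunction ν r q F (s, y)‖ₑ =
      ‖F (s, y)‖ₑ ^ q * sliceNorm ν q (fun x => ‖F x‖ₑ) s ^ (r - q) := fun y => by
    rw [enorm_dualFunction (r := r) hq (x := (s, y)) h0 h1, ← mul_assoc]
    congr 1
    nth_rw 1 [← ENNReal.rpow_one ‖F (s, y)‖ₑ]
    rw [← ENNReal.rpow_add_of_nonneg _ _ zero_le_one (by linarith)]
    congr 1; ring
  simp only [this]
  rw [lintegral_mul_const _ hm, ← sliceNorm_rpow hq0 (fun x => ‖F x‖ₑ),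
    ← ENNReal.rpow_add _ _ h0 h1]
  congr 1; ring

theorem mul_dualFunction_nonneg (F : S × Y → ℝ) (x : S × Y) :
    0 ≤ F x * dualFunction ν r q F x := by
  have : F x * dualFunction ν r q F x = (F x * F x) * (‖F x‖ ^ (q - 2) *
      (sliceNorm ν q (fun x => ‖F x‖ₑ) x.1).toReal ^ (r - q)) := by
    rw [dualFunction]; ring
  rw [this]
  exact mul_nonneg (mul_self_nonneg _) (by positivity)

variable [AddCommGroup Y] [MeasurableAdd₂ Y] [MeasurableNeg Y]
  [ν.IsAddLeftInvariant] [ν.IsNegInvariant]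
  [AddCommGroup S] [MeasurableAdd₂ S] [MeasurableNeg S] [μ.IsAddLeftInvariant]
  [μ.IsNegInvariant]

theorem mixedEnergy_comp_neg (F : S × Y → ℝ≥0∞) :
    mixedEnergy μ ν r q (fun x => F (-x)) = mixedEnergy μ ν r q F := by
  have h : ∀ s, sliceNorm ν q (fun x => F (-x)) s = sliceNorm ν q F (-s) := fun s => by
    simp only [sliceNorm, Prod.neg_mk]
    rw [lintegral_neg_eq_self (fun y => F (-s, y) ^ q)]
  simp only [mixedEnergy, h]
  exact lintegral_neg_eq_self (fun s => sliceNorm ν q F s ^ r)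

theorem MixedBound.dual (hr : r.HolderConjugate r') (hq : q.HolderConjugate q')
    {k : S × Y → ℝ} (hk : Measurable k) (hki : Integrable k (μ.prod ν)) {C : ℝ≥0∞}
    (h : MixedBound μ ν k r q C) : MixedBound μ ν k r' q' (C ^ (r' / r)) := by
  intro f hf hfi
  have hr0 := hr.pos
  have hr0' := hr.symm.pos
  set F := kernelConv (μ.prod ν) k f with hFdef
  have hF : Measurable F := measurable_kernelConv hk hf
  have hYoung : mixedEnergy μ ν r' q'
      (lowerConv (μ.prod ν) (fun w => ‖k w‖ₑ) (fun w => ‖f w‖ₑ)) < ∞ := by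
    refine (mixedEnergy_lowerConv_le hq.symm.lt hr.symm.lt hk.enorm hf.enorm).trans_lt ?_
    refine ENNReal.mul_lt_top (ENNReal.rpow_lt_top_of_nonneg hr0'.le ?_) hfi
    exact hki.hasFiniteIntegral.ne
  set X := mixedEnergy μ ν r' q' (fun x => ‖F x‖ₑ) with hX
  have hXtop : X < ∞ := lt_of_le_of_lt (mixedEnergy_mono_ae hq.symm.pos hr0'
    (Eventually.of_forall fun x => enorm_kernelConv_le _ _ _ _)) hYoung
  have hNfin : ∀ᵐ s ∂μ, sliceNorm ν q' (fun x => ‖F x‖ₑ) s ≠ ∞ := by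
    filter_upwards [ae_lt_top ((measurable_sliceNorm (ν := ν) (q := q') hF.enorm).pow_const r')
      hXtop.ne] with s hs h0
    simp [h0, hr0'] at hs
  set g := dualFunction ν r' q' F with hg
  have hgm : Measurable g := measurable_dualFunction hF
  have hgE : mixedEnergy μ ν r q (fun x => ‖g x‖ₑ) ≤ X := by
    refine lintegral_mono_ae ?_
    filter_upwards [hNfin] with s hs
    refine (ENNReal.rpow_le_rpow (sliceNorm_dualFunction_le hq.symm hF hs)
      hr0.le).trans (le_of_eq ?_)
    rw [← ENNReal.rpow_mul, hr.symm.sub_one_mul_conj]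
  have hFg : X ≤ ∫⁻ x, ‖F x‖ₑ * ‖g x‖ₑ ∂μ.prod ν := by
    have hm : Measurable fun x => ‖F x‖ₑ * ‖g x‖ₑ := hF.enorm.mul hgm.enorm
    rw [lintegral_prod _ hm.aemeasurable]
    refine lintegral_mono_ae ?_
    filter_upwards [hNfin] with s hs
    exact le_lintegral_mul_dualFunction hq.symm.lt hr0' hF hs
  set gn : S × Y → ℝ := fun x => g (-x)
  have hgnm : Measurable gn := hgm.comp measurable_neg
  have hgnE : mixedEnergy μ ν r q (fun x => ‖gn x‖ₑ) ≤ X := by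
    rwa [mixedEnergy_comp_neg (fun x => ‖g x‖ₑ)]
  have hTg := h gn hgnm (hgnE.trans_lt hXtop)
  set P := kernelConv (μ.prod ν) k gn with hP
  have hPm : Measurable P := measurable_kernelConv hk hgnm
  have hadj : ∀ w, P (-w) = ∫ x, k (x - w) * g x ∂μ.prod ν := by
    intro w
    rw [hP, kernelConv, ← integral_neg_eq_self]
    refine integral_congr_ae (Eventually.of_forall fun x => ?_)
    simp only [gn, neg_neg]
    congr 2; abel
  have hInt : Integrable (Function.uncurry fun x w => k (x - w) * f w * g x)
      ((μ.prod ν).prod (μ.prod ν)) := by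
    have hm : Measurable (Function.uncurry fun x w => k (x - w) * f w * g x) :=
      ((hk.comp measurable_sub).mul (hf.comp measurable_snd)).mul (hgm.comp measurable_fst)
    refine ⟨hm.aestronglyMeasurable, ?_⟩
    rw [HasFiniteIntegral, lintegral_prod _ hm.enorm.aemeasurable]
    have hm2 : ∀ x, Measurable fun w => ‖k (x - w)‖ₑ * ‖f w‖ₑ := fun x =>
      (hk.comp (measurable_const.sub measurable_id)).enorm.mul hf.enorm
    simp only [Function.uncurry_apply_pair, enorm_mul,
      fun x => lintegral_mul_const (μ := μ.prod ν) ‖g x‖ₑ (hm2 x)]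
    refine (lintegral_mul_le_mixedEnergy hr.symm hq.symm
      (measurable_lowerConv hk.enorm hf.enorm) hgm.enorm).trans_lt ?_
    exact ENNReal.mul_lt_top (ENNReal.rpow_lt_top_of_nonneg (by positivity) hYoung.ne)
      (ENNReal.rpow_lt_top_of_nonneg (by positivity) (hgE.trans_lt hXtop).ne)
  have hswap : ∫ x, F x * g x ∂μ.prod ν = ∫ w, f w * P (-w) ∂μ.prod ν := by
    calc ∫ x, F x * g x ∂μ.prod ν = ∫ x, ∫ w, k (x - w) * f w * g x ∂μ.prod ν ∂μ.prod ν := by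
          refine integral_congr_ae (Eventually.of_forall fun x => ?_)
          simp only [hFdef, kernelConv]
          rw [integral_mul_const]
      _ = ∫ w, ∫ x, k (x - w) * f w * g x ∂μ.prod ν ∂μ.prod ν := integral_integral_swap hInt
      _ = _ := by
          refine integral_congr_ae (Eventually.of_forall fun w => ?_)
          simp only [hadj]
          rw [← integral_const_mul]
          refine integral_congr_ae (Eventually.of_forall fun x => ?_)
          simp only; ring
  have hFgi : Integrable (fun x => F x * g x) (μ.prod ν) := by
    refine ⟨(hF.mul hgm).aestronglyMeasurable, ?_⟩
    simp only [HasFiniteIntegral, enorm_mul]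
    refine (lintegral_mul_le_mixedEnergy hr.symm hq.symm hF.enorm hgm.enorm).trans_lt ?_
    exact ENNReal.mul_lt_top (ENNReal.rpow_lt_top_of_nonneg (by positivity) hXtop.ne)
      (ENNReal.rpow_lt_top_of_nonneg (by positivity) (hgE.trans_lt hXtop).ne)
  set Φ := mixedEnergy μ ν r' q' (fun x => ‖f x‖ₑ) with hΦ
  have key : X ≤ Φ ^ (1 / r') * (C * X) ^ (1 / r) := by
    calc X ≤ ∫⁻ x, ‖F x‖ₑ * ‖g x‖ₑ ∂μ.prod ν := hFg
      _ = ENNReal.ofReal (∫ x, F x * g x ∂μ.prod ν) := by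
          rw [ofReal_integral_eq_lintegral_ofReal hFgi
            (Eventually.of_forall (mul_dualFunction_nonneg F))]
          refine lintegral_congr fun x => ?_
          rw [← enorm_mul, Real.enorm_of_nonneg (mul_dualFunction_nonneg F x)]
      _ ≤ ∫⁻ w, ‖f w‖ₑ * ‖P (-w)‖ₑ ∂μ.prod ν := by
          rw [hswap]
          refine (Real.ofReal_le_enorm _).trans ?_
          refine (enorm_integral_le_lintegral_enorm _).trans (le_of_eq ?_)
          simp [enorm_mul]
      _ ≤ Φ ^ (1 / r') * mixedEnergy μ ν r q (fun w => ‖P (-w)‖ₑ) ^ (1 / r) :=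
          lintegral_mul_le_mixedEnergy hr.symm hq.symm hf.enorm (hPm.comp measurable_neg).enorm
      _ ≤ Φ ^ (1 / r') * (C * X) ^ (1 / r) := by
          rw [mixedEnergy_comp_neg (fun w => ‖P w‖ₑ)]
          gcongr
          exact hTg.trans (mul_le_mul_right hgnE C)
  rcases eq_or_ne X 0 with h0 | h0
  · rw [h0]; exact zero_le
  have key2 : X ^ (1 / r') ≤ Φ ^ (1 / r') * C ^ (1 / r) := by
    have e1 : X ^ (1 / r) ≠ 0 := by simp [h0, hXtop.ne]
    have e2 : X ^ (1 / r) ≠ ∞ := ENNReal.rpow_ne_top_of_nonneg (by positivity) hXtop.ne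
    rw [← ENNReal.mul_le_mul_iff_left e1 e2, ← ENNReal.rpow_add _ _ h0 hXtop.ne, mul_assoc,
      ← ENNReal.mul_rpow_of_nonneg _ _ (by positivity), one_div, one_div,
      hr.symm.inv_add_inv_eq_one, ENNReal.rpow_one, ← one_div, ← one_div]
    exact key
  calc X = (X ^ (1 / r')) ^ r' := by
        rw [← ENNReal.rpow_mul, one_div_mul_cancel hr0'.ne', ENNReal.rpow_one]
    _ ≤ (Φ ^ (1 / r') * C ^ (1 / r)) ^ r' := ENNReal.rpow_le_rpow key2 hr0'.le
    _ = C ^ (r' / r) * Φ := by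
        rw [ENNReal.mul_rpow_of_nonneg _ _ hr0'.le, ← ENNReal.rpow_mul, ← ENNReal.rpow_mul,
          one_div_mul_cancel hr0'.ne', ENNReal.rpow_one, mul_comm]
        congr 2; ring

end Duality

section Grid

open Filter Topology

variable {S ι : Type*} [MeasurableSpace S] [TopologicalSpace S]

/-- A dyadic grid on a measure space: for every `n : ℤ` a countable partition into measurable
cells of the same measure `size n`, refining as `n` decreases, with parents at most `D` times
larger than their children. -/
structure DyadicGrid (μ : Measure S) (ι : Type*) (D : ℝ≥0∞) where
  /-- The label of the cell of generation `n` containing a point. -/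
  idx : ℤ → S → ι
  /-- The measure of the cells of generation `n`. -/
  size : ℤ → ℝ≥0∞
  measurableSet_cell : ∀ n i, MeasurableSet (idx n ⁻¹' {i})
  idx_succ : ∀ n s s', idx n s = idx n s' → idx (n + 1) s = idx (n + 1) s'
  measure_cell : ∀ n s, μ (idx n ⁻¹' {idx n s}) = size n
  size_ne_zero : ∀ n, size n ≠ 0
  size_ne_top : ∀ n, size n ≠ ∞
  size_succ_le : ∀ n, size (n + 1) ≤ D * size n
  tendsto_size : Tendsto size atTop (𝓝 ∞)
  exists_cell_subset : ∀ s U, IsOpen U → s ∈ U → ∃ n ≤ 0, idx n ⁻¹' {idx n s} ⊆ U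

namespace DyadicGrid

variable {μ : Measure S} {D : ℝ≥0∞} (𝒢 : DyadicGrid μ ι D)

/-- The cell of generation `n` with label `i`. -/
def cell (n : ℤ) (i : ι) : Set S := 𝒢.idx n ⁻¹' {i}

theorem mem_cell {n : ℤ} {i : ι} {s : S} : s ∈ 𝒢.cell n i ↔ 𝒢.idx n s = i := Iff.rfl

theorem idx_eq_of_le {n m : ℤ} (h : n ≤ m) {s t : S} (hs : 𝒢.idx n s = 𝒢.idx n t) :
    𝒢.idx m s = 𝒢.idx m t := by
  induction m, h using Int.leInduction with
  | base => exact hs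
  | succ m _ ih => exact 𝒢.idx_succ m s t ih

/-- A property of cells, seen as a property of their points. -/
def IsCellProperty (P : ℤ → S → Prop) : Prop :=
  ∀ n s t, 𝒢.idx n s = 𝒢.idx n t → P n s → P n t

/-- The cell with the given generation and label if it is maximal among the cells satisfying `P`,
and the empty set otherwise. -/
def maximalCell (P : ℤ → S → Prop) (j : ℤ × ι) : Set S :=
  {s | 𝒢.idx j.1 s = j.2 ∧ P j.1 s ∧ ∀ m, j.1 < m → ¬ P m s}

variable {𝒢} {P : ℤ → S → Prop}

theorem maximalCell_eq (hP : 𝒢.IsCellProperty P) {j : ℤ × ι} (hj : (𝒢.maximalCell P j).Nonempty) :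
    𝒢.maximalCell P j = 𝒢.cell j.1 j.2 := by
  obtain ⟨s, hs⟩ := hj
  refine Subset.antisymm (fun x hx => hx.1) fun x hx => ?_
  have hx' : 𝒢.idx j.1 s = 𝒢.idx j.1 x := hs.1.trans (𝒢.mem_cell.1 hx).symm
  refine ⟨hx, hP _ _ _ hx' hs.2.1, fun m hm hm' => hs.2.2 m hm (hP _ _ _ ?_ hm')⟩
  exact 𝒢.idx_eq_of_le hm.le hx'.symm

theorem measurableSet_maximalCell (hP : 𝒢.IsCellProperty P) (j : ℤ × ι) :
    MeasurableSet (𝒢.maximalCell P j) := by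
  rcases (𝒢.maximalCell P j).eq_empty_or_nonempty with h | h
  · simp [h]
  · rw [maximalCell_eq hP h]; exact 𝒢.measurableSet_cell _ _

theorem measure_maximalCell (hP : 𝒢.IsCellProperty P) {j : ℤ × ι}
    (hj : (𝒢.maximalCell P j).Nonempty) : μ (𝒢.maximalCell P j) = 𝒢.size j.1 := by
  rw [maximalCell_eq hP hj]
  obtain ⟨s, hs⟩ := hj
  rw [← 𝒢.measure_cell j.1 s, hs.1, cell]

theorem eq_of_mem_maximalCell {i j : ℤ × ι} {s : S} (hi : s ∈ 𝒢.maximalCell P i)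
    (hj : s ∈ 𝒢.maximalCell P j) : i = j := by
  have h1 : i.1 = j.1 := by
    rcases lt_trichotomy i.1 j.1 with h | h | h
    · exact absurd hj.2.1 (hi.2.2 _ h)
    · exact h
    · exact absurd hi.2.1 (hj.2.2 _ h)
  refine Prod.ext h1 ?_
  rw [← hi.1, ← hj.1, h1]

theorem pairwise_disjoint_maximalCell : Pairwise (Function.onFun Disjoint (𝒢.maximalCell P)) :=
  fun _ _ hij => Set.disjoint_left.2 fun _ hi hj => hij (eq_of_mem_maximalCell hi hj)

theorem iUnion_maximalCell (hb : ∀ s, ∃ b, ∀ n, P n s → n ≤ b) :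
    ⋃ j, 𝒢.maximalCell P j = {s | ∃ n, P n s} := by
  ext s
  simp only [mem_iUnion, mem_ofPred_eq]
  constructor
  · rintro ⟨j, hj⟩; exact ⟨_, hj.2.1⟩
  · intro h
    obtain ⟨n, hn, hn'⟩ := Int.exists_greatest_of_bdd (hb s) h
    exact ⟨(n, 𝒢.idx n s), rfl, hn, fun m hm hm' => absurd (hn' m hm') (not_le.2 hm)⟩

/-- **Lebesgue's differentiation theorem** for a grid: if `N` has average at most `a` over all
cells meeting a set, then `N ≤ a` almost everywhere on that set. -/
theorem ae_le_of_cell_average_le [Countable ι] [SigmaFinite μ] [μ.OuterRegular] {N : S → ℝ≥0∞}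
    (hN : Measurable N) {r : ℝ} (hr : 0 < r) (hNr : ∫⁻ s, N s ^ r ∂μ < ∞) {a : ℝ≥0∞} (ha : a ≠ ∞)
    {A : Set S} (h : ∀ s ∈ A, ∀ n, ∫⁻ x in 𝒢.cell n (𝒢.idx n s), N x ∂μ ≤ a * 𝒢.size n) :
    ∀ᵐ s ∂μ, s ∈ A → N s ≤ a := by
  have key : ∀ b : ℝ≥0∞, a < b → b ≠ ∞ → μ {s | s ∈ A ∧ b < N s} = 0 := by
    intro b hb hbtop
    set B := {s | s ∈ A ∧ b < N s} with hB
    have hb0 : 0 < b := bot_lt_of_lt hb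
    have hBfin : μ B < ∞ := by
      refine (measure_mono (t := {s | b ^ r ≤ N s ^ r}) fun s hs => ?_).trans_lt ?_
      · exact ENNReal.rpow_le_rpow hs.2.le hr.le
      · exact (meas_ge_le_lintegral_div (hN.pow_const r).aemeasurable (by simp [hb0.ne', hbtop])
          (ENNReal.rpow_ne_top_of_nonneg hr.le hbtop)).trans_lt
          (ENNReal.div_lt_top hNr.ne (by simp [hb0.ne', hbtop]))
    by_contra hne
    obtain ⟨ε, hε, hεb⟩ : ∃ ε : ℝ≥0∞, 0 < ε ∧ a * (μ B + ε) < b * μ B := by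
      have ht : Tendsto (fun ε : ℝ≥0∞ => a * (μ B + ε)) (𝓝[>] 0) (𝓝 (a * (μ B + 0))) :=
        ((ENNReal.continuous_const_mul ha).comp
          (continuous_const.add continuous_id)).continuousAt.mono_left nhdsWithin_le_nhds
      have hlt : a * (μ B + 0) < b * μ B := by
        rw [add_zero]
        exact (ENNReal.mul_lt_mul_iff_left hne hBfin.ne).2 hb
      have h0 : ∀ᶠ ε : ℝ≥0∞ in 𝓝[>] 0, 0 < ε := self_mem_nhdsWithin
      exact (h0.and (ht.eventually_lt_const hlt)).exists
    obtain ⟨U, hBU, hU, hUm⟩ := B.exists_isOpen_lt_add hBfin.ne hε.ne'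
    let P : ℤ → S → Prop := fun n s =>
      n ≤ 0 ∧ 𝒢.cell n (𝒢.idx n s) ⊆ U ∧ (𝒢.cell n (𝒢.idx n s) ∩ B).Nonempty
    have hP : 𝒢.IsCellProperty P := fun n s s' hss' hs => by
      simpa only [P, ← hss'] using hs
    have hBV : B ⊆ ⋃ j, 𝒢.maximalCell P j := by
      rw [iUnion_maximalCell fun s => ⟨0, fun n hn => hn.1⟩]
      intro s hs
      obtain ⟨n, hn0, hn⟩ := 𝒢.exists_cell_subset s U hU (hBU hs)
      exact ⟨n, hn0, hn, s, rfl, hs⟩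
    have hVU : ⋃ j, 𝒢.maximalCell P j ⊆ U := by
      rw [iUnion_maximalCell fun s => ⟨0, fun n hn => hn.1⟩]
      rintro s ⟨n, hn⟩
      exact hn.2.1 rfl
    have hcell : ∀ j, ∫⁻ x in 𝒢.maximalCell P j, N x ∂μ ≤ a * μ (𝒢.maximalCell P j) := by
      intro j
      rcases (𝒢.maximalCell P j).eq_empty_or_nonempty with h0 | h0
      · simp [h0]
      · rw [measure_maximalCell hP h0, maximalCell_eq hP h0]
        obtain ⟨s, hs⟩ := h0
        obtain ⟨x, hx, hxB⟩ := hs.2.1.2.2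
        have := h x hxB.1 j.1
        rwa [𝒢.mem_cell.1 hx, hs.1] at this
    have hm := measurableSet_maximalCell hP
    have h1 : b * μ B ≤ ∫⁻ x in ⋃ j, 𝒢.maximalCell P j, N x ∂μ := by
      calc b * μ B ≤ b * (μ.restrict (⋃ j, 𝒢.maximalCell P j)) {x | b ≤ N x} := by
            refine mul_le_mul_right ?_ b
            rw [Measure.restrict_apply (measurableSet_le measurable_const hN)]
            exact measure_mono fun s hs => ⟨hs.2.le, hBV hs⟩
        _ ≤ _ := mul_meas_ge_le_lintegral hN b
    have h2 : ∫⁻ x in ⋃ j, 𝒢.maximalCell P j, N x ∂μ ≤ a * (μ B + ε) := by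
      rw [lintegral_iUnion hm pairwise_disjoint_maximalCell]
      calc ∑' j, ∫⁻ x in 𝒢.maximalCell P j, N x ∂μ ≤ ∑' j, a * μ (𝒢.maximalCell P j) :=
            ENNReal.tsum_le_tsum hcell
        _ = a * μ (⋃ j, 𝒢.maximalCell P j) := by
            rw [ENNReal.tsum_mul_left, measure_iUnion pairwise_disjoint_maximalCell hm]
        _ ≤ a * (μ B + ε) := by gcongr; exact (measure_mono hVU).trans hUm.le
    exact absurd (h1.trans h2) (not_le.2 hεb)
  have hseq : ∀ n : ℕ, ∀ᵐ s ∂μ, ¬ (s ∈ A ∧ a + ((n : ℝ≥0∞) + 1)⁻¹ < N s) := fun n => by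
    have := key (a + ((n : ℝ≥0∞) + 1)⁻¹) (ENNReal.lt_add_right ha (by simp))
      (ENNReal.add_ne_top.2 ⟨ha, by simp⟩)
    rw [ae_iff]; simpa using this
  filter_upwards [ae_all_iff.2 hseq] with s hs hsA
  have ht : Tendsto (fun n : ℕ => a + ((n : ℝ≥0∞) + 1)⁻¹) atTop (𝓝 (a + 0)) := by
    refine tendsto_const_nhds.add ?_
    exact_mod_cast ENNReal.tendsto_inv_nat_nhds_zero.comp (tendsto_add_atTop_nat 1)
  rw [add_zero] at ht
  exact ge_of_tendsto' ht fun n => not_lt.1 fun h => hs n ⟨hsA, h⟩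

/-- The cells on which the average of `N` exceeds `a`. -/
def HighAverage (𝒢 : DyadicGrid μ ι D) (N : S → ℝ≥0∞) (a : ℝ≥0∞) (n : ℤ) (s : S) : Prop :=
  a * 𝒢.size n < ∫⁻ x in 𝒢.cell n (𝒢.idx n s), N x ∂μ

theorem isCellProperty_highAverage (N : S → ℝ≥0∞) (a : ℝ≥0∞) :
    𝒢.IsCellProperty (𝒢.HighAverage N a) := fun n s s' hss' hs => by
  simpa only [HighAverage, ← hss'] using hs

/-- The union of the cells on which the average of `N` exceeds `a`. -/
def exceptional (𝒢 : DyadicGrid μ ι D) (N : S → ℝ≥0∞) (a : ℝ≥0∞) : Set S :=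
  ⋃ j, 𝒢.maximalCell (𝒢.HighAverage N a) j

variable {N : S → ℝ≥0∞} {a : ℝ≥0∞}

theorem measurableSet_exceptional [Countable ι] : MeasurableSet (𝒢.exceptional N a) :=
  .iUnion fun j => measurableSet_maximalCell (isCellProperty_highAverage N a) j

theorem half_mul_lt_of_high (hN : Measurable N) {Q : Set S}
    (h : a * μ Q < ∫⁻ x in Q, N x ∂μ) :
    a / 2 * μ Q < ∫⁻ x in Q ∩ {x | a / 2 < N x}, N x ∂μ := by
  have hm : MeasurableSet {x | a / 2 < N x} := measurableSet_lt measurable_const hN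
  have h1 : ∫⁻ x in Q, N x ∂μ ≤ ∫⁻ x in Q ∩ {x | a / 2 < N x}, N x ∂μ + a / 2 * μ Q := by
    rw [← lintegral_inter_add_sdiff N Q hm]
    gcongr
    calc ∫⁻ x in Q \ {x | a / 2 < N x}, N x ∂μ ≤ ∫⁻ _ in Q \ {x | a / 2 < N x}, a / 2 ∂μ := by
          refine setLIntegral_mono measurable_const fun x hx => ?_
          exact not_lt.1 hx.2
      _ ≤ a / 2 * μ Q := by
          rw [setLIntegral_const]
          gcongr; exact sdiff_subset
  by_contra hcon
  rw [not_lt] at hcon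
  have h2 := h.trans_le (h1.trans (add_le_add_left hcon _))
  rw [← add_mul, ENNReal.add_halves] at h2
  exact lt_irrefl _ h2

theorem highAverage_bddAbove (hN : Measurable N) (ha : a ≠ 0) (ha' : a ≠ ∞)
    (hfin : ∫⁻ x in {x | a / 2 < N x}, N x ∂μ ≠ ∞) (s : S) :
    ∃ b, ∀ n, 𝒢.HighAverage N a n s → n ≤ b := by
  set A := ∫⁻ x in {x | a / 2 < N x}, N x ∂μ with hA
  have hA' : A / (a / 2) < ∞ := ENNReal.div_lt_top hfin (by simpa using ha)
  obtain ⟨b, hb⟩ := eventually_atTop.1 (𝒢.tendsto_size.eventually_const_lt hA')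
  refine ⟨b, fun n hn => ?_⟩
  by_contra hlt
  have h1 := hb n (not_le.1 hlt).le
  have hc : μ (𝒢.cell n (𝒢.idx n s)) = 𝒢.size n := 𝒢.measure_cell n s
  have h2 := half_mul_lt_of_high hN (by rwa [hc])
  have h3 : ∫⁻ x in 𝒢.cell n (𝒢.idx n s) ∩ {x | a / 2 < N x}, N x ∂μ ≤ A :=
    lintegral_mono_set inter_subset_right
  rw [ENNReal.div_lt_iff (Or.inl (by simpa using ha))
    (Or.inl (ENNReal.div_ne_top ha' (by simp)))] at h1
  rw [hc, mul_comm] at h2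
  exact lt_irrefl _ (h1.trans (h2.trans_le h3))

theorem measure_exceptional_le [Countable ι] (hN : Measurable N) :
    a / 2 * μ (𝒢.exceptional N a) ≤ ∫⁻ x in {x | a / 2 < N x}, N x ∂μ := by
  have hP := isCellProperty_highAverage (𝒢 := 𝒢) N a
  have hm : MeasurableSet {x | a / 2 < N x} := measurableSet_lt measurable_const hN
  rw [exceptional, measure_iUnion pairwise_disjoint_maximalCell (measurableSet_maximalCell hP),
    ← ENNReal.tsum_mul_left]
  have hcell : ∀ j, a / 2 * μ (𝒢.maximalCell (𝒢.HighAverage N a) j) ≤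
      ∫⁻ x in 𝒢.maximalCell (𝒢.HighAverage N a) j ∩ {x | a / 2 < N x}, N x ∂μ := by
    intro j
    rcases (𝒢.maximalCell (𝒢.HighAverage N a) j).eq_empty_or_nonempty with h0 | h0
    · simp [h0]
    · have hμ := measure_maximalCell hP h0
      refine (half_mul_lt_of_high hN ?_).le
      rw [hμ, maximalCell_eq hP h0]
      obtain ⟨s, hs⟩ := h0
      have := hs.2.1
      rwa [HighAverage, hs.1] at this
  refine (ENNReal.tsum_le_tsum hcell).trans ?_
  rw [← lintegral_iUnion (fun j => (measurableSet_maximalCell hP j).inter hm)]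
  · exact lintegral_mono_set (iUnion_subset fun _ => inter_subset_right)
  · exact fun i j hij => (pairwise_disjoint_maximalCell hij).mono inter_subset_left inter_subset_left

theorem lintegral_maximalCell_le (j : ℤ × ι) :
    ∫⁻ x in 𝒢.maximalCell (𝒢.HighAverage N a) j, N x ∂μ ≤
      D * a * μ (𝒢.maximalCell (𝒢.HighAverage N a) j) := by
  have hP := isCellProperty_highAverage (𝒢 := 𝒢) N a
  rcases (𝒢.maximalCell (𝒢.HighAverage N a) j).eq_empty_or_nonempty with h0 | h0
  · simp [h0]
  rw [measure_maximalCell hP h0, maximalCell_eq hP h0]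
  obtain ⟨s, hs⟩ := h0
  have h1 := hs.2.2 (j.1 + 1) (lt_add_one _)
  rw [HighAverage, not_lt] at h1
  calc ∫⁻ x in 𝒢.cell j.1 j.2, N x ∂μ ≤ ∫⁻ x in 𝒢.cell (j.1 + 1) (𝒢.idx (j.1 + 1) s), N x ∂μ := by
        refine lintegral_mono_set fun x hx => 𝒢.mem_cell.2 ?_
        exact 𝒢.idx_succ _ _ _ ((𝒢.mem_cell.1 hx).trans hs.1.symm)
    _ ≤ a * 𝒢.size (j.1 + 1) := h1
    _ ≤ a * (D * 𝒢.size j.1) := by gcongr; exact 𝒢.size_succ_le _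
    _ = _ := by ring

theorem lintegral_exceptional_le [Countable ι] :
    ∫⁻ x in 𝒢.exceptional N a, N x ∂μ ≤ D * a * μ (𝒢.exceptional N a) := by
  have hP := isCellProperty_highAverage (𝒢 := 𝒢) N a
  rw [exceptional, measure_iUnion pairwise_disjoint_maximalCell (measurableSet_maximalCell hP),
    ← ENNReal.tsum_mul_left,
    lintegral_iUnion (measurableSet_maximalCell hP) pairwise_disjoint_maximalCell]
  exact ENNReal.tsum_le_tsum lintegral_maximalCell_le

theorem ae_le_of_notMem_exceptional [Countable ι] [SigmaFinite μ] [μ.OuterRegular]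
    (hN : Measurable N) {r : ℝ} (hr : 0 < r) (hNr : ∫⁻ s, N s ^ r ∂μ < ∞) (ha : a ≠ 0)
    (ha' : a ≠ ∞) (hfin : ∫⁻ x in {x | a / 2 < N x}, N x ∂μ ≠ ∞) :
    ∀ᵐ s ∂μ, s ∉ 𝒢.exceptional N a → N s ≤ a := by
  refine ae_le_of_cell_average_le (𝒢 := 𝒢) hN hr hNr ha' (A := (𝒢.exceptional N a)ᶜ)
    fun s hs n => ?_
  by_contra hcon
  rw [exceptional, iUnion_maximalCell (highAverage_bddAbove hN ha ha' hfin)] at hs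
  exact hs ⟨n, not_le.1 hcon⟩

end DyadicGrid

end Grid

section CellAverages

open Filter Topology

variable {S Y J : Type*} [MeasurableSpace S] [MeasurableSpace Y] [Countable J]
  {μ : Measure S} {ν : Measure Y} [SigmaFinite μ] [SigmaFinite ν] {q : ℝ}

/-- The average over `s ∈ Q j` of `f (s, ·)`. -/
def cellAverage (μ : Measure S) (Q : J → Set S) (f : S × Y → ℝ) (j : J) (y : Y) : ℝ :=
  (μ (Q j)).toReal⁻¹ * ∫ s in Q j, f (s, y) ∂μ

open Classical in
/-- The function obtained from `f` by averaging over each of the sets `Q j`. -/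
def goodPart (μ : Measure S) (Q : J → Set S) (f : S × Y → ℝ) (x : S × Y) : ℝ :=
  if h : ∃ j, x.1 ∈ Q j then cellAverage μ Q f h.choose x.2 else f x

variable {Q : J → Set S} {f : S × Y → ℝ}

theorem goodPart_of_mem (hd : Pairwise (Function.onFun Disjoint Q)) {j : J} {x : S × Y}
    (hx : x.1 ∈ Q j) : goodPart μ Q f x = cellAverage μ Q f j x.2 := by
  have h : ∃ j, x.1 ∈ Q j := ⟨j, hx⟩
  rw [goodPart, dif_pos h]
  congr 1
  by_contra hne
  exact Set.disjoint_left.1 (hd hne) h.choose_spec hx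

theorem goodPart_of_notMem {x : S × Y} (hx : x.1 ∉ ⋃ j, Q j) : goodPart μ Q f x = f x := by
  rw [goodPart, dif_neg (by simpa using hx)]

theorem measurable_cellAverage (hf : Measurable f) (j : J) :
    Measurable (cellAverage μ Q f j) :=
  (hf.stronglyMeasurable.integral_prod_left' (μ := μ.restrict (Q j))).measurable.const_mul _

theorem measurable_goodPart (hQ : ∀ j, MeasurableSet (Q j))
    (hd : Pairwise (Function.onFun Disjoint Q)) (hf : Measurable f) :
    Measurable (goodPart μ Q f) := by
  intro B hB
  have : goodPart μ Q f ⁻¹' B =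
      (⋃ j, (Prod.fst ⁻¹' Q j ∩ (fun x : S × Y => cellAverage μ Q f j x.2) ⁻¹' B)) ∪
        (Prod.fst ⁻¹' (⋃ j, Q j)ᶜ ∩ f ⁻¹' B) := by
    ext x
    by_cases hx : x.1 ∈ ⋃ j, Q j
    · obtain ⟨j, hj⟩ := mem_iUnion.1 hx
      simp only [mem_preimage, goodPart_of_mem hd hj, mem_union, mem_iUnion, mem_inter_iff,
        mem_compl_iff]
      constructor
      · exact fun h => Or.inl ⟨j, hj, h⟩
      · rintro (⟨i, hi, h⟩ | ⟨h, -⟩)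
        · have : i = j := by
            by_contra hne
            exact Set.disjoint_left.1 (hd hne) hi hj
          rwa [← this]
        · exact absurd ⟨j, hj⟩ h
    · have hx' : ∀ j, x.1 ∉ Q j := by simpa using hx
      simp [goodPart_of_notMem hx, hx']
  rw [this]
  refine MeasurableSet.union (.iUnion fun j => ?_) ?_
  · exact (measurable_fst (hQ j)).inter
      (((measurable_cellAverage hf j).comp measurable_snd) hB)
  · exact (measurable_fst (MeasurableSet.iUnion hQ).compl).inter (hf hB)

theorem integrableOn_slice {M : ℝ} (hf : Measurable f) (hM : ∀ x, ‖f x‖ ≤ M) {A : Set S}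
    (hA : μ A ≠ ∞) (y : Y) : IntegrableOn (fun s => f (s, y)) A μ :=
  Measure.integrableOn_of_bounded hA
    (hf.comp measurable_prodMk_right).aestronglyMeasurable (M := M)
    (Eventually.of_forall fun _ => hM _)

theorem setIntegral_sub_goodPart (hQ : ∀ j, MeasurableSet (Q j))
    (hd : Pairwise (Function.onFun Disjoint Q)) (hfin : ∀ j, μ (Q j) ≠ ∞) {M : ℝ}
    (hf : Measurable f) (hM : ∀ x, ‖f x‖ ≤ M) (j : J) (y : Y) :
    ∫ s in Q j, (f (s, y) - goodPart μ Q f (s, y)) ∂μ = 0 := by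
  have h1 : ∫ s in Q j, (f (s, y) - goodPart μ Q f (s, y)) ∂μ =
      ∫ s in Q j, (f (s, y) - cellAverage μ Q f j y) ∂μ :=
    setIntegral_congr_fun (hQ j) fun s hs => by
      simp only [goodPart_of_mem (μ := μ) (f := f) hd (x := (s, y)) hs]
  rw [h1, integral_sub (integrableOn_slice hf hM (hfin j) y) (integrableOn_const (hfin j)),
    setIntegral_const, cellAverage, smul_eq_mul, measureReal_def]
  rcases eq_or_ne (μ (Q j)) 0 with h0 | h0
  · simp [h0, setIntegral_measure_zero]
  · rw [mul_inv_cancel_left₀ (ENNReal.toReal_ne_zero.2 ⟨h0, hfin j⟩), sub_self]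

theorem sliceNorm_cellAverage_le (hq : 1 < q) (hfin : ∀ j, μ (Q j) ≠ ∞)
    (hf : Measurable f) {j : J} (h0 : μ (Q j) ≠ 0) :
    (∫⁻ y, ‖cellAverage μ Q f j y‖ₑ ^ q ∂ν) ^ (1 / q) ≤
      (μ (Q j))⁻¹ * ∫⁻ s in Q j, sliceNorm ν q (fun x => ‖f x‖ₑ) s ∂μ := by
  have hq0 : 0 < q := by linarith
  have hpt : ∀ y, ‖cellAverage μ Q f j y‖ₑ ≤ (μ (Q j))⁻¹ * ∫⁻ s in Q j, ‖f (s, y)‖ₑ ∂μ := by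
    intro y
    rw [cellAverage, enorm_mul]
    refine mul_le_mul' (le_of_eq ?_) (enorm_integral_le_lintegral_enorm _)
    rw [enorm_inv (ENNReal.toReal_ne_zero.2 ⟨h0, hfin j⟩), Real.enorm_of_nonneg (by positivity),
      ENNReal.ofReal_toReal (hfin j)]
  have hm : Measurable (Function.uncurry fun s y => ‖f (s, y)‖ₑ) := hf.enorm
  calc (∫⁻ y, ‖cellAverage μ Q f j y‖ₑ ^ q ∂ν) ^ (1 / q)
      ≤ (∫⁻ y, ((μ (Q j))⁻¹ * ∫⁻ s in Q j, ‖f (s, y)‖ₑ ∂μ) ^ q ∂ν) ^ (1 / q) := by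
        gcongr with y; exact hpt y
    _ = (μ (Q j))⁻¹ * (∫⁻ y, (∫⁻ s in Q j, ‖f (s, y)‖ₑ ∂μ) ^ q ∂ν) ^ (1 / q) := by
        simp only [ENNReal.mul_rpow_of_nonneg _ _ hq0.le]
        have hm' : Measurable fun y => (∫⁻ s in Q j, ‖f (s, y)‖ₑ ∂μ) ^ q :=
          (hm.lintegral_prod_left').pow_const q
        rw [lintegral_const_mul _ hm', ENNReal.mul_rpow_of_nonneg _ _ (by positivity),
          ← ENNReal.rpow_mul, mul_one_div_cancel hq0.ne', ENNReal.rpow_one]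
    _ ≤ _ := by
        gcongr
        exact lintegral_rpow_lintegral_le (μ := μ.restrict (Q j)) hq hm

end CellAverages

section BadPart

open Filter Topology

variable {S Y J : Type*} [MeasurableSpace S] [MeasurableSpace Y] [Countable J]
  [AddCommGroup Y] [MeasurableAdd₂ Y] [MeasurableNeg Y]
  {μ : Measure S} {ν : Measure Y} [SigmaFinite μ] [SigmaFinite ν]
  [ν.IsAddLeftInvariant] [ν.IsNegInvariant] {q : ℝ}

theorem setLIntegral_rpow_lintegral_conv_le (hq : 1 < q) {L : S → S → Y → ℝ≥0∞}
    {F : S × Y → ℝ≥0∞} (hL : Measurable fun p : S × S × Y => L p.1 p.2.1 p.2.2)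
    (hF : Measurable F) {W : Set S} {K : ℝ≥0∞}
    (hK : ∀ s, sliceNorm ν q F s ≠ 0 → ∫⁻ t in W, ∫⁻ y, L t s y ∂ν ∂μ ≤ K) :
    ∫⁻ t in W, (∫⁻ y, (∫⁻ s, ∫⁻ z, L t s (y - z) * F (s, z) ∂ν ∂μ) ^ q ∂ν) ^ (1 / q) ∂μ ≤
      K * ∫⁻ s, sliceNorm ν q F s ∂μ := by
  have hm : Measurable fun p : S × S => ∫⁻ y, L p.1 p.2 y ∂ν := by
    have : Measurable fun p : (S × S) × Y => L p.1.1 p.1.2 p.2 :=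
      hL.comp (((measurable_fst.comp measurable_fst)).prodMk
        ((measurable_snd.comp measurable_fst).prodMk measurable_snd))
    exact this.lintegral_prod_right'
  calc ∫⁻ t in W, (∫⁻ y, (∫⁻ s, ∫⁻ z, L t s (y - z) * F (s, z) ∂ν ∂μ) ^ q ∂ν) ^ (1 / q) ∂μ
      ≤ ∫⁻ t in W, ∫⁻ s, (∫⁻ y, L t s y ∂ν) * sliceNorm ν q F s ∂μ ∂μ :=
        lintegral_mono fun t => lintegral_rpow_lintegral_conv_le hq (L := L t)
          (hL.comp (measurable_const.prodMk measurable_id)) hF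
    _ = ∫⁻ s, ∫⁻ t in W, (∫⁻ y, L t s y ∂ν) * sliceNorm ν q F s ∂μ ∂μ := by
        refine lintegral_lintegral_swap ?_
        exact (hm.mul ((measurable_sliceNorm hF).comp measurable_snd)).aemeasurable
    _ ≤ ∫⁻ s, K * sliceNorm ν q F s ∂μ := by
        refine lintegral_mono fun s => ?_
        simp only
        have hms : Measurable fun t => ∫⁻ y, L t s y ∂ν := hm.comp measurable_prodMk_right
        rw [lintegral_mul_const _ hms]
        rcases eq_or_ne (sliceNorm ν q F s) 0 with h0 | h0
        · simp [h0]
        · gcongr; exact hK s h0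
    _ = _ := lintegral_const_mul _ (measurable_sliceNorm hF)

theorem measurable_lintegral_conv {L : S → S → Y → ℝ≥0∞}
    {F : S × Y → ℝ≥0∞} (hL : Measurable fun p : S × S × Y => L p.1 p.2.1 p.2.2)
    (hF : Measurable F) : Measurable fun x : S × Y =>
      ∫⁻ s, ∫⁻ z, L x.1 s (x.2 - z) * F (s, z) ∂ν ∂μ := by
  have h1 : Measurable fun p : ((S × Y) × S) × Y =>
      L p.1.1.1 p.1.2 (p.1.1.2 - p.2) * F (p.1.2, p.2) :=
    (hL.comp ((measurable_fst.comp (measurable_fst.comp measurable_fst)).prodMk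
      ((measurable_snd.comp measurable_fst).prodMk
        ((measurable_snd.comp (measurable_fst.comp measurable_fst)).sub measurable_snd)))).mul
    (hF.comp ((measurable_snd.comp measurable_fst).prodMk measurable_snd))
  exact h1.lintegral_prod_right'.lintegral_prod_right'

theorem ae_ae_lt_top_of_lintegral {S Y : Type*} [MeasurableSpace S] [MeasurableSpace Y]
    {μ : Measure S} {ν : Measure Y} [SFinite ν] {q : ℝ} (hq : 0 < q) {G : S × Y → ℝ≥0∞}
    (hG : Measurable G) {W : Set S}
    (h : ∫⁻ t in W, (∫⁻ y, G (t, y) ^ q ∂ν) ^ (1 / q) ∂μ ≠ ∞) :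
    ∀ᵐ t ∂μ.restrict W, ∀ᵐ y ∂ν, G (t, y) < ∞ := by
  filter_upwards [ae_lt_top (measurable_sliceNorm (ν := ν) (q := q) hG) h] with t ht
  have h1 : ∫⁻ y, G (t, y) ^ q ∂ν ≠ ∞ := by
    intro h0
    simp [sliceNorm, h0, hq] at ht
  filter_upwards [ae_lt_top ((hG.comp measurable_prodMk_left).pow_const q) h1] with y hy
  refine lt_top_iff_ne_top.2 fun h0 => ?_
  simp [h0, hq] at hy

variable [AddCommGroup S] [MeasurableAdd₂ S] [MeasurableNeg S] [μ.IsAddLeftInvariant]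
  [μ.IsNegInvariant]

/-- The estimate for the part of a Calderón–Zygmund decomposition with mean zero on each cell. -/
theorem lintegral_sliceNorm_badPart_le (hq : 1 < q) {k b : S × Y → ℝ} (hk : Measurable k)
    (hki : Integrable k (μ.prod ν)) (hb : Measurable b) {Q : J → Set S}
    (hQ : ∀ j, MeasurableSet (Q j)) (hd : Pairwise (Function.onFun Disjoint Q))
    (hb0 : ∀ x : S × Y, x.1 ∉ ⋃ j, Q j → b x = 0)
    (hmean : ∀ j y, ∫ s in Q j, b (s, y) ∂μ = 0)
    (hbN : ∫⁻ s, sliceNorm ν q (fun x => ‖b x‖ₑ) s ∂μ ≠ ∞) {W : Set S}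
    {c : J → S} {C : ℝ≥0∞} (hC : C ≠ ∞)
    (hH : ∀ j, ∀ s ∈ Q j, ∫⁻ t in W, ∫⁻ y, ‖k (t - s, y) - k (t - c j, y)‖ₑ ∂ν ∂μ ≤ C) :
    ∫⁻ t in W, sliceNorm ν q (fun x => ‖kernelConv (μ.prod ν) k b x‖ₑ) t ∂μ ≤
      C * ∫⁻ s, sliceNorm ν q (fun x => ‖b x‖ₑ) s ∂μ := by
  have hq0 : 0 < q := by linarith
  obtain ⟨cc, hccm, hcc⟩ : ∃ cc : S → S, Measurable cc ∧ ∀ j, ∀ s ∈ Q j, cc s = c j := by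
    rcases isEmpty_or_nonempty J with hJ | hJ
    · exact ⟨id, measurable_id, fun j => hJ.elim j⟩
    · obtain ⟨g, hg, hg'⟩ := exists_measurable_piecewise Q hQ (fun j _ => c j)
        (fun _ => measurable_const) fun i j hij x hx =>
          absurd hx.2 (Set.disjoint_left.1 (hd hij) hx.1)
      exact ⟨g, hg, fun j s hs => hg' j hs⟩
  have hNb : ∀ s, sliceNorm ν q (fun x => ‖b x‖ₑ) s ≠ 0 → ∃ j, s ∈ Q j := by
    intro s hs
    by_contra hcon
    refine hs ?_
    have : ∀ y, b (s, y) = 0 := fun y => hb0 (s, y) (by simpa using hcon)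
    simp [sliceNorm, this, hq0]
  let Ld : S → S → Y → ℝ≥0∞ := fun t s y => ‖k (t - s, y) - k (t - cc s, y)‖ₑ
  let Lc : S → S → Y → ℝ≥0∞ := fun t s y => ‖k (t - cc s, y)‖ₑ
  have m1 : Measurable fun p : S × S × Y => k (p.1 - p.2.1, p.2.2) :=
    hk.comp ((measurable_fst.sub (measurable_fst.comp measurable_snd)).prodMk
      (measurable_snd.comp measurable_snd))
  have m2 : Measurable fun p : S × S × Y => k (p.1 - cc p.2.1, p.2.2) :=
    hk.comp ((measurable_fst.sub (hccm.comp (measurable_fst.comp measurable_snd))).prodMk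
      (measurable_snd.comp measurable_snd))
  have mLd : Measurable fun p : S × S × Y => Ld p.1 p.2.1 p.2.2 := (m1.sub m2).enorm
  have mLc : Measurable fun p : S × S × Y => Lc p.1 p.2.1 p.2.2 := m2.enorm
  have bd := setLIntegral_rpow_lintegral_conv_le (μ := μ) (ν := ν) (W := W) hq mLd hb.enorm
    (K := C) fun s hs => by
      obtain ⟨j, hj⟩ := hNb s hs
      simp only [Ld, hcc j s hj]
      exact hH j s hj
  have bc := setLIntegral_rpow_lintegral_conv_le (μ := μ) (ν := ν) (W := W) hq mLc hb.enorm
    (K := C + ∫⁻ x, ‖k x‖ₑ ∂μ.prod ν) fun s hs => by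
      obtain ⟨j, hj⟩ := hNb s hs
      have m3 : ∀ t, Measurable fun y => k (t - s, y) - k (t - c j, y) := fun t =>
        (hk.comp measurable_prodMk_left).sub (hk.comp measurable_prodMk_left)
      have m4 : Measurable fun t => ∫⁻ y, ‖k (t - s, y) - k (t - c j, y)‖ₑ ∂ν :=
        (((hk.comp (((measurable_fst.sub measurable_const)).prodMk measurable_snd)).sub
          (hk.comp (((measurable_fst.sub measurable_const)).prodMk
            measurable_snd))).enorm).lintegral_prod_right'
      calc ∫⁻ t in W, ∫⁻ y, Lc t s y ∂ν ∂μ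
          ≤ ∫⁻ t in W, (∫⁻ y, ‖k (t - s, y) - k (t - c j, y)‖ₑ ∂ν
              + ∫⁻ y, ‖k (t - s, y)‖ₑ ∂ν) ∂μ := by
            refine lintegral_mono fun t => ?_
            rw [← lintegral_add_left (m3 t).enorm]
            refine lintegral_mono fun y => ?_
            simp only [Lc, hcc j s hj]
            rw [enorm_sub_rev]
            refine le_trans (le_of_eq ?_) (enorm_add_le _ _)
            rw [sub_add_cancel]
        _ = ∫⁻ t in W, ∫⁻ y, ‖k (t - s, y) - k (t - c j, y)‖ₑ ∂ν ∂μ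
              + ∫⁻ t in W, ∫⁻ y, ‖k (t - s, y)‖ₑ ∂ν ∂μ := lintegral_add_left m4 _
        _ ≤ C + ∫⁻ x, ‖k x‖ₑ ∂μ.prod ν := by
            refine add_le_add (hH j s hj) ?_
            rw [lintegral_prod _ hk.enorm.aemeasurable]
            refine (setLIntegral_le_lintegral _ _).trans (le_of_eq ?_)
            exact lintegral_sub_right_eq_self (fun t => ∫⁻ y, ‖k (t, y)‖ₑ ∂ν) s
  have fd : ∀ᵐ t ∂μ.restrict W, ∀ᵐ y ∂ν,
      ∫⁻ s, ∫⁻ z, Ld t s (y - z) * ‖b (s, z)‖ₑ ∂ν ∂μ < ∞ :=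
    ae_ae_lt_top_of_lintegral hq0 (measurable_lintegral_conv mLd hb.enorm)
      (bd.trans_lt (ENNReal.mul_lt_top hC.lt_top hbN.lt_top)).ne
  have fc : ∀ᵐ t ∂μ.restrict W, ∀ᵐ y ∂ν,
      ∫⁻ s, ∫⁻ z, Lc t s (y - z) * ‖b (s, z)‖ₑ ∂ν ∂μ < ∞ :=
    ae_ae_lt_top_of_lintegral hq0 (measurable_lintegral_conv mLc hb.enorm)
      (bc.trans_lt (ENNReal.mul_lt_top (ENNReal.add_lt_top.2 ⟨hC.lt_top,
        hki.hasFiniteIntegral⟩) hbN.lt_top)).ne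
  refine le_trans (lintegral_mono_ae ?_) bd
  filter_upwards [fd, fc] with t htd htc
  refine ENNReal.rpow_le_rpow (lintegral_mono_ae ?_) (by positivity)
  filter_upwards [htd, htc] with y hyd hyc
  refine ENNReal.rpow_le_rpow ?_ hq0.le
  have id : Integrable (fun w : S × Y => (k (t - w.1, y - w.2) - k (t - cc w.1, y - w.2)) * b w)
      (μ.prod ν) := by
    have hm : Measurable fun w : S × Y =>
        (k (t - w.1, y - w.2) - k (t - cc w.1, y - w.2)) * b w :=
      ((m1.sub m2).comp (measurable_const.prodMk (measurable_fst.prodMk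
        (measurable_const.sub measurable_snd)))).mul hb
    refine ⟨hm.aestronglyMeasurable, ?_⟩
    rw [HasFiniteIntegral, lintegral_prod _ hm.enorm.aemeasurable]
    simpa only [enorm_mul] using hyd
  have ic : Integrable (fun w : S × Y => k (t - cc w.1, y - w.2) * b w) (μ.prod ν) := by
    have hm : Measurable fun w : S × Y => k (t - cc w.1, y - w.2) * b w :=
      (m2.comp (measurable_const.prodMk (measurable_fst.prodMk
        (measurable_const.sub measurable_snd)))).mul hb
    refine ⟨hm.aestronglyMeasurable, ?_⟩
    rw [HasFiniteIntegral, lintegral_prod _ hm.enorm.aemeasurable]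
    simpa only [enorm_mul] using hyc
  have hc0 : ∫ w, k (t - cc w.1, y - w.2) * b w ∂μ.prod ν = 0 := by
    rw [integral_prod_symm _ ic]
    refine integral_eq_zero_of_ae ?_
    filter_upwards [ic.prod_left_ae] with z hz
    rw [← setIntegral_eq_integral_of_forall_compl_eq_zero (s := ⋃ j, Q j)
      (fun s hs => by simp [hb0 (s, z) hs]),
      integral_iUnion hQ hd hz.integrableOn]
    have : ∀ j, ∫ s in Q j, k (t - cc s, y - z) * b (s, z) ∂μ = 0 := fun j => by
      rw [setIntegral_congr_fun (g := fun s => k (t - c j, y - z) * b (s, z)) (hQ j)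
        (fun s hs => by simp only [hcc j s hs]), integral_const_mul, hmean, mul_zero]
    simp [this]
  have hsum : kernelConv (μ.prod ν) k b (t, y) =
      ∫ w, (k (t - w.1, y - w.2) - k (t - cc w.1, y - w.2)) * b w ∂μ.prod ν := by
    rw [← add_zero (∫ w, _ ∂μ.prod ν), ← hc0, ← integral_add id ic]
    refine integral_congr_ae (Eventually.of_forall fun w => ?_)
    beta_reduce
    rw [sub_mul, sub_add_cancel]
    rfl
  rw [hsum]
  refine (enorm_integral_le_lintegral_enorm _).trans (le_of_eq ?_)
  rw [lintegral_prod _ id.1.enorm]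
  simp [Ld, enorm_mul]

end BadPart

section CalderonZygmund

open Filter Topology

variable {S Y ι : Type*} [MeasurableSpace S] [TopologicalSpace S] [MeasurableSpace Y] [Countable ι]
  [AddCommGroup Y] [MeasurableAdd₂ Y] [MeasurableNeg Y]
  {μ : Measure S} {ν : Measure Y} [SigmaFinite μ] [SigmaFinite ν] [μ.OuterRegular]
  [ν.IsAddLeftInvariant] [ν.IsNegInvariant] {r q : ℝ}
  [AddCommGroup S] [MeasurableAdd₂ S] [MeasurableNeg S] [μ.IsAddLeftInvariant]
  [μ.IsNegInvariant] {D : ℝ≥0∞}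

/-- **Hörmander's condition** for a kernel `k` on `S × Y`, relative to a grid on `S`. -/
def HormanderCondition (𝒢 : DyadicGrid μ ι D) (ν : Measure Y) (k : S × Y → ℝ)
    (C₂ C₃ : ℝ≥0∞) : Prop :=
  ∀ n i, ∃ (c : S) (E : Set S), MeasurableSet E ∧ μ E ≤ C₂ * 𝒢.size n ∧
    ∀ s ∈ 𝒢.cell n i, ∫⁻ t in Eᶜ, ∫⁻ y, ‖k (t - s, y) - k (t - c, y)‖ₑ ∂ν ∂μ ≤ C₃

theorem lintegral_gt_ne_top {N : S → ℝ≥0∞} (hN : Measurable N) (hr : 1 < r)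
    (hNr : ∫⁻ s, N s ^ r ∂μ < ∞) {a : ℝ≥0∞} (ha : a ≠ 0) :
    ∫⁻ s in {s | a < N s}, N s ∂μ ≠ ∞ := by
  rcases eq_or_ne a ∞ with rfl | ha'
  · simp
  have hpt : ∀ s ∈ {s | a < N s}, N s ≤ a ^ (1 - r) * N s ^ r := by
    intro s hs
    rcases eq_or_ne (N s) ∞ with h | h
    · rw [h, ENNReal.top_rpow_of_pos (by linarith), ENNReal.mul_top]
      simp [ha, ha']
    have hs0 : N s ≠ 0 := (bot_lt_of_lt hs).ne'
    calc N s = N s ^ (1 - r) * N s ^ r := by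
          rw [← ENNReal.rpow_add _ _ hs0 h]; simp
      _ ≤ _ := by
          gcongr ?_ * _
          have : 1 - r = -(r - 1) := by ring
          rw [this, ENNReal.rpow_neg, ENNReal.rpow_neg, ENNReal.inv_le_inv]
          exact ENNReal.rpow_le_rpow (le_of_lt hs) (by linarith)
  have h1 : ∫⁻ s in {s | a < N s}, N s ∂μ ≤ a ^ (1 - r) * ∫⁻ s, N s ^ r ∂μ := by
    rw [← lintegral_const_mul _ (hN.pow_const r)]
    exact (setLIntegral_mono ((hN.pow_const r).const_mul _) hpt).trans
      (setLIntegral_le_lintegral _ _)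
  refine (h1.trans_lt (ENNReal.mul_lt_top ?_ hNr)).ne
  exact lt_top_iff_ne_top.2 (by simp [ha, ha'])

theorem lintegral_le_rpow_ne_top {N : S → ℝ≥0∞} (hN : Measurable N) (hr : 0 < r) (hrq : r < q)
    (hNr : ∫⁻ s, N s ^ r ∂μ < ∞) {a : ℝ≥0∞} (ha' : a ≠ ∞) :
    ∫⁻ s in {s | N s ≤ a}, N s ^ q ∂μ ≠ ∞ := by
  have hpt : ∀ s ∈ {s | N s ≤ a}, N s ^ q ≤ a ^ (q - r) * N s ^ r := by
    intro s hs
    calc N s ^ q = N s ^ (q - r) * N s ^ r := by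
          rw [← ENNReal.rpow_add_of_nonneg _ _ (by linarith) hr.le]; simp
      _ ≤ _ := by
          gcongr ?_ * _
          exact ENNReal.rpow_le_rpow hs (by linarith)
  have h1 : ∫⁻ s in {s | N s ≤ a}, N s ^ q ∂μ ≤ a ^ (q - r) * ∫⁻ s, N s ^ r ∂μ := by
    rw [← lintegral_const_mul _ (hN.pow_const r)]
    exact (setLIntegral_mono ((hN.pow_const r).const_mul _) hpt).trans
      (setLIntegral_le_lintegral _ _)
  exact (h1.trans_lt (ENNReal.mul_lt_top
    (ENNReal.rpow_lt_top_of_nonneg (by linarith) ha') hNr)).ne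

variable {k f : S × Y → ℝ} {C₁ C₂ C₃ : ℝ≥0∞}

/-- The distributional estimate resulting from the Calderón–Zygmund decomposition at height `a`. -/
theorem measure_sliceNorm_kernelConv_gt_le (𝒢 : DyadicGrid μ ι D) (hD : D ≠ ∞) (hr : 1 < r)
    (hrq : r < q) (hk : Measurable k) (hki : Integrable k (μ.prod ν))
    (hB : MixedBound μ ν k q q C₁) (hC₃ : C₃ ≠ ∞) (hH : HormanderCondition 𝒢 ν k C₂ C₃)
    (hf : Measurable f) {M : ℝ} (hM : ∀ x, ‖f x‖ ≤ M)
    (hfr : mixedEnergy μ ν r q (fun x => ‖f x‖ₑ) < ∞) {a : ℝ≥0∞} (ha : a ≠ 0) (ha' : a ≠ ∞) :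
    μ {t | 2 * a < sliceNorm ν q (fun x => ‖kernelConv (μ.prod ν) k f x‖ₑ) t} ≤
      C₁ * a ^ (-q) * ∫⁻ s in {s | sliceNorm ν q (fun x => ‖f x‖ₑ) s ≤ a},
          sliceNorm ν q (fun x => ‖f x‖ₑ) s ^ q ∂μ +
        (C₁ * D ^ q + C₂ + C₃ * (2 * D)) *
          μ (𝒢.exceptional (sliceNorm ν q (fun x => ‖f x‖ₑ)) a) := by
  have hq : 1 < q := hr.trans hrq
  have hq0 : 0 < q := by linarith
  have hr0 : 0 < r := by linarith
  set N := sliceNorm ν q (fun x => ‖f x‖ₑ) with hNdef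
  have hN : Measurable N := measurable_sliceNorm hf.enorm
  set Ω := 𝒢.exceptional N a with hΩ
  set P := 𝒢.HighAverage N a
  set Q := 𝒢.maximalCell P with hQdef
  have hP : 𝒢.IsCellProperty P := DyadicGrid.isCellProperty_highAverage N a
  have hΩQ : Ω = ⋃ j, Q j := rfl
  have hQm : ∀ j, MeasurableSet (Q j) := DyadicGrid.measurableSet_maximalCell hP
  have hQd : Pairwise (Function.onFun Disjoint Q) := DyadicGrid.pairwise_disjoint_maximalCell
  have hΩm : MeasurableSet Ω := DyadicGrid.measurableSet_exceptional
  have ha2 : a / 2 ≠ 0 := by simpa using ha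
  have hfin := lintegral_gt_ne_top hN hr hfr ha2
  have hΩfin : μ Ω ≠ ∞ := fun h => by
    have := DyadicGrid.measure_exceptional_le (𝒢 := 𝒢) (a := a) hN
    rw [← hΩ, h, ENNReal.mul_top ha2, top_le_iff] at this
    exact hfin this
  have hQfin : ∀ j, μ (Q j) ≠ ∞ := fun j => measure_ne_top_of_subset (subset_iUnion Q j) hΩfin
  have hoff : ∀ᵐ s ∂μ, s ∉ Ω → N s ≤ a :=
    DyadicGrid.ae_le_of_notMem_exceptional hN hr0 hfr ha ha' hfin
  set g := goodPart μ Q f with hg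
  have hgm : Measurable g := measurable_goodPart hQm hQd hf
  set Ng := sliceNorm ν q (fun x => ‖g x‖ₑ) with hNg
  have hNgm : Measurable Ng := measurable_sliceNorm hgm.enorm
  have hg_on : ∀ s ∈ Ω, Ng s ≤ D * a := by
    intro s hs
    obtain ⟨j, hj⟩ := mem_iUnion.1 hs
    have h0 : μ (Q j) ≠ 0 := by
      rw [DyadicGrid.measure_maximalCell hP ⟨s, hj⟩]; exact 𝒢.size_ne_zero _
    have e : Ng s = (∫⁻ y, ‖cellAverage μ Q f j y‖ₑ ^ q ∂ν) ^ (1 / q) := by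
      simp only [hNg, sliceNorm, hg, goodPart_of_mem (μ := μ) (f := f) hQd (x := (s, _)) hj]
    rw [e]
    calc _ ≤ (μ (Q j))⁻¹ * ∫⁻ s in Q j, N s ∂μ := sliceNorm_cellAverage_le hq hQfin hf h0
      _ ≤ (μ (Q j))⁻¹ * (D * a * μ (Q j)) := by
          gcongr; exact DyadicGrid.lintegral_maximalCell_le j
      _ = D * a := by
          rw [mul_comm, mul_assoc, ENNReal.mul_inv_cancel h0 (hQfin j), mul_one]
  have hg_off : ∀ s ∉ Ω, Ng s = N s := by
    intro s hs
    have e : ∀ y, g (s, y) = f (s, y) := fun y => goodPart_of_notMem hs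
    simp only [hNg, hNdef, sliceNorm, e]
  set X := ∫⁻ s in {s | N s ≤ a}, N s ^ q ∂μ with hX
  have hXfin : X ≠ ∞ := lintegral_le_rpow_ne_top hN hr0 hrq hfr ha'
  have hgE : mixedEnergy μ ν q q (fun x => ‖g x‖ₑ) ≤ X + (D * a) ^ q * μ Ω := by
    change ∫⁻ s, Ng s ^ q ∂μ ≤ _
    rw [← lintegral_add_compl _ hΩm, add_comm]
    gcongr
    · calc ∫⁻ s in Ωᶜ, Ng s ^ q ∂μ = ∫⁻ s in Ωᶜ, N s ^ q ∂μ :=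
            setLIntegral_congr_fun hΩm.compl fun s hs => by simp only [hg_off s hs]
        _ ≤ X := by
            refine lintegral_mono' (Measure.restrict_mono_ae ?_) le_rfl
            filter_upwards [hoff] with s hs h using hs h
    · calc ∫⁻ s in Ω, Ng s ^ q ∂μ ≤ ∫⁻ _ in Ω, (D * a) ^ q ∂μ :=
            setLIntegral_mono measurable_const fun s hs => ENNReal.rpow_le_rpow (hg_on s hs) hq0.le
        _ = _ := setLIntegral_const _ _
  have hDa : (D * a) ^ q ≠ ∞ := ENNReal.rpow_ne_top_of_nonneg hq0.le (ENNReal.mul_ne_top hD ha')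
  have hgfin : mixedEnergy μ ν q q (fun x => ‖g x‖ₑ) < ∞ :=
    hgE.trans_lt (ENNReal.add_lt_top.2 ⟨hXfin.lt_top,
      ENNReal.mul_lt_top hDa.lt_top hΩfin.lt_top⟩)
  set NTg := sliceNorm ν q (fun x => ‖kernelConv (μ.prod ν) k g x‖ₑ) with hNTg
  have hNTgm : Measurable NTg := measurable_sliceNorm (measurable_kernelConv hk hgm).enorm
  have hgood : μ {t | a ≤ NTg t} ≤ C₁ * a ^ (-q) * X + C₁ * D ^ q * μ Ω := by
    have h1 := hB g hgm hgfin
    have h2 : a ^ q * μ {t | a ≤ NTg t} ≤ C₁ * (X + (D * a) ^ q * μ Ω) := by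
      calc a ^ q * μ {t | a ≤ NTg t} ≤ a ^ q * μ {t | a ^ q ≤ NTg t ^ q} := by
            refine mul_le_mul_right (measure_mono fun t ht => ?_) _
            exact ENNReal.rpow_le_rpow ht hq0.le
        _ ≤ ∫⁻ t, NTg t ^ q ∂μ := mul_meas_ge_le_lintegral (hNTgm.pow_const q) _
        _ ≤ _ := h1.trans (mul_le_mul_right hgE C₁)
    have haq : a ^ q ≠ 0 := by simp [ha, ha']
    have haq' : a ^ q ≠ ∞ := ENNReal.rpow_ne_top_of_nonneg hq0.le ha'
    calc μ {t | a ≤ NTg t} = a ^ (-q) * (a ^ q * μ {t | a ≤ NTg t}) := by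
          rw [← mul_assoc, ENNReal.rpow_neg, ENNReal.inv_mul_cancel haq haq', one_mul]
      _ ≤ a ^ (-q) * (C₁ * (X + (D * a) ^ q * μ Ω)) := by gcongr
      _ = C₁ * a ^ (-q) * X + C₁ * D ^ q * μ Ω * (a ^ (-q) * a ^ q) := by
          rw [ENNReal.mul_rpow_of_nonneg _ _ hq0.le]; ring
      _ = _ := by rw [ENNReal.rpow_neg, ENNReal.inv_mul_cancel haq haq', mul_one]
  choose c E hEm hEs hEH using hH
  set b : S × Y → ℝ := fun x => f x - g x with hb
  have hbm : Measurable b := hf.sub hgm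
  have hb0 : ∀ x : S × Y, x.1 ∉ ⋃ j, Q j → b x = 0 := fun x hx => by
    simp only [hb, hg, goodPart_of_notMem hx, sub_self]
  set Nb := sliceNorm ν q (fun x => ‖b x‖ₑ) with hNb
  have hNbm : Measurable Nb := measurable_sliceNorm hbm.enorm
  have hbN : ∫⁻ s, Nb s ∂μ ≤ 2 * D * a * μ Ω := by
    have hle : ∀ s, Nb s ≤ N s + Ng s := fun s =>
      (sliceNorm_mono hq0 fun y => enorm_sub_le).trans
        (sliceNorm_add_le hq.le hf.enorm hgm.enorm s)
    have hzero : ∀ s ∉ Ω, Nb s = 0 := fun s hs => by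
      have : ∀ y, b (s, y) = 0 := fun y => hb0 (s, y) hs
      simp [hNb, sliceNorm, this, hq0]
    calc ∫⁻ s, Nb s ∂μ = ∫⁻ s in Ω, Nb s ∂μ := by
          rw [← lintegral_add_compl _ hΩm,
            setLIntegral_congr_fun (g := fun _ => 0) hΩm.compl hzero]
          simp
      _ ≤ ∫⁻ s in Ω, (N s + Ng s) ∂μ := lintegral_mono fun s => hle s
      _ = ∫⁻ s in Ω, N s ∂μ + ∫⁻ s in Ω, Ng s ∂μ := lintegral_add_left hN _
      _ ≤ D * a * μ Ω + D * a * μ Ω := by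
          refine add_le_add DyadicGrid.lintegral_exceptional_le ?_
          rw [← setLIntegral_const]
          exact setLIntegral_mono measurable_const hg_on
      _ = _ := by ring
  have hbNfin : ∫⁻ s, Nb s ∂μ ≠ ∞ := (hbN.trans_lt (ENNReal.mul_lt_top (ENNReal.mul_lt_top
    (ENNReal.mul_lt_top (by simp) hD.lt_top) ha'.lt_top) hΩfin.lt_top)).ne
  set Es : Set S := ⋃ j : ℤ × ι, ⋃ _ : (Q j).Nonempty, E j.1 j.2 with hEsdef
  have hEsμ : μ Es ≤ C₂ * μ Ω := by
    rw [hΩQ, measure_iUnion hQd hQm, ← ENNReal.tsum_mul_left]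
    refine (measure_iUnion_le _).trans (ENNReal.tsum_le_tsum fun j => ?_)
    by_cases h : (Q j).Nonempty
    · rw [DyadicGrid.measure_maximalCell hP h]
      simpa [h] using hEs j.1 j.2
    · simp [h]
  set NTb := sliceNorm ν q (fun x => ‖kernelConv (μ.prod ν) k b x‖ₑ) with hNTb
  have hNTbm : Measurable NTb := measurable_sliceNorm (measurable_kernelConv hk hbm).enorm
  have hTb : ∫⁻ t in Esᶜ, NTb t ∂μ ≤ C₃ * (2 * D * a * μ Ω) := by
    refine (lintegral_sliceNorm_badPart_le hq hk hki hbm hQm hQd hb0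
      (setIntegral_sub_goodPart hQm hQd hQfin hf hM) hbNfin (c := fun j => c j.1 j.2) hC₃
      fun j s hs => ?_).trans (mul_le_mul_right hbN C₃)
    refine le_trans (lintegral_mono_set (compl_subset_compl.2 ?_)) (hEH j.1 j.2 s hs.1)
    exact subset_iUnion_of_subset j (subset_iUnion_of_subset ⟨s, hs⟩ Subset.rfl)
  have hbad : μ ({t | a ≤ NTb t} ∩ Esᶜ) ≤ C₃ * (2 * D) * μ Ω := by
    have h1 : a * μ ({t | a ≤ NTb t} ∩ Esᶜ) ≤ C₃ * (2 * D * a * μ Ω) := by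
      rw [← Measure.restrict_apply (measurableSet_le measurable_const hNTbm)]
      exact (mul_meas_ge_le_lintegral hNTbm a).trans hTb
    rw [← ENNReal.mul_le_mul_iff_right ha ha']
    exact h1.trans (le_of_eq (by ring))
  have hTf : ∀ᵐ t ∂μ, sliceNorm ν q (fun x => ‖kernelConv (μ.prod ν) k f x‖ₑ) t ≤
      NTg t + NTb t := by
    filter_upwards [Measure.ae_ae_of_ae_prod (ae_integrable_kernelConv hq hr hk hki hf hfr),
      Measure.ae_ae_of_ae_prod (ae_integrable_kernelConv hq hq hk hki hgm hgfin)] with t h1 h2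
    refine le_trans (sliceNorm_mono_ae hq0 ?_) (sliceNorm_add_le hq.le
      (measurable_kernelConv hk hgm).enorm (measurable_kernelConv hk hbm).enorm t)
    filter_upwards [h1, h2] with y hy1 hy2
    refine le_trans (le_of_eq ?_) (enorm_add_le _ _)
    congr 1
    have hy3 : Integrable (fun w => k ((t, y) - w) * b w) (μ.prod ν) := by
      refine (hy1.sub hy2).congr (Eventually.of_forall fun w => ?_)
      simp only [hb, mul_sub, Pi.sub_apply]
    rw [kernelConv, kernelConv, kernelConv, ← integral_add hy2 hy3]
    refine integral_congr_ae (Eventually.of_forall fun w => ?_)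
    simp only [hb]; ring
  calc μ {t | 2 * a < sliceNorm ν q (fun x => ‖kernelConv (μ.prod ν) k f x‖ₑ) t}
      ≤ μ ({t | a ≤ NTg t} ∪ (Es ∪ ({t | a ≤ NTb t} ∩ Esᶜ))) := by
        refine measure_mono_ae ?_
        filter_upwards [hTf] with t ht ht2
        have ht3 : 2 * a < NTg t + NTb t := lt_of_lt_of_le ht2 ht
        by_cases h1 : a ≤ NTg t
        · exact Or.inl h1
        by_cases h2 : t ∈ Es
        · exact Or.inr (Or.inl h2)
        refine Or.inr (Or.inr ⟨?_, h2⟩)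
        by_contra h3
        have h3' : ¬ a ≤ NTb t := h3
        rw [not_le] at h1 h3'
        have := ht3.trans (ENNReal.add_lt_add h1 h3')
        rw [two_mul] at this
        exact lt_irrefl _ this
    _ ≤ μ {t | a ≤ NTg t} + (μ Es + μ ({t | a ≤ NTb t} ∩ Esᶜ)) :=
        (measure_union_le _ _).trans (add_le_add_right (measure_union_le _ _) _)
    _ ≤ (C₁ * a ^ (-q) * X + C₁ * D ^ q * μ Ω) + (C₂ * μ Ω + C₃ * (2 * D) * μ Ω) := by
        gcongr
    _ = _ := by ring

end CalderonZygmund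

section Interpolation

open Filter Topology

variable {S : Type*} [MeasurableSpace S] {μ : Measure S} [SigmaFinite μ] {r q : ℝ}

theorem rpow_mul_lintegral_le (hrq : r < q) (hr : 0 < r) (x : ℝ≥0∞) :
    ∫⁻ l in Ioi (0 : ℝ), {l : ℝ | x ≤ ENNReal.ofReal l}.indicator
      (fun l => ENNReal.ofReal (l ^ (r - 1 - q)) * x ^ q) l ≤
      (ENNReal.ofReal (q - r))⁻¹ * x ^ r := by
  have hq : 0 < q := hr.trans hrq
  rcases eq_or_ne x ∞ with rfl | hx
  · simp
  rcases eq_or_ne x 0 with rfl | h0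
  · simp [hq, Set.indicator]
  have hx0 : 0 < x.toReal := ENNReal.toReal_pos h0 hx
  have hm : Measurable fun l : ℝ => ENNReal.ofReal (l ^ (r - 1 - q)) :=
    (measurable_id.pow_const _).ennreal_ofReal
  calc ∫⁻ l in Ioi (0 : ℝ), {l : ℝ | x ≤ ENNReal.ofReal l}.indicator
        (fun l => ENNReal.ofReal (l ^ (r - 1 - q)) * x ^ q) l
      ≤ ∫⁻ l, (Ici x.toReal).indicator (fun l => ENNReal.ofReal (l ^ (r - 1 - q)) * x ^ q) l := by
        refine (setLIntegral_le_lintegral _ _).trans (lintegral_mono fun l => ?_)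
        refine Set.indicator_le_indicator_of_subset (fun l hl => ?_) (fun _ => zero_le) l
        exact (ENNReal.le_ofReal_iff_toReal_le hx (by
          by_contra hneg
          have hl' : x ≤ ENNReal.ofReal l := hl
          rw [ENNReal.ofReal_of_nonpos (not_le.1 hneg).le] at hl'
          exact h0 (le_zero_iff.1 hl'))).1 hl
    _ = (∫⁻ l in Ioi x.toReal, ENNReal.ofReal (l ^ (r - 1 - q))) * x ^ q := by
        rw [lintegral_indicator measurableSet_Ici, lintegral_mul_const _ hm,
          setLIntegral_congr Ioi_ae_eq_Ici.symm]
    _ = ENNReal.ofReal (x.toReal ^ (r - q) / (q - r)) * x ^ q := by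
        rw [← ofReal_integral_eq_lintegral_ofReal
          (integrableOn_Ioi_rpow_of_lt (by linarith) hx0)
          ((ae_restrict_mem measurableSet_Ioi).mono fun l hl =>
            Real.rpow_nonneg (hx0.trans hl).le _),
          integral_Ioi_rpow_of_lt (by linarith) hx0]
        congr 2
        rw [show r - 1 - q + 1 = -(q - r) by ring, neg_div_neg_eq, show r - q = -(q - r) by ring]
    _ = (ENNReal.ofReal (q - r))⁻¹ * (x ^ (r - q) * x ^ q) := by
        rw [ENNReal.ofReal_div_of_pos (by linarith), ← ENNReal.ofReal_rpow_of_pos hx0,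
          ENNReal.ofReal_toReal hx, div_eq_mul_inv]
        ring
    _ ≤ _ := by
        rw [← ENNReal.rpow_add _ _ h0 hx, sub_add_cancel]

theorem mul_lintegral_le (hr : 1 < r) (x : ℝ≥0∞) :
    ∫⁻ l in Ioi (0 : ℝ), {l : ℝ | ENNReal.ofReal l / 2 < x}.indicator
      (fun l => ENNReal.ofReal (l ^ (r - 2)) * x) l ≤
      ENNReal.ofReal (2 ^ (r - 1) / (r - 1)) * x ^ r := by
  have hr1 : 0 < r - 1 := by linarith
  rcases eq_or_ne x ∞ with rfl | hx
  · rw [ENNReal.top_rpow_of_pos (by linarith), ENNReal.mul_top]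
    · exact le_top
    · simp only [ne_eq, ENNReal.ofReal_eq_zero, not_le]; positivity
  rcases eq_or_ne x 0 with rfl | h0
  · simp
  have hx0 : 0 < x.toReal := ENNReal.toReal_pos h0 hx
  have hm : Measurable fun l : ℝ => ENNReal.ofReal (l ^ (r - 2)) :=
    (measurable_id.pow_const _).ennreal_ofReal
  calc ∫⁻ l in Ioi (0 : ℝ), {l : ℝ | ENNReal.ofReal l / 2 < x}.indicator
        (fun l => ENNReal.ofReal (l ^ (r - 2)) * x) l
      = ∫⁻ l, (Ioi (0 : ℝ)).indicator ({l : ℝ | ENNReal.ofReal l / 2 < x}.indicator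
        (fun l => ENNReal.ofReal (l ^ (r - 2)) * x)) l := by
        rw [lintegral_indicator measurableSet_Ioi]
    _ ≤ ∫⁻ l, (Ioc 0 (2 * x.toReal)).indicator (fun l => ENNReal.ofReal (l ^ (r - 2)) * x) l := by
        refine lintegral_mono fun l => ?_
        rw [Set.indicator_indicator]
        refine Set.indicator_le_indicator_of_subset (fun l hl => ?_) (fun _ => zero_le) l
        refine ⟨hl.1, ?_⟩
        have h1 : ENNReal.ofReal l / 2 < x := hl.2
        rw [ENNReal.div_lt_iff (by simp) (by simp), ← ENNReal.ofReal_toReal hx,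
          ← ENNReal.ofReal_ofNat, ← ENNReal.ofReal_mul hx0.le,
          ENNReal.ofReal_lt_ofReal_iff (by positivity)] at h1
        linarith
    _ = (∫⁻ l in Ioc 0 (2 * x.toReal), ENNReal.ofReal (l ^ (r - 2))) * x := by
        rw [lintegral_indicator measurableSet_Ioc, lintegral_mul_const _ hm]
    _ = ENNReal.ofReal ((2 * x.toReal) ^ (r - 1) / (r - 1)) * x := by
        rw [← ofReal_integral_eq_lintegral_ofReal
          ((intervalIntegrable_iff_integrableOn_Ioc_of_le (by positivity)).1
            (intervalIntegral.intervalIntegrable_rpow' (by linarith)))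
          ((ae_restrict_mem measurableSet_Ioc).mono fun l hl => Real.rpow_nonneg hl.1.le _),
          ← intervalIntegral.integral_of_le (by positivity), integral_rpow (Or.inl (by linarith))]
        congr 2
        rw [show r - 2 + 1 = r - 1 by ring, Real.zero_rpow hr1.ne', sub_zero]
    _ = ENNReal.ofReal (2 ^ (r - 1) / (r - 1)) * (x ^ (r - 1) * x) := by
        rw [Real.mul_rpow (by norm_num) hx0.le, mul_div_right_comm,
          ENNReal.ofReal_mul (by positivity), ← ENNReal.ofReal_rpow_of_pos hx0,
          ENNReal.ofReal_toReal hx, mul_assoc]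
    _ ≤ _ := by
        nth_rw 2 [← ENNReal.rpow_one x]
        rw [← ENNReal.rpow_add _ _ h0 hx, sub_add_cancel]

theorem lintegral_mul_setLIntegral_le {N : S → ℝ≥0∞} (hN : Measurable N) (hrq : r < q)
    (hr : 0 < r) :
    ∫⁻ l in Ioi (0 : ℝ), ENNReal.ofReal (l ^ (r - 1 - q)) *
      ∫⁻ s in {s | N s ≤ ENNReal.ofReal l}, N s ^ q ∂μ ≤
      (ENNReal.ofReal (q - r))⁻¹ * ∫⁻ s, N s ^ r ∂μ := by
  have e : ∀ l : ℝ, ENNReal.ofReal (l ^ (r - 1 - q)) *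
      ∫⁻ s in {s | N s ≤ ENNReal.ofReal l}, N s ^ q ∂μ =
      ∫⁻ s, {l : ℝ | N s ≤ ENNReal.ofReal l}.indicator
        (fun l => ENNReal.ofReal (l ^ (r - 1 - q)) * N s ^ q) l ∂μ := fun l => by
    rw [← lintegral_const_mul _ (hN.pow_const q),
      ← lintegral_indicator (measurableSet_le hN measurable_const)]
    rfl
  have hm : Measurable fun p : ℝ × S => {l : ℝ | N p.2 ≤ ENNReal.ofReal l}.indicator
      (fun l => ENNReal.ofReal (l ^ (r - 1 - q)) * N p.2 ^ q) p.1 := by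
    have h1 : MeasurableSet {p : ℝ × S | N p.2 ≤ ENNReal.ofReal p.1} :=
      measurableSet_le (hN.comp measurable_snd) measurable_fst.ennreal_ofReal
    have h2 : Measurable fun p : ℝ × S => ENNReal.ofReal (p.1 ^ (r - 1 - q)) * N p.2 ^ q :=
      (measurable_fst.pow_const _).ennreal_ofReal.mul ((hN.comp measurable_snd).pow_const q)
    exact h2.indicator h1
  simp only [e]
  rw [lintegral_lintegral_swap hm.aemeasurable, ← lintegral_const_mul _ (hN.pow_const r)]
  exact lintegral_mono fun s => rpow_mul_lintegral_le hrq hr (N s)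

theorem lintegral_mul_setLIntegral_gt_le {N : S → ℝ≥0∞} (hN : Measurable N) (hr : 1 < r) :
    ∫⁻ l in Ioi (0 : ℝ), ENNReal.ofReal (l ^ (r - 2)) *
      ∫⁻ s in {s | ENNReal.ofReal l / 2 < N s}, N s ∂μ ≤
      ENNReal.ofReal (2 ^ (r - 1) / (r - 1)) * ∫⁻ s, N s ^ r ∂μ := by
  have e : ∀ l : ℝ, ENNReal.ofReal (l ^ (r - 2)) *
      ∫⁻ s in {s | ENNReal.ofReal l / 2 < N s}, N s ∂μ =
      ∫⁻ s, {l : ℝ | ENNReal.ofReal l / 2 < N s}.indicator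
        (fun l => ENNReal.ofReal (l ^ (r - 2)) * N s) l ∂μ := fun l => by
    rw [← lintegral_const_mul _ hN, ← lintegral_indicator (measurableSet_lt measurable_const hN)]
    rfl
  have hm : Measurable fun p : ℝ × S => {l : ℝ | ENNReal.ofReal l / 2 < N p.2}.indicator
      (fun l => ENNReal.ofReal (l ^ (r - 2)) * N p.2) p.1 := by
    have h1 : MeasurableSet {p : ℝ × S | ENNReal.ofReal p.1 / 2 < N p.2} :=
      measurableSet_lt (measurable_fst.ennreal_ofReal.div_const 2) (hN.comp measurable_snd)
    have h2 : Measurable fun p : ℝ × S => ENNReal.ofReal (p.1 ^ (r - 2)) * N p.2 :=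
      (measurable_fst.pow_const _).ennreal_ofReal.mul (hN.comp measurable_snd)
    exact h2.indicator h1
  simp only [e]
  rw [lintegral_lintegral_swap hm.aemeasurable, ← lintegral_const_mul _ (hN.pow_const r)]
  exact lintegral_mono fun s => mul_lintegral_le hr (N s)

end Interpolation

section CalderonZygmund

open Filter Topology

variable {S Y ι : Type*} [MeasurableSpace S] [TopologicalSpace S] [MeasurableSpace Y] [Countable ι]
  [AddCommGroup Y] [MeasurableAdd₂ Y] [MeasurableNeg Y]
  {μ : Measure S} {ν : Measure Y} [SigmaFinite μ] [SigmaFinite ν] [μ.OuterRegular]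
  [ν.IsAddLeftInvariant] [ν.IsNegInvariant] {r q : ℝ}
  [AddCommGroup S] [MeasurableAdd₂ S] [MeasurableNeg S] [μ.IsAddLeftInvariant]
  [μ.IsNegInvariant] {D : ℝ≥0∞}

/-- The constant in the Calderón–Zygmund theorem. -/
def czConstant (D C₁ C₂ C₃ : ℝ≥0∞) (r q : ℝ) : ℝ≥0∞ :=
  2 ^ r * (ENNReal.ofReal r * (C₁ * (ENNReal.ofReal (q - r))⁻¹ +
    (C₁ * D ^ q + C₂ + C₃ * (2 * D)) * 2 * ENNReal.ofReal (2 ^ (r - 1) / (r - 1))))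

theorem czConstant_ne_top {D C₁ C₂ C₃ : ℝ≥0∞} (hD : D ≠ ∞) (h₁ : C₁ ≠ ∞) (h₂ : C₂ ≠ ∞)
    (h₃ : C₃ ≠ ∞) (hr : 1 < r) (hrq : r < q) : czConstant D C₁ C₂ C₃ r q ≠ ∞ := by
  have hDq : D ^ q ≠ ∞ := ENNReal.rpow_ne_top_of_nonneg (by linarith) hD
  have h2 : (2 : ℝ≥0∞) ^ r ≠ ∞ := ENNReal.rpow_ne_top_of_nonneg (by linarith) (by simp)
  have hi : (ENNReal.ofReal (q - r))⁻¹ ≠ ∞ := by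
    rw [ENNReal.inv_ne_top]; simpa using hrq
  unfold czConstant
  finiteness

/-- **The Calderón–Zygmund theorem** for kernels acting on `L^r(S; L^q(Y))`. -/
theorem MixedBound.of_hormander (𝒢 : DyadicGrid μ ι D) (hD : D ≠ ∞) (hr : 1 < r)
    (hrq : r < q) {k : S × Y → ℝ} (hk : Measurable k) (hki : Integrable k (μ.prod ν))
    {C₁ C₂ C₃ : ℝ≥0∞}
    (hB : MixedBound μ ν k q q C₁) (hC₃ : C₃ ≠ ∞) (hH : HormanderCondition 𝒢 ν k C₂ C₃) :
    MixedBound μ ν k r q (czConstant D C₁ C₂ C₃ r q) := by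
  have hq : 1 < q := hr.trans hrq
  have hr0 : 0 < r := by linarith
  refine .of_bounded hq hr hk hki fun f hf ⟨M, hM⟩ _ hfr => ?_
  set N := sliceNorm ν q (fun x => ‖f x‖ₑ) with hNdef
  have hN : Measurable N := measurable_sliceNorm hf.enorm
  set h := sliceNorm ν q (fun x => ‖kernelConv (μ.prod ν) k f x‖ₑ) with hh
  have hhm : Measurable h := measurable_sliceNorm (measurable_kernelConv hk hf).enorm
  have hhfin : ∀ᵐ t ∂μ, h t ≠ ∞ := by
    have h1 : ∫⁻ t, h t ^ r ∂μ < ∞ := by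
      refine lt_of_le_of_lt (mixedEnergy_mono_ae (by linarith) hr0
        (Eventually.of_forall fun x => enorm_kernelConv_le _ _ _ _)) ?_
      refine (mixedEnergy_lowerConv_le hq hr hk.enorm hf.enorm).trans_lt ?_
      exact ENNReal.mul_lt_top (ENNReal.rpow_lt_top_of_nonneg hr0.le hki.hasFiniteIntegral.ne) hfr
    filter_upwards [ae_lt_top (hhm.pow_const r) h1.ne] with t ht h0
    simp [h0, hr0] at ht
  set K := C₁ * D ^ q + C₂ + C₃ * (2 * D) with hK
  have hdist : ∀ l : ℝ, 0 < l → μ {t | l < (h t / 2).toReal} * ENNReal.ofReal (l ^ (r - 1)) ≤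
      C₁ * (ENNReal.ofReal (l ^ (r - 1 - q)) * ∫⁻ s in {s | N s ≤ ENNReal.ofReal l}, N s ^ q ∂μ) +
      K * 2 * (ENNReal.ofReal (l ^ (r - 2)) *
        ∫⁻ s in {s | ENNReal.ofReal l / 2 < N s}, N s ∂μ) := by
    intro l hl
    set a := ENNReal.ofReal l with ha
    have ha0 : a ≠ 0 := by simpa [ha] using hl
    have ha' : a ≠ ∞ := ENNReal.ofReal_ne_top
    have e : ∀ x : ℝ, ENNReal.ofReal (l ^ x) = a ^ x := fun x =>
      (ENNReal.ofReal_rpow_of_pos hl).symm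
    rw [e, e, e]
    have h1 : μ {t | l < (h t / 2).toReal} ≤ μ {t | 2 * a < h t} := by
      refine measure_mono fun t ht => ?_
      have h2 : a < h t / 2 := (ENNReal.ofReal_lt_iff_lt_toReal hl.le (by
        intro h0
        have ht' : l < (h t / 2).toReal := ht
        rw [h0, ENNReal.toReal_top] at ht'
        exact lt_asymm hl ht')).2 ht
      rw [ENNReal.lt_div_iff_mul_lt (by simp) (by simp)] at h2
      rwa [mem_ofPred_eq, mul_comm]
    have h2 := measure_sliceNorm_kernelConv_gt_le 𝒢 hD hr hrq hk hki hB hC₃ hH hf hM hfr ha0 ha'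
    have h3 : μ (𝒢.exceptional N a) ≤ 2 * a⁻¹ * ∫⁻ s in {s | a / 2 < N s}, N s ∂μ := by
      have h4 := DyadicGrid.measure_exceptional_le (𝒢 := 𝒢) (a := a) hN
      have ha2 : a / 2 ≠ 0 := by simpa using ha0
      have ha2' : a / 2 ≠ ∞ := ENNReal.div_ne_top ha' (by simp)
      have h5 : 2 * a⁻¹ = (a / 2)⁻¹ := by
        rw [ENNReal.inv_div (by simp) (by simp), div_eq_mul_inv]
      rw [h5, mul_comm, ← div_eq_mul_inv, ENNReal.le_div_iff_mul_le (Or.inl ha2) (Or.inl ha2'),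
        mul_comm]
      exact h4
    calc _ ≤ (C₁ * a ^ (-q) * ∫⁻ s in {s | N s ≤ a}, N s ^ q ∂μ +
          K * (2 * a⁻¹ * ∫⁻ s in {s | a / 2 < N s}, N s ∂μ)) * a ^ (r - 1) := by
          gcongr
          exact h1.trans (h2.trans (by gcongr))
      _ = C₁ * ((a ^ (r - 1) * a ^ (-q)) * ∫⁻ s in {s | N s ≤ a}, N s ^ q ∂μ) +
          K * 2 * ((a ^ (r - 1) * a⁻¹) * ∫⁻ s in {s | a / 2 < N s}, N s ∂μ) := by ring
      _ ≤ _ := by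
          rw [← ENNReal.rpow_neg_one, ← ENNReal.rpow_add _ _ ha0 ha',
            ← ENNReal.rpow_add _ _ ha0 ha', show r - 1 + -q = r - 1 - q by ring,
            show r - 1 + -1 = r - 2 by ring]
  have hmeas1 : Measurable fun l : ℝ => ENNReal.ofReal (l ^ (r - 1 - q)) *
      ∫⁻ s in {s | N s ≤ ENNReal.ofReal l}, N s ^ q ∂μ := by
    refine (measurable_id.pow_const _).ennreal_ofReal.mul ?_
    refine Monotone.measurable fun l l' hll' => lintegral_mono_set fun s hs => ?_
    exact le_trans hs (ENNReal.ofReal_le_ofReal hll')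
  calc mixedEnergy μ ν r q (fun x => ‖kernelConv (μ.prod ν) k f x‖ₑ)
      = ∫⁻ t, h t ^ r ∂μ := rfl
    _ = 2 ^ r * ∫⁻ t, ENNReal.ofReal ((h t / 2).toReal ^ r) ∂μ := by
        rw [← lintegral_const_mul _
          ((hhm.div_const 2).ennreal_toReal.pow_const r).ennreal_ofReal]
        refine lintegral_congr_ae ?_
        filter_upwards [hhfin] with t ht
        rw [← ENNReal.ofReal_rpow_of_nonneg ENNReal.toReal_nonneg hr0.le,
          ENNReal.ofReal_toReal (ENNReal.div_ne_top ht (by simp)),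
          ← ENNReal.mul_rpow_of_nonneg _ _ hr0.le, ENNReal.mul_div_cancel (by simp) (by simp)]
    _ = 2 ^ r * (ENNReal.ofReal r * ∫⁻ l in Ioi 0, μ {t | l < (h t / 2).toReal} *
          ENNReal.ofReal (l ^ (r - 1))) := by
        rw [lintegral_rpow_eq_lintegral_meas_lt_mul μ
          (Eventually.of_forall fun t => ENNReal.toReal_nonneg)
          (hhm.div_const 2).ennreal_toReal.aemeasurable hr0]
    _ ≤ 2 ^ r * (ENNReal.ofReal r * ∫⁻ l in Ioi (0 : ℝ), (C₁ * (ENNReal.ofReal (l ^ (r - 1 - q)) *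
          ∫⁻ s in {s | N s ≤ ENNReal.ofReal l}, N s ^ q ∂μ) +
          K * 2 * (ENNReal.ofReal (l ^ (r - 2)) *
            ∫⁻ s in {s | ENNReal.ofReal l / 2 < N s}, N s ∂μ))) := by
        gcongr 2 ^ r * (ENNReal.ofReal r * ?_)
        exact setLIntegral_mono' measurableSet_Ioi hdist
    _ ≤ 2 ^ r * (ENNReal.ofReal r * (C₁ * ((ENNReal.ofReal (q - r))⁻¹ * ∫⁻ s, N s ^ r ∂μ) +
          K * 2 * (ENNReal.ofReal (2 ^ (r - 1) / (r - 1)) * ∫⁻ s, N s ^ r ∂μ))) := by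
        gcongr 2 ^ r * (ENNReal.ofReal r * ?_)
        have hmeas2 : Measurable fun l : ℝ => ENNReal.ofReal (l ^ (r - 2)) *
            ∫⁻ s in {s | ENNReal.ofReal l / 2 < N s}, N s ∂μ := by
          refine (measurable_id.pow_const _).ennreal_ofReal.mul ?_
          refine Antitone.measurable fun l l' hll' => lintegral_mono_set fun s hs => ?_
          exact lt_of_le_of_lt (ENNReal.div_le_div_right (ENNReal.ofReal_le_ofReal hll') _) hs
        rw [lintegral_add_left (hmeas1.const_mul _), lintegral_const_mul _ hmeas1,
          lintegral_const_mul _ hmeas2]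
        gcongr
        · exact lintegral_mul_setLIntegral_le hN hrq hr0
        · exact lintegral_mul_setLIntegral_gt_le hN hr
    _ = czConstant D C₁ C₂ C₃ r q * mixedEnergy μ ν r q (fun x => ‖f x‖ₑ) := by
        simp only [czConstant, mixedEnergy, ← hNdef, ← hK]
        ring

end CalderonZygmund

section HeatHessian

variable {d : ℕ} {v w z x : EuclideanSpace ℝ (Fin d)} {u : ℝ}

/-- The second derivative of the heat kernel in the directions `v` and `w`. -/
def heatHessian (d : ℕ) (v w : EuclideanSpace ℝ (Fin d)) (u : ℝ) (x : EuclideanSpace ℝ (Fin d)) :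
    ℝ :=
  (inner ℝ x v * inner ℝ x w / (4 * u ^ 2) - inner ℝ v w / (2 * u)) * heatKernel d u x

/-- A Gaussian dominating the derivatives of the heat kernel. -/
def gaussEnvelope (d : ℕ) (u : ℝ) (x : EuclideanSpace ℝ (Fin d)) : ℝ :=
  (4 * Real.pi * u) ^ (-(d : ℝ) / 2) * Real.exp (-‖x‖ ^ 2 / (8 * u))

theorem heatKernel_nonneg (hu : 0 ≤ u) (x : EuclideanSpace ℝ (Fin d)) : 0 ≤ heatKernel d u x := by
  unfold heatKernel; positivity

theorem gaussEnvelope_nonneg (hu : 0 ≤ u) (x : EuclideanSpace ℝ (Fin d)) :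
    0 ≤ gaussEnvelope d u x := by
  unfold gaussEnvelope; positivity

theorem measurable_heatKernel :
    Measurable fun p : ℝ × EuclideanSpace ℝ (Fin d) => heatKernel d p.1 p.2 := by
  unfold heatKernel; fun_prop

theorem measurable_gaussEnvelope :
    Measurable fun p : ℝ × EuclideanSpace ℝ (Fin d) => gaussEnvelope d p.1 p.2 := by
  unfold gaussEnvelope; fun_prop

theorem measurable_heatHessian :
    Measurable fun p : ℝ × EuclideanSpace ℝ (Fin d) => heatHessian d v w p.1 p.2 := by
  unfold heatHessian
  have := measurable_heatKernel (d := d)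
  fun_prop

theorem lintegral_gaussEnvelope (hu : 0 < u) :
    ∫⁻ x, ENNReal.ofReal (gaussEnvelope d u x) = ENNReal.ofReal (2 ^ ((d : ℝ) / 2)) := by
  have hb : 0 < 1 / (8 * u) := by positivity
  have hI := GaussianFourier.integral_rexp_neg_mul_sq_norm (V := EuclideanSpace ℝ (Fin d)) hb
  have hInt : Integrable fun x : EuclideanSpace ℝ (Fin d) => Real.exp (-(1 / (8 * u)) * ‖x‖ ^ 2) := by
    by_contra h
    rw [integral_undef h] at hI
    have : 0 < (π / (1 / (8 * u))) ^ ((Module.finrank ℝ (EuclideanSpace ℝ (Fin d)) : ℝ) / 2) := by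
      positivity
    linarith
  have he : ∀ x, gaussEnvelope d u x =
      (4 * π * u) ^ (-(d : ℝ) / 2) * Real.exp (-(1 / (8 * u)) * ‖x‖ ^ 2) := by
    intro x; unfold gaussEnvelope; congr 2; field_simp
  simp_rw [he]
  rw [← ofReal_integral_eq_lintegral_ofReal (hInt.const_mul _)
    (.of_forall fun x => by positivity), integral_const_mul, hI, finrank_euclideanSpace,
    Fintype.card_fin]
  congr 1
  have h1 : π / (1 / (8 * u)) = 2 * (4 * π * u) := by field_simp; norm_num
  have h2 : 0 < 4 * π * u := by positivity
  rw [h1, Real.mul_rpow zero_le_two h2.le, neg_div, Real.rpow_neg h2.le, mul_comm (2 ^ _),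
    inv_mul_cancel_left₀ (by positivity)]

theorem one_add_pow_mul_heatKernel_le (hu : 0 < u) {k : ℕ} (hk : k ≤ 3) :
    (1 + ‖x‖ ^ 2 / u) ^ k * heatKernel d u x ≤ 6144 * gaussEnvelope d u x := by
  have hX : 0 ≤ ‖x‖ ^ 2 / u := by positivity
  set X := ‖x‖ ^ 2 / u with hXd
  have h1 : (1 + X) ^ k ≤ (1 + X) ^ 3 := pow_le_pow_right₀ (by linarith) hk
  have h2 := Real.pow_div_factorial_le_exp (x := (1 + X) / 8) (by positivity) 3
  have h3 : Real.exp ((1 + X) / 8) ≤ 2 * Real.exp (X / 8) := by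
    rw [add_div, Real.exp_add]
    refine mul_le_mul_of_nonneg_right ?_ (Real.exp_pos _).le
    have := Real.exp_bound_div_one_sub_of_interval (x := 1 / 8) (by norm_num) (by norm_num)
    linarith
  have h4 : (1 + X) ^ 3 ≤ 6144 * Real.exp (X / 8) := by
    have : ((3).factorial : ℝ) = 6 := by norm_num [Nat.factorial]
    rw [this] at h2
    nlinarith
  unfold heatKernel gaussEnvelope
  have e1 : -‖x‖ ^ 2 / (4 * u) = -(X / 4) := by rw [hXd]; field_simp
  have e2 : -‖x‖ ^ 2 / (8 * u) = -(X / 8) := by rw [hXd]; field_simp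
  rw [e1, e2]
  have h5 : Real.exp (X / 8) * Real.exp (-(X / 4)) = Real.exp (-(X / 8)) := by
    rw [← Real.exp_add]; congr 1; ring
  calc (1 + X) ^ k * ((4 * π * u) ^ (-(d : ℝ) / 2) * Real.exp (-(X / 4)))
      ≤ (6144 * Real.exp (X / 8)) * ((4 * π * u) ^ (-(d : ℝ) / 2) * Real.exp (-(X / 4))) := by
        gcongr; exact h1.trans h4
    _ = 6144 * ((4 * π * u) ^ (-(d : ℝ) / 2) * (Real.exp (X / 8) * Real.exp (-(X / 4)))) := by ring
    _ = _ := by rw [h5]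

theorem abs_inner_le_of_norm_le_one (hv : ‖v‖ ≤ 1) : |inner ℝ x v| ≤ ‖x‖ :=
  (abs_real_inner_le_norm x v).trans (mul_le_of_le_one_right (norm_nonneg _) hv)

theorem abs_hessian_coeff_le (hu : 0 < u) (hv : ‖v‖ ≤ 1) (hw : ‖w‖ ≤ 1) :
    |inner ℝ x v * inner ℝ x w / (4 * u ^ 2) - inner ℝ v w / (2 * u)| ≤
      u⁻¹ * (‖x‖ ^ 2 / u / 4 + 1 / 2) := by
  have h1 : |inner ℝ x v * inner ℝ x w / (4 * u ^ 2)| ≤ ‖x‖ ^ 2 / (4 * u ^ 2) := by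
    rw [abs_div, abs_mul, abs_of_pos (show 0 < 4 * u ^ 2 by positivity)]
    gcongr
    rw [sq]
    exact mul_le_mul (abs_inner_le_of_norm_le_one hv) (abs_inner_le_of_norm_le_one hw)
      (abs_nonneg _) (norm_nonneg _)
  have h2 : |inner ℝ v w / (2 * u)| ≤ 1 / (2 * u) := by
    rw [abs_div, abs_of_pos (show 0 < 2 * u by positivity)]
    gcongr
    exact (abs_inner_le_of_norm_le_one hw).trans hv
  calc _ ≤ ‖x‖ ^ 2 / (4 * u ^ 2) + 1 / (2 * u) := (abs_sub _ _).trans (add_le_add h1 h2)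
    _ = _ := by field_simp

theorem abs_heatHessian_le (hu : 0 < u) (hv : ‖v‖ ≤ 1) (hw : ‖w‖ ≤ 1) :
    |heatHessian d v w u x| ≤ 6144 * u⁻¹ * gaussEnvelope d u x := by
  have hG := heatKernel_nonneg hu.le x
  rw [heatHessian, abs_mul, abs_of_nonneg hG]
  have h := one_add_pow_mul_heatKernel_le (d := d) (x := x) hu (k := 1) (by norm_num)
  have hX : 0 ≤ ‖x‖ ^ 2 / u := by positivity
  calc _ ≤ (u⁻¹ * (1 + ‖x‖ ^ 2 / u) ^ 1) * heatKernel d u x := by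
        gcongr
        refine (abs_hessian_coeff_le hu hv hw).trans ?_
        gcongr; linarith
    _ ≤ _ := by
        rw [mul_assoc, mul_comm 6144, mul_assoc]; gcongr

theorem norm_sq_mul_abs_heatHessian_le (hu : 0 < u) (hv : ‖v‖ ≤ 1) (hw : ‖w‖ ≤ 1) :
    ‖x‖ ^ 2 * |heatHessian d v w u x| ≤ 6144 * gaussEnvelope d u x := by
  have hG := heatKernel_nonneg hu.le x
  rw [heatHessian, abs_mul, abs_of_nonneg hG]
  refine le_trans ?_ (one_add_pow_mul_heatKernel_le (d := d) (x := x) hu (k := 2) (by norm_num))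
  have hX : 0 ≤ ‖x‖ ^ 2 / u := by positivity
  rw [← mul_assoc]
  gcongr
  calc _ ≤ ‖x‖ ^ 2 * (u⁻¹ * (‖x‖ ^ 2 / u / 4 + 1 / 2)) := by
        gcongr; exact abs_hessian_coeff_le hu hv hw
    _ = ‖x‖ ^ 2 / u * (‖x‖ ^ 2 / u / 4 + 1 / 2) := by ring
    _ ≤ _ := by nlinarith

theorem hasDerivAt_heatKernel_time (hu : 0 < u) (x : EuclideanSpace ℝ (Fin d)) :
    HasDerivAt (fun u => heatKernel d u x)
      ((-(d : ℝ) / (2 * u) + ‖x‖ ^ 2 / (4 * u ^ 2)) * heatKernel d u x) u := by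
  unfold heatKernel
  have h0 : 4 * π * u ≠ 0 := by positivity
  have h1 : HasDerivAt (fun u : ℝ => (4 * π * u) ^ (-(d : ℝ) / 2))
      (4 * π * (-(d : ℝ) / 2) * (4 * π * u) ^ (-(d : ℝ) / 2 - 1)) u := by
    have := ((hasDerivAt_id u).const_mul (4 * π)).rpow_const (p := -(d : ℝ) / 2) (Or.inl h0)
    simpa using this
  have h2 : HasDerivAt (fun u : ℝ => Real.exp (-‖x‖ ^ 2 / (4 * u)))
      (Real.exp (-‖x‖ ^ 2 / (4 * u)) * (‖x‖ ^ 2 / (4 * u ^ 2))) u := by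
    have h3 : HasDerivAt (fun u : ℝ => -‖x‖ ^ 2 / (4 * u)) (‖x‖ ^ 2 / (4 * u ^ 2)) u := by
      have := (hasDerivAt_const u (-‖x‖ ^ 2)).div ((hasDerivAt_id u).const_mul 4)
        (by simpa using hu.ne')
      refine this.congr_deriv ?_
      simp only [id]
      field_simp
      ring
    exact h3.exp
  refine (h1.mul h2).congr_deriv ?_
  rw [Real.rpow_sub_one h0]
  field_simp

theorem hasDerivAt_heatHessian_time (hu : 0 < u) (x : EuclideanSpace ℝ (Fin d)) :
    HasDerivAt (fun u => heatHessian d v w u x)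
      ((inner ℝ v w / (2 * u ^ 2) - inner ℝ x v * inner ℝ x w / (2 * u ^ 3) +
        (inner ℝ x v * inner ℝ x w / (4 * u ^ 2) - inner ℝ v w / (2 * u)) *
          (-(d : ℝ) / (2 * u) + ‖x‖ ^ 2 / (4 * u ^ 2))) * heatKernel d u x) u := by
  unfold heatHessian
  have h1 : HasDerivAt (fun u : ℝ => inner ℝ x v * inner ℝ x w / (4 * u ^ 2) -
      inner ℝ v w / (2 * u))
      (inner ℝ v w / (2 * u ^ 2) - inner ℝ x v * inner ℝ x w / (2 * u ^ 3)) u := by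
    have a := (hasDerivAt_const u (inner ℝ x v * inner ℝ x w)).div
      ((hasDerivAt_pow 2 u).const_mul 4) (by positivity)
    have b := (hasDerivAt_const u (inner ℝ v w)).div ((hasDerivAt_id u).const_mul 2)
        (by simpa using hu.ne')
    refine (a.sub b).congr_deriv ?_
    simp only [id]
    field_simp
    ring
  refine (h1.mul (hasDerivAt_heatKernel_time hu x)).congr_deriv ?_
  ring

theorem abs_deriv_heatHessian_time_le (hu : 0 < u) (hv : ‖v‖ ≤ 1) (hw : ‖w‖ ≤ 1) :
    |deriv (fun u => heatHessian d v w u x) u| ≤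
      6144 * (1 + d) * (u⁻¹ ^ 2 * gaussEnvelope d u x) := by
  have hG := heatKernel_nonneg hu.le x
  rw [(hasDerivAt_heatHessian_time hu x).deriv, abs_mul, abs_of_nonneg hG]
  have h := one_add_pow_mul_heatKernel_le (d := d) (x := x) hu (k := 2) (by norm_num)
  have hX : 0 ≤ ‖x‖ ^ 2 / u := by positivity
  set X := ‖x‖ ^ 2 / u with hXd
  have h1 : |inner ℝ v w / (2 * u ^ 2) - inner ℝ x v * inner ℝ x w / (2 * u ^ 3)| ≤
      u⁻¹ ^ 2 * (X / 2 + 1 / 2) := by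
    have a1 : |inner ℝ x v * inner ℝ x w / (2 * u ^ 3)| ≤ ‖x‖ ^ 2 / (2 * u ^ 3) := by
      rw [abs_div, abs_mul, abs_of_pos (show 0 < 2 * u ^ 3 by positivity)]
      gcongr
      rw [sq]
      exact mul_le_mul (abs_inner_le_of_norm_le_one hv) (abs_inner_le_of_norm_le_one hw)
        (abs_nonneg _) (norm_nonneg _)
    have a2 : |inner ℝ v w / (2 * u ^ 2)| ≤ 1 / (2 * u ^ 2) := by
      rw [abs_div, abs_of_pos (show 0 < 2 * u ^ 2 by positivity)]
      gcongr
      exact (abs_inner_le_of_norm_le_one hw).trans hv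
    calc _ ≤ 1 / (2 * u ^ 2) + ‖x‖ ^ 2 / (2 * u ^ 3) := (abs_sub _ _).trans (add_le_add a2 a1)
      _ = _ := by rw [hXd]; field_simp; ring
  have h2 : |-(d : ℝ) / (2 * u) + ‖x‖ ^ 2 / (4 * u ^ 2)| ≤ u⁻¹ * (d / 2 + X / 4) := by
    refine (abs_add_le _ _).trans (le_of_eq ?_)
    rw [abs_div, abs_neg, abs_of_nonneg (Nat.cast_nonneg d), abs_of_pos (by positivity : 0 < 2 * u),
      abs_of_nonneg (by positivity), hXd]
    field_simp
  calc _ ≤ (u⁻¹ ^ 2 * (X / 2 + 1 / 2) + (u⁻¹ * (X / 4 + 1 / 2)) * (u⁻¹ * (d / 2 + X / 4))) *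
        heatKernel d u x := by
        gcongr
        refine (abs_add_le _ _).trans (add_le_add h1 ?_)
        rw [abs_mul]
        exact mul_le_mul (abs_hessian_coeff_le hu hv hw) h2 (abs_nonneg _) (by positivity)
    _ ≤ ((1 + d) * u⁻¹ ^ 2 * (1 + X) ^ 2) * heatKernel d u x := by
        gcongr
        have hd : (0:ℝ) ≤ d := Nat.cast_nonneg d
        have : (X / 2 + 1 / 2) + (X / 4 + 1 / 2) * (d / 2 + X / 4) ≤ (1 + d) * (1 + X) ^ 2 := by
          nlinarith [mul_nonneg hd hX, mul_nonneg hd (mul_nonneg hX hX), mul_nonneg hX hX]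
        calc _ = u⁻¹ ^ 2 * ((X / 2 + 1 / 2) + (X / 4 + 1 / 2) * (d / 2 + X / 4)) := by ring
          _ ≤ u⁻¹ ^ 2 * ((1 + d) * (1 + X) ^ 2) := by gcongr
          _ = _ := by ring
    _ = (1 + d) * u⁻¹ ^ 2 * ((1 + X) ^ 2 * heatKernel d u x) := by ring
    _ ≤ (1 + d) * u⁻¹ ^ 2 * (6144 * gaussEnvelope d u x) := by gcongr
    _ = _ := by ring

theorem hasFDerivAt_heatKernel (hu : 0 < u) (x : EuclideanSpace ℝ (Fin d)) :
    HasFDerivAt (heatKernel d u) (-(heatKernel d u x / (2 * u)) • innerSL ℝ x) x := by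
  have h1 : HasFDerivAt (fun x : EuclideanSpace ℝ (Fin d) => -‖x‖ ^ 2 / (4 * u))
      ((-(4 * u)⁻¹) • (2 • innerSL ℝ x)) x := by
    have := ((hasStrictFDerivAt_norm_sq x).hasFDerivAt).const_mul (-(4 * u)⁻¹)
    refine this.congr_of_eventuallyEq (.of_forall fun y => ?_)
    simp only
    ring
  refine (h1.exp.const_mul ((4 * π * u) ^ (-(d : ℝ) / 2))).congr_fderiv ?_
  ext y
  simp [heatKernel]
  field_simp
  ring

theorem hasFDerivAt_heatHessian (hu : 0 < u) (x : EuclideanSpace ℝ (Fin d)) :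
    HasFDerivAt (heatHessian d v w u)
      (heatKernel d u x • ((4 * u ^ 2)⁻¹ • (inner ℝ x v • innerSL ℝ w + inner ℝ x w • innerSL ℝ v)
        - ((inner ℝ x v * inner ℝ x w / (4 * u ^ 2) - inner ℝ v w / (2 * u)) / (2 * u)) •
          innerSL ℝ x)) x := by
  have hl : ∀ v : EuclideanSpace ℝ (Fin d), HasFDerivAt (fun x => inner ℝ x v) (innerSL ℝ v) x := by
    intro v
    have := (innerSL ℝ v).hasFDerivAt (x := x)
    refine this.congr_of_eventuallyEq (.of_forall fun y => ?_)
    simp [real_inner_comm]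
  have h1 := ((((hl v).mul (hl w)).const_mul (4 * u ^ 2)⁻¹).sub_const
    (inner ℝ v w / (2 * u))).mul (hasFDerivAt_heatKernel hu x)
  refine (h1.congr_of_eventuallyEq (.of_forall fun y => ?_)).congr_fderiv ?_
  · simp only [heatHessian, Pi.mul_apply]; ring
  · ext y
    simp
    field_simp
    ring

theorem abs_fderiv_heatHessian_le (hu : 0 < u) (hv : ‖v‖ ≤ 1) (hw : ‖w‖ ≤ 1) :
    |fderiv ℝ (heatHessian d v w u) x z| ≤
      6144 * (‖z‖ * u ^ (-(3 / 2) : ℝ) * gaussEnvelope d u x) := by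
  have hG := heatKernel_nonneg hu.le x
  rw [(hasFDerivAt_heatHessian hu x).fderiv]
  have h := one_add_pow_mul_heatKernel_le (d := d) (x := x) hu (k := 2) (by norm_num)
  obtain ⟨m, hm, rfl⟩ : ∃ m, 0 < m ∧ u = m ^ 2 := ⟨√u, Real.sqrt_pos.2 hu, (Real.sq_sqrt hu.le).symm⟩
  have e1 : (m ^ 2) ^ (-(3 / 2) : ℝ) = (m ^ 3)⁻¹ := by
    rw [← Real.rpow_natCast, ← Real.rpow_mul hm.le, ← Real.rpow_natCast, ← Real.rpow_neg hm.le]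
    norm_num
  rw [e1]
  set a := ‖x‖ / m with ha
  have ha0 : 0 ≤ a := by positivity
  have hx : ‖x‖ = a * m := by rw [ha]; field_simp
  have hX : ‖x‖ ^ 2 / m ^ 2 = a ^ 2 := by rw [hx]; field_simp
  rw [hX] at h
  have hc := abs_hessian_coeff_le (x := x) hu hv hw
  rw [hX] at hc
  set κ := inner ℝ x v * inner ℝ x w / (4 * (m ^ 2) ^ 2) - inner ℝ v w / (2 * m ^ 2)
  have hpair : ∀ v w : EuclideanSpace ℝ (Fin d), ‖v‖ ≤ 1 → ‖w‖ ≤ 1 →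
      |inner ℝ x v * inner ℝ w z| ≤ (a * m) * ‖z‖ := by
    intro v w hv hw
    rw [abs_mul, ← hx]
    refine mul_le_mul (abs_inner_le_of_norm_le_one hv) ?_ (abs_nonneg _) (norm_nonneg _)
    rw [real_inner_comm]
    exact abs_inner_le_of_norm_le_one hw
  have hxz : |inner ℝ x z| ≤ (a * m) * ‖z‖ := hx ▸ abs_real_inner_le_norm x z
  have h2 : |(4 * (m ^ 2) ^ 2)⁻¹ * (inner ℝ x v * inner ℝ w z + inner ℝ x w * inner ℝ v z) -
      κ / (2 * m ^ 2) * inner ℝ x z| ≤ (m ^ 3)⁻¹ * ‖z‖ * (1 + a ^ 2) ^ 2 := by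
    have b1 : |(4 * (m ^ 2) ^ 2)⁻¹ * (inner ℝ x v * inner ℝ w z + inner ℝ x w * inner ℝ v z)| ≤
        (4 * (m ^ 2) ^ 2)⁻¹ * (a * m * ‖z‖ + a * m * ‖z‖) := by
      rw [abs_mul, abs_of_pos (show 0 < (4 * (m ^ 2) ^ 2)⁻¹ by positivity)]
      gcongr
      exact (abs_add_le _ _).trans (add_le_add (hpair v w hv hw) (hpair w v hw hv))
    have b2 : |κ / (2 * m ^ 2) * inner ℝ x z| ≤
        ((m ^ 2)⁻¹ * (a ^ 2 / 4 + 1 / 2)) / (2 * m ^ 2) * (a * m * ‖z‖) := by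
      rw [abs_mul, abs_div, abs_of_pos (show 0 < 2 * m ^ 2 by positivity)]
      gcongr
    refine ((abs_sub _ _).trans (add_le_add b1 b2)).trans ?_
    have : (4 * (m ^ 2) ^ 2)⁻¹ * (a * m * ‖z‖ + a * m * ‖z‖) +
        ((m ^ 2)⁻¹ * (a ^ 2 / 4 + 1 / 2)) / (2 * m ^ 2) * (a * m * ‖z‖) =
        (m ^ 3)⁻¹ * ‖z‖ * (a / 2 + (a ^ 2 / 4 + 1 / 2) * a / 2) := by
      field_simp; ring
    rw [this]
    gcongr
    nlinarith [sq_nonneg (a - 1), sq_nonneg (a ^ 2 - a), mul_nonneg ha0 ha0]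
  calc _ = |((4 * (m ^ 2) ^ 2)⁻¹ * (inner ℝ x v * inner ℝ w z + inner ℝ x w * inner ℝ v z) -
      κ / (2 * m ^ 2) * inner ℝ x z) * heatKernel d (m ^ 2) x| := by
        congr 1
        simp
        ring
    _ = |((4 * (m ^ 2) ^ 2)⁻¹ * (inner ℝ x v * inner ℝ w z + inner ℝ x w * inner ℝ v z) -
      κ / (2 * m ^ 2) * inner ℝ x z)| * heatKernel d (m ^ 2) x := by
        rw [abs_mul, abs_of_nonneg hG]
    _ ≤ ((m ^ 3)⁻¹ * ‖z‖ * (1 + a ^ 2) ^ 2) * heatKernel d (m ^ 2) x := by gcongr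
    _ = (m ^ 3)⁻¹ * ‖z‖ * ((1 + a ^ 2) ^ 2 * heatKernel d (m ^ 2) x) := by ring
    _ ≤ (m ^ 3)⁻¹ * ‖z‖ * (6144 * gaussEnvelope d (m ^ 2) x) := by gcongr
    _ = _ := by ring

end HeatHessian

section TruncatedKernel

variable {d : ℕ} {v w : EuclideanSpace ℝ (Fin d)} {ε u : ℝ}

/-- A smooth cutoff removing small and large times. -/
def timeCutoff (ε u : ℝ) : ℝ := u / ((u + ε) * (1 + ε * u))

/-- The heat Hessian, cut off in time and extended by zero to negative times. -/
def truncatedKernel (d : ℕ) (v w : EuclideanSpace ℝ (Fin d)) (ε : ℝ)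
    (p : ℝ × EuclideanSpace ℝ (Fin d)) : ℝ :=
  if 0 < p.1 then timeCutoff ε p.1 * heatHessian d v w p.1 p.2 else 0

theorem timeCutoff_nonneg (hε : 0 < ε) (hu : 0 ≤ u) : 0 ≤ timeCutoff ε u := by
  unfold timeCutoff; positivity

theorem timeCutoff_le_one (hε : 0 < ε) (hu : 0 ≤ u) : timeCutoff ε u ≤ 1 := by
  unfold timeCutoff
  rw [div_le_one (by positivity)]
  nlinarith [mul_nonneg hε.le hu, mul_nonneg hu hu, mul_nonneg hε.le (mul_nonneg hu hu),
    mul_nonneg hε.le (mul_nonneg hε.le hu)]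

theorem timeCutoff_mul_inv_le (hε : 0 < ε) (hu : 0 < u) :
    timeCutoff ε u * u⁻¹ ≤ ε⁻¹ * (1 + u ^ 2)⁻¹ := by
  unfold timeCutoff
  rw [← mul_inv, div_mul_eq_mul_div, mul_inv_cancel₀ hu.ne', one_div]
  refine inv_anti₀ (by positivity) ?_
  nlinarith [mul_nonneg hε.le (mul_nonneg hε.le hu.le)]

theorem hasDerivAt_timeCutoff (hε : 0 < ε) (hu : 0 < u) :
    HasDerivAt (timeCutoff ε) (timeCutoff ε u * (1 / u - 1 / (u + ε) - ε / (1 + ε * u))) u := by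
  unfold timeCutoff
  have h1 : HasDerivAt (fun u : ℝ => (u + ε) * (1 + ε * u)) (1 * (1 + ε * u) + (u + ε) * ε) u := by
    have a : HasDerivAt (fun u : ℝ => u + ε) 1 u := (hasDerivAt_id u).add_const ε
    have b : HasDerivAt (fun u : ℝ => 1 + ε * u) ε u := by
      simpa using ((hasDerivAt_id u).const_mul ε).const_add 1
    exact a.mul b
  refine ((hasDerivAt_id u).div h1 (by positivity)).congr_deriv ?_
  simp only [id]
  field_simp
  ring

theorem abs_deriv_timeCutoff_le (hε : 0 < ε) (hu : 0 < u) : |deriv (timeCutoff ε) u| ≤ u⁻¹ := by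
  rw [(hasDerivAt_timeCutoff hε hu).deriv, abs_mul, abs_of_nonneg (timeCutoff_nonneg hε hu.le)]
  have h1 : |1 / u - 1 / (u + ε) - ε / (1 + ε * u)| ≤ u⁻¹ := by
    have a1 : 0 ≤ 1 / (u + ε) := by positivity
    have a2 : 1 / (u + ε) ≤ 1 / u := by gcongr; linarith
    have a3 : 0 ≤ ε / (1 + ε * u) := by positivity
    have a4 : ε / (1 + ε * u) ≤ 1 / u := by
      rw [div_le_div_iff₀ (by positivity) hu]; linarith
    rw [abs_le, ← one_div]
    constructor <;> linarith
  calc _ ≤ 1 * u⁻¹ := mul_le_mul (timeCutoff_le_one hε hu.le) h1 (abs_nonneg _) zero_le_one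
    _ = _ := one_mul _

theorem measurable_timeCutoff : Measurable (timeCutoff ε) := by
  unfold timeCutoff; fun_prop

theorem measurable_truncatedKernel : Measurable (truncatedKernel d v w ε) := by
  unfold truncatedKernel
  have h1 := measurable_heatHessian (d := d) (v := v) (w := w)
  have h2 := measurable_timeCutoff (ε := ε)
  exact Measurable.ite (measurableSet_lt measurable_const measurable_fst)
    ((h2.comp measurable_fst).mul h1) measurable_const

theorem enorm_truncatedKernel_le (hε : 0 < ε) (hv : ‖v‖ ≤ 1) (hw : ‖w‖ ≤ 1)
    (p : ℝ × EuclideanSpace ℝ (Fin d)) :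
    ‖truncatedKernel d v w ε p‖ₑ ≤
      ENNReal.ofReal (6144 * (ε⁻¹ * (1 + p.1 ^ 2)⁻¹)) * ENNReal.ofReal (gaussEnvelope d p.1 p.2) := by
  unfold truncatedKernel
  split_ifs with h
  · rw [← ofReal_mul (by positivity), Real.enorm_eq_ofReal_abs, abs_mul,
      abs_of_nonneg (timeCutoff_nonneg hε h.le)]
    refine ofReal_le_ofReal ?_
    have hc := timeCutoff_nonneg hε h.le
    have hg := gaussEnvelope_nonneg h.le p.2
    calc _ ≤ timeCutoff ε p.1 * (6144 * p.1⁻¹ * gaussEnvelope d p.1 p.2) := by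
          gcongr; exact abs_heatHessian_le h hv hw
      _ = 6144 * (timeCutoff ε p.1 * p.1⁻¹) * gaussEnvelope d p.1 p.2 := by ring
      _ ≤ _ := mul_le_mul_of_nonneg_right
          (mul_le_mul_of_nonneg_left (timeCutoff_mul_inv_le hε h) (by norm_num)) hg
  · simp

theorem integrable_truncatedKernel (hε : 0 < ε) (hv : ‖v‖ ≤ 1) (hw : ‖w‖ ≤ 1) :
    Integrable (truncatedKernel d v w ε) (volume.prod volume) := by
  refine ⟨measurable_truncatedKernel.aestronglyMeasurable, ?_⟩
  rw [hasFiniteIntegral_iff_enorm, lintegral_prod _ measurable_truncatedKernel.enorm.aemeasurable]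
  have hb : ∀ u : ℝ, ∫⁻ x, ‖truncatedKernel d v w ε (u, x)‖ₑ ≤
      ENNReal.ofReal (6144 * (ε⁻¹ * (1 + u ^ 2)⁻¹)) * ENNReal.ofReal (2 ^ ((d : ℝ) / 2)) := by
    intro u
    by_cases hu : 0 < u
    · refine (lintegral_mono fun x => enorm_truncatedKernel_le hε hv hw (u, x)).trans ?_
      simp only
      rw [lintegral_const_mul' _ _ ofReal_ne_top, lintegral_gaussEnvelope hu]
    · simp [truncatedKernel, hu]
  refine (lintegral_mono hb).trans_lt ?_
  rw [lintegral_mul_const' _ _ ofReal_ne_top]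
  refine ENNReal.mul_lt_top ?_ ofReal_lt_top
  exact ((integrable_inv_one_add_sq.const_mul ε⁻¹).const_mul 6144).lintegral_lt_top

/-- Uniform size and smoothness estimates for kernels of parabolic homogeneity `-2`. -/
structure IsParabolicKernel (d : ℕ) (k : ℝ × EuclideanSpace ℝ (Fin d) → ℝ) (A : ℝ) : Prop where
  measurable : Measurable k
  nonneg : 0 ≤ A
  eq_zero : ∀ u ≤ 0, ∀ x, k (u, x) = 0
  moment : ∀ u, ∫⁻ x, ENNReal.ofReal (‖x‖ ^ 2) * ‖k (u, x)‖ₑ ≤ ENNReal.ofReal A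
  space : ∀ u, 0 < u → ∀ z, ∫⁻ x, ‖k (u, x - z) - k (u, x)‖ₑ ≤
    ENNReal.ofReal (A * ‖z‖ * u ^ (-(3 / 2) : ℝ))
  time : ∀ a b, 0 < a → a ≤ b → ∫⁻ x, ‖k (b, x) - k (a, x)‖ₑ ≤
    ENNReal.ofReal (A * (b - a) * a ^ (-2 : ℝ))

theorem truncatedKernel_moment (hε : 0 < ε) (hv : ‖v‖ ≤ 1) (hw : ‖w‖ ≤ 1) (u : ℝ) :
    ∫⁻ x, ENNReal.ofReal (‖x‖ ^ 2) * ‖truncatedKernel d v w ε (u, x)‖ₑ ≤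
      ENNReal.ofReal (6144 * 2 ^ ((d : ℝ) / 2)) := by
  by_cases hu : 0 < u
  · have : ∀ x, ENNReal.ofReal (‖x‖ ^ 2) * ‖truncatedKernel d v w ε (u, x)‖ₑ ≤
        ENNReal.ofReal 6144 * ENNReal.ofReal (gaussEnvelope d u x) := by
      intro x
      rw [← ofReal_mul (by norm_num), Real.enorm_eq_ofReal_abs, ← ofReal_mul (by positivity)]
      refine ofReal_le_ofReal ?_
      simp only [truncatedKernel, hu, if_true, abs_mul]
      rw [abs_of_nonneg (timeCutoff_nonneg hε hu.le)]
      calc _ ≤ ‖x‖ ^ 2 * (1 * |heatHessian d v w u x|) := by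
            gcongr; exact timeCutoff_le_one hε hu.le
        _ ≤ _ := by rw [one_mul]; exact norm_sq_mul_abs_heatHessian_le hu hv hw
    refine (lintegral_mono this).trans ?_
    rw [lintegral_const_mul' _ _ ofReal_ne_top, lintegral_gaussEnvelope hu, ← ofReal_mul (by norm_num)]
  · simp [truncatedKernel, hu]

theorem contDiff_heatHessian_space (u : ℝ) : ContDiff ℝ 1 (heatHessian d v w u) := by
  unfold heatHessian heatKernel
  have h : ∀ v : EuclideanSpace ℝ (Fin d), ContDiff ℝ 1 fun x => inner ℝ x v :=
    fun v => contDiff_id.inner ℝ contDiff_const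
  have h1 := h v
  have h2 := h w
  have h3 : ContDiff ℝ 1 fun x : EuclideanSpace ℝ (Fin d) => ‖x‖ ^ 2 := contDiff_norm_sq ℝ
  fun_prop

theorem truncatedKernel_space (hε : 0 < ε) (hv : ‖v‖ ≤ 1) (hw : ‖w‖ ≤ 1) {u : ℝ} (hu : 0 < u)
    (z : EuclideanSpace ℝ (Fin d)) :
    ∫⁻ x, ‖truncatedKernel d v w ε (u, x - z) - truncatedKernel d v w ε (u, x)‖ₑ ≤
      ENNReal.ofReal (6144 * 2 ^ ((d : ℝ) / 2) * ‖z‖ * u ^ (-(3 / 2) : ℝ)) := by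
  have hpt : ∀ x, ‖truncatedKernel d v w ε (u, x - z) - truncatedKernel d v w ε (u, x)‖ₑ ≤
      ∫⁻ θ in Icc (0 : ℝ) 1, ENNReal.ofReal (6144 * (‖z‖ * u ^ (-(3 / 2) : ℝ))) *
        ENNReal.ofReal (gaussEnvelope d u (x - θ • z)) := by
    intro x
    have hc : ContDiff ℝ 1 fun θ : ℝ => heatHessian d v w u (x - θ • z) :=
      (contDiff_heatHessian_space u).comp (by fun_prop)
    have h1 := enorm_sub_le_lintegral_deriv_of_contDiffOn_Icc
      (hc.contDiffOn (s := Icc 0 1)) zero_le_one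
    simp only [one_smul, zero_smul, sub_zero] at h1
    have h2 : ‖truncatedKernel d v w ε (u, x - z) - truncatedKernel d v w ε (u, x)‖ₑ ≤
        ‖heatHessian d v w u (x - z) - heatHessian d v w u x‖ₑ := by
      simp only [truncatedKernel, hu, if_true, ← mul_sub, enorm_mul]
      refine mul_le_of_le_one_left' ?_
      rw [Real.enorm_of_nonneg (timeCutoff_nonneg hε hu.le)]
      exact ofReal_le_one.2 (timeCutoff_le_one hε hu.le)
    refine h2.trans (h1.trans (lintegral_mono fun θ => ?_))
    have hd : HasDerivAt (fun θ : ℝ => heatHessian d v w u (x - θ • z))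
        (fderiv ℝ (heatHessian d v w u) (x - θ • z) (-z)) θ := by
      have a : HasDerivAt (fun θ : ℝ => x - θ • z) (-z) θ := by
        simpa using ((hasDerivAt_id θ).smul_const z).const_sub x
      exact ((contDiff_heatHessian_space u).differentiable one_ne_zero _).hasFDerivAt.comp_hasDerivAt
        θ a
    simp only
    rw [hd.deriv, ← ofReal_mul (by positivity), Real.enorm_eq_ofReal_abs]
    refine ofReal_le_ofReal ((abs_fderiv_heatHessian_le hu hv hw).trans (le_of_eq ?_))
    rw [norm_neg]; ring
  have hm := measurable_gaussEnvelope (d := d)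
  refine (lintegral_mono hpt).trans ?_
  rw [lintegral_lintegral_swap]
  · have : ∀ θ : ℝ, ∫⁻ x, ENNReal.ofReal (6144 * (‖z‖ * u ^ (-(3 / 2) : ℝ))) *
        ENNReal.ofReal (gaussEnvelope d u (x - θ • z)) =
        ENNReal.ofReal (6144 * 2 ^ ((d : ℝ) / 2) * ‖z‖ * u ^ (-(3 / 2) : ℝ)) := by
      intro θ
      rw [lintegral_const_mul' _ _ ofReal_ne_top,
        lintegral_sub_right_eq_self (fun x => ENNReal.ofReal (gaussEnvelope d u x)) (θ • z),
        lintegral_gaussEnvelope hu, ← ofReal_mul (by positivity)]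
      congr 1; ring
    simp only [this, lintegral_const, Measure.restrict_apply_univ, Real.volume_Icc]
    simp
  · refine Measurable.aemeasurable ?_
    have h3 : Measurable fun p : EuclideanSpace ℝ (Fin d) × ℝ => (u, p.1 - p.2 • z) := by fun_prop
    exact ((hm.comp h3).ennreal_ofReal.const_mul _)

theorem contDiffOn_heatHessian_time (hε : 0 < ε) {a b : ℝ} (ha : 0 < a) (x : EuclideanSpace ℝ (Fin d)) :
    ContDiffOn ℝ 1 (fun u => timeCutoff ε u * heatHessian d v w u x) (Icc a b) := by
  refine fun u hu => ContDiffAt.contDiffWithinAt ?_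
  have hu : 0 < u := ha.trans_le hu.1
  unfold timeCutoff heatHessian heatKernel
  have h1 : (u + ε) * (1 + ε * u) ≠ 0 := by positivity
  have h2 : 4 * u ^ 2 ≠ 0 := by positivity
  have h3 : 2 * u ≠ 0 := by positivity
  have h4 : 4 * π * u ≠ 0 := by positivity
  have h5 : 4 * u ≠ 0 := by positivity
  have e : ContDiffAt ℝ 1 (fun u : ℝ => (4 * π * u) ^ (-(d : ℝ) / 2)) u :=
    ContDiffAt.rpow_const_of_ne (by fun_prop) h4
  fun_prop (disch := assumption)

theorem truncatedKernel_time (hε : 0 < ε) (hv : ‖v‖ ≤ 1) (hw : ‖w‖ ≤ 1) {a b : ℝ} (ha : 0 < a)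
    (hab : a ≤ b) :
    ∫⁻ x, ‖truncatedKernel d v w ε (b, x) - truncatedKernel d v w ε (a, x)‖ₑ ≤
      ENNReal.ofReal (6144 * (2 + d) * 2 ^ ((d : ℝ) / 2) * (b - a) * a ^ (-2 : ℝ)) := by
  have hb : 0 < b := ha.trans_le hab
  have hpt : ∀ x, ‖truncatedKernel d v w ε (b, x) - truncatedKernel d v w ε (a, x)‖ₑ ≤
      ∫⁻ u in Icc a b, ENNReal.ofReal (6144 * (2 + d) * a ^ (-2 : ℝ)) *
        ENNReal.ofReal (gaussEnvelope d u x) := by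
    intro x
    have hc := contDiffOn_heatHessian_time (v := v) (w := w) hε (b := b) ha x
    have h1 := enorm_sub_le_lintegral_deriv_of_contDiffOn_Icc hc hab
    simp only [truncatedKernel, ha, hb, if_true]
    refine h1.trans (setLIntegral_mono_ae' measurableSet_Icc (.of_forall fun u hu => ?_))
    have hu0 : 0 < u := ha.trans_le hu.1
    have hg := gaussEnvelope_nonneg hu0.le x
    have hH := (hasDerivAt_heatHessian_time (v := v) (w := w) hu0 x)
    have hprod : deriv (fun u => timeCutoff ε u * heatHessian d v w u x) u =
        deriv (timeCutoff ε) u * heatHessian d v w u x +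
          timeCutoff ε u * deriv (fun u => heatHessian d v w u x) u :=
      deriv_fun_mul (hasDerivAt_timeCutoff hε hu0).differentiableAt hH.differentiableAt
    rw [hprod, ← ofReal_mul (by positivity), Real.enorm_eq_ofReal_abs]
    refine ofReal_le_ofReal ((abs_add_le _ _).trans ?_)
    rw [abs_mul, abs_mul, abs_of_nonneg (timeCutoff_nonneg hε hu0.le)]
    calc _ ≤ u⁻¹ * (6144 * u⁻¹ * gaussEnvelope d u x) +
          1 * (6144 * (1 + d) * (u⁻¹ ^ 2 * gaussEnvelope d u x)) := by
          gcongr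
          · exact abs_deriv_timeCutoff_le hε hu0
          · exact abs_heatHessian_le hu0 hv hw
          · exact timeCutoff_le_one hε hu0.le
          · exact abs_deriv_heatHessian_time_le hu0 hv hw
      _ = 6144 * (2 + d) * u⁻¹ ^ 2 * gaussEnvelope d u x := by ring
      _ ≤ _ := by
          rw [Real.rpow_neg ha.le, Real.rpow_two, inv_pow]
          gcongr
          exact hu.1
  refine (lintegral_mono hpt).trans ?_
  have hm := measurable_gaussEnvelope (d := d)
  rw [lintegral_lintegral_swap]
  · have : ∀ u ∈ Icc a b, ∫⁻ x, ENNReal.ofReal (6144 * (2 + d) * a ^ (-2 : ℝ)) *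
        ENNReal.ofReal (gaussEnvelope d u x) =
        ENNReal.ofReal (6144 * (2 + d) * a ^ (-2 : ℝ) * 2 ^ ((d : ℝ) / 2)) := by
      intro u hu
      rw [lintegral_const_mul' _ _ ofReal_ne_top, lintegral_gaussEnvelope (ha.trans_le hu.1),
        ← ofReal_mul (by positivity)]
    rw [setLIntegral_congr_fun measurableSet_Icc this, lintegral_const, Measure.restrict_apply_univ,
      Real.volume_Icc, ← ofReal_mul (by positivity)]
    refine ofReal_le_ofReal (le_of_eq ?_)
    ring
  · exact ((hm.comp measurable_swap).ennreal_ofReal.const_mul _).aemeasurable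

/-- A bound for the parabolic kernel constants of the truncated heat Hessian. -/
def parabolicConstant (d : ℕ) : ℝ := 6144 * (2 + d) * 2 ^ ((d : ℝ) / 2)

theorem isParabolicKernel_truncatedKernel (hε : 0 < ε) (hv : ‖v‖ ≤ 1) (hw : ‖w‖ ≤ 1) :
    IsParabolicKernel d (truncatedKernel d v w ε) (parabolicConstant d) := by
  have hle : 6144 * 2 ^ ((d : ℝ) / 2) ≤ parabolicConstant d := by
    unfold parabolicConstant
    have : (0 : ℝ) ≤ d := Nat.cast_nonneg d
    gcongr
    linarith
  refine ⟨measurable_truncatedKernel, by unfold parabolicConstant; positivity, fun u hu x => ?_,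
    fun u => ?_, fun u hu z => ?_, fun a b ha hab => ?_⟩
  · simp [truncatedKernel, not_lt.2 hu]
  · exact (truncatedKernel_moment hε hv hw u).trans (ofReal_le_ofReal hle)
  · refine (truncatedKernel_space hε hv hw hu z).trans (ofReal_le_ofReal ?_)
    gcongr
  · exact truncatedKernel_time hε hv hw ha hab

end TruncatedKernel

section Grids

open Filter Topology

theorem floor_div_zpow_succ {b : ℕ} (hb : 0 < b) (n : ℤ) (x : ℝ) :
    ⌊x / (b : ℝ) ^ (n + 1)⌋ = ⌊x / (b : ℝ) ^ n⌋ / (b : ℤ) := by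
  have hb0 : (b : ℝ) ≠ 0 := by positivity
  rw [zpow_add_one₀ hb0, ← div_div, Int.floor_div_natCast]

theorem mem_Ico_iff_floor_div_eq {ℓ : ℝ} (hℓ : 0 < ℓ) {x : ℝ} {i : ℤ} :
    ⌊x / ℓ⌋ = i ↔ x ∈ Ico (i * ℓ) (i * ℓ + ℓ) := by
  rw [Int.floor_eq_iff, le_div_iff₀ hℓ, div_lt_iff₀ hℓ, mem_Ico, add_mul, one_mul]

theorem abs_sub_lt_of_floor_div_eq {ℓ : ℝ} (hℓ : 0 < ℓ) {x y : ℝ} (h : ⌊x / ℓ⌋ = ⌊y / ℓ⌋) :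
    |x - y| < ℓ := by
  have := Int.abs_sub_lt_one_of_floor_eq_floor h
  rwa [← sub_div, abs_div, abs_of_pos hℓ, div_lt_one hℓ] at this

theorem exists_zpow_lt {b : ℕ} (hb : 1 < b) {ε : ℝ} (hε : 0 < ε) : ∃ n : ℤ, n ≤ 0 ∧ (b : ℝ) ^ n < ε := by
  obtain ⟨k, hk⟩ := exists_pow_lt_of_lt_one hε (y := ((b : ℝ))⁻¹)
    (inv_lt_one_of_one_lt₀ (by exact_mod_cast hb))
  exact ⟨-k, by simp, by rwa [zpow_neg, zpow_natCast, ← inv_pow]⟩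

theorem tendsto_ofReal_zpow {b : ℕ} (hb : 1 < b) :
    Tendsto (fun n : ℤ => ENNReal.ofReal ((b : ℝ) ^ n)) atTop (𝓝 ∞) := by
  have hb1 : (1 : ℝ) < b := by exact_mod_cast hb
  refine ENNReal.tendsto_ofReal_atTop.comp ?_
  refine tendsto_atTop.2 fun M => ?_
  obtain ⟨k, hk⟩ := pow_unbounded_of_one_lt M hb1
  filter_upwards [eventually_ge_atTop (k : ℤ)] with n hn
  refine hk.le.trans ?_
  rw [← zpow_natCast]
  exact zpow_le_zpow_right₀ hb1.le hn

/-- The grid of intervals `[i 4ⁿ, (i + 1) 4ⁿ)`. -/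
def timeGrid : DyadicGrid (volume : Measure ℝ) ℤ 4 where
  idx n t := ⌊t / (4 : ℕ) ^ n⌋
  size n := ENNReal.ofReal (((4 : ℕ) : ℝ) ^ n)
  measurableSet_cell n i := by
    have : Measurable fun t : ℝ => ⌊t / ((4 : ℕ) : ℝ) ^ n⌋ := by fun_prop
    exact this (measurableSet_singleton i)
  idx_succ n s s' h := by
    rw [floor_div_zpow_succ (by norm_num), floor_div_zpow_succ (by norm_num), h]
  measure_cell n s := by
    have hℓ : (0 : ℝ) < ((4 : ℕ) : ℝ) ^ n := by positivity
    have : (fun t : ℝ => ⌊t / ((4 : ℕ) : ℝ) ^ n⌋) ⁻¹' {⌊s / ((4 : ℕ) : ℝ) ^ n⌋} =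
        Ico (⌊s / ((4 : ℕ) : ℝ) ^ n⌋ * ((4 : ℕ) : ℝ) ^ n)
          (⌊s / ((4 : ℕ) : ℝ) ^ n⌋ * ((4 : ℕ) : ℝ) ^ n + ((4 : ℕ) : ℝ) ^ n) := by
      ext t; exact mem_Ico_iff_floor_div_eq hℓ
    rw [this, Real.volume_Ico, add_sub_cancel_left]
  size_ne_zero n := by simp; positivity
  size_ne_top n := ofReal_ne_top
  size_succ_le n := by
    rw [zpow_add_one₀ (by norm_num), mul_comm, ofReal_mul (by norm_num)]
    simp
  tendsto_size := tendsto_ofReal_zpow (by norm_num)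
  exists_cell_subset s U hU hs := by
    obtain ⟨ε, hε, hball⟩ := Metric.isOpen_iff.1 hU s hs
    obtain ⟨n, hn, hlt⟩ := exists_zpow_lt (b := 4) (by norm_num) hε
    refine ⟨n, hn, fun t ht => hball ?_⟩
    have hℓ : (0 : ℝ) < ((4 : ℕ) : ℝ) ^ n := by positivity
    exact (abs_sub_lt_of_floor_div_eq hℓ (mem_singleton_iff.1 ht)).trans hlt

theorem norm_sub_le_card_mul {d : ℕ} {x y : EuclideanSpace ℝ (Fin d)} {ℓ : ℝ}
    (h : ∀ i, |x i - y i| ≤ ℓ) : ‖x - y‖ ≤ d * ℓ := by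
  have h1 : ‖x - y‖ ≤ ∑ i, ‖(x - y) i‖ := by
    have : x - y = ∑ i, (x - y) i • EuclideanSpace.basisFun (Fin d) ℝ i := by
      simpa using ((EuclideanSpace.basisFun (Fin d) ℝ).sum_repr (x - y)).symm
    calc ‖x - y‖ = ‖∑ i, (x - y) i • EuclideanSpace.basisFun (Fin d) ℝ i‖ := by rw [← this]
      _ ≤ ∑ i, ‖(x - y) i • EuclideanSpace.basisFun (Fin d) ℝ i‖ := norm_sum_le _ _
      _ = _ := by simp [norm_smul]
  refine h1.trans ((Finset.sum_le_card_nsmul _ _ ℓ fun i _ => ?_).trans (by simp))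
  simpa using h i

/-- The grid of half open dyadic cubes. -/
def spaceGrid (d : ℕ) [NeZero d] :
    DyadicGrid (volume : Measure (EuclideanSpace ℝ (Fin d))) (Fin d → ℤ) (2 ^ d) where
  idx n x := fun i => ⌊x i / (2 : ℕ) ^ n⌋
  size n := ENNReal.ofReal (((2 : ℕ) : ℝ) ^ n) ^ d
  measurableSet_cell n i := by
    have : Measurable fun x : EuclideanSpace ℝ (Fin d) => fun i => ⌊x i / ((2 : ℕ) : ℝ) ^ n⌋ := by
      fun_prop
    exact this (measurableSet_singleton i)
  idx_succ n s s' h := by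
    funext i
    have := congrFun h i
    simp only at this ⊢
    rw [floor_div_zpow_succ (by norm_num), floor_div_zpow_succ (by norm_num), this]
  measure_cell n s := by
    have hℓ : (0 : ℝ) < ((2 : ℕ) : ℝ) ^ n := by positivity
    have : (fun x : EuclideanSpace ℝ (Fin d) => fun i => ⌊x i / ((2 : ℕ) : ℝ) ^ n⌋) ⁻¹'
        {fun i => ⌊s i / ((2 : ℕ) : ℝ) ^ n⌋} = WithLp.ofLp ⁻¹' (univ.pi fun i =>
        Ico (⌊s i / ((2 : ℕ) : ℝ) ^ n⌋ * ((2 : ℕ) : ℝ) ^ n)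
          (⌊s i / ((2 : ℕ) : ℝ) ^ n⌋ * ((2 : ℕ) : ℝ) ^ n + ((2 : ℕ) : ℝ) ^ n)) := by
      ext t
      simp only [mem_preimage, mem_singleton_iff, mem_univ_pi, funext_iff]
      exact forall_congr' fun i => mem_Ico_iff_floor_div_eq hℓ
    rw [this, (PiLp.volume_preserving_ofLp (Fin d)).measure_preimage
      (MeasurableSet.univ_pi fun i => measurableSet_Ico).nullMeasurableSet, volume_pi_pi]
    simp [Real.volume_Ico]
  size_ne_zero n := pow_ne_zero _ (by simp; positivity)
  size_ne_top n := by simp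
  size_succ_le n := by
    rw [zpow_add_one₀ (by norm_num), mul_comm, ofReal_mul (by norm_num), mul_pow]
    simp
  tendsto_size := by
    have h := (ENNReal.continuous_pow d).tendsto ∞ |>.comp (tendsto_ofReal_zpow (b := 2) (by norm_num))
    rwa [ENNReal.top_pow (NeZero.ne d)] at h
  exists_cell_subset s U hU hs := by
    obtain ⟨ε, hε, hball⟩ := Metric.isOpen_iff.1 hU s hs
    obtain ⟨n, hn, hlt⟩ := exists_zpow_lt (b := 2) (by norm_num) (div_pos hε (show (0:ℝ) < d + 1 by positivity))
    refine ⟨n, hn, fun t ht => hball ?_⟩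
    have hℓ : (0 : ℝ) < ((2 : ℕ) : ℝ) ^ n := by positivity
    have hts : ∀ i, |t i - s i| ≤ ((2 : ℕ) : ℝ) ^ n := by
      intro i
      exact (abs_sub_lt_of_floor_div_eq hℓ (congrFun (mem_singleton_iff.1 ht) i)).le
    rw [Metric.mem_ball, dist_eq_norm]
    refine (norm_sub_le_card_mul hts).trans_lt ?_
    rw [lt_div_iff₀ (by positivity)] at hlt
    linarith

/-- Products of grids. -/
def DyadicGrid.prod {S S' ι ι' : Type*} [MeasurableSpace S] [TopologicalSpace S]
    [MeasurableSpace S'] [TopologicalSpace S'] {μ : Measure S} {μ' : Measure S'} [SFinite μ']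
    {D D' : ℝ≥0∞} (𝒢 : DyadicGrid μ ι D) (𝒢' : DyadicGrid μ' ι' D') :
    DyadicGrid (μ.prod μ') (ι × ι') (D * D') where
  idx n s := (𝒢.idx n s.1, 𝒢'.idx n s.2)
  size n := 𝒢.size n * 𝒢'.size n
  measurableSet_cell n i := by
    have : (fun s : S × S' => (𝒢.idx n s.1, 𝒢'.idx n s.2)) ⁻¹' {i} =
      (𝒢.idx n ⁻¹' {i.1}) ×ˢ (𝒢'.idx n ⁻¹' {i.2}) := by
      ext s; simp [Prod.ext_iff]
    rw [this]
    exact (𝒢.measurableSet_cell n _).prod (𝒢'.measurableSet_cell n _)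
  idx_succ n s s' h := by
    simp only [Prod.mk.injEq] at h ⊢
    exact ⟨𝒢.idx_succ n _ _ h.1, 𝒢'.idx_succ n _ _ h.2⟩
  measure_cell n i := by
    have : (fun s : S × S' => (𝒢.idx n s.1, 𝒢'.idx n s.2)) ⁻¹' {(𝒢.idx n i.1, 𝒢'.idx n i.2)} =
      (𝒢.idx n ⁻¹' {𝒢.idx n i.1}) ×ˢ (𝒢'.idx n ⁻¹' {𝒢'.idx n i.2}) := by
      ext s; simp [Prod.ext_iff]
    rw [this, Measure.prod_prod, 𝒢.measure_cell, 𝒢'.measure_cell]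
  size_ne_zero n := mul_ne_zero (𝒢.size_ne_zero n) (𝒢'.size_ne_zero n)
  size_ne_top n := ENNReal.mul_ne_top (𝒢.size_ne_top n) (𝒢'.size_ne_top n)
  size_succ_le n := by
    calc _ ≤ (D * 𝒢.size n) * (D' * 𝒢'.size n) :=
          mul_le_mul' (𝒢.size_succ_le n) (𝒢'.size_succ_le n)
      _ = _ := by ring
  tendsto_size := by
    have := ENNReal.Tendsto.mul 𝒢.tendsto_size (Or.inl ENNReal.top_ne_zero) 𝒢'.tendsto_size
      (Or.inl ENNReal.top_ne_zero)
    simpa using this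
  exists_cell_subset s U hU hs := by
    obtain ⟨V, V', hV, hV', hsV, hsV', hsub⟩ := isOpen_prod_iff.1 hU s.1 s.2 hs
    obtain ⟨n, hn, h⟩ := 𝒢.exists_cell_subset s.1 V hV hsV
    obtain ⟨n', hn', h'⟩ := 𝒢'.exists_cell_subset s.2 V' hV' hsV'
    refine ⟨min n n', (min_le_left _ _).trans hn, fun t ht => hsub ⟨?_, ?_⟩⟩
    · exact h (𝒢.idx_eq_of_le (min_le_left n n') (Prod.ext_iff.1 ht).1)
    · exact h' (𝒢'.idx_eq_of_le (min_le_right n n') (Prod.ext_iff.1 ht).2)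

end Grids

section ParabolicHormander

variable {d : ℕ} {k : ℝ × EuclideanSpace ℝ (Fin d) → ℝ} {A : ℝ}

theorem lintegral_Ici_indicator_rpow_le {c a e M : ℝ} (ha : 0 < a) (he : e < -1) (hM : 0 ≤ M) :
    ∫⁻ t, (Ici (c + a)).indicator (fun t => ENNReal.ofReal (M * (t - c) ^ e)) t ≤
      ENNReal.ofReal (M * (-a ^ (e + 1) / (e + 1))) := by
  have h1 : ∀ t, (Ici (c + a)).indicator (fun t => ENNReal.ofReal (M * (t - c) ^ e)) t =
      (Ici a).indicator (fun t => ENNReal.ofReal (M * t ^ e)) (t - c) := by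
    intro t
    by_cases h : c + a ≤ t
    · rw [indicator_of_mem (by exact h), indicator_of_mem (by simp only [mem_Ici]; linarith)]
    · rw [indicator_of_notMem (by exact h), indicator_of_notMem (by simp only [mem_Ici]; linarith)]
  simp_rw [h1]
  rw [lintegral_sub_right_eq_self (fun t => (Ici a).indicator
    (fun t => ENNReal.ofReal (M * t ^ e)) t) c, lintegral_indicator measurableSet_Ici,
    setLIntegral_congr Ioi_ae_eq_Ici.symm, ← integral_Ioi_rpow_of_lt he ha, ← integral_const_mul,
    ofReal_integral_eq_lintegral_ofReal ((integrableOn_Ioi_rpow_of_lt he ha).const_mul M)]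
  filter_upwards [ae_restrict_mem measurableSet_Ioi] with t ht
  have : 0 < t := ha.trans ht
  positivity

theorem volume_univ_fin_zero : (volume : Measure (Fin 0 → ℝ)) univ = 1 := by
  rw [Measure.volume_pi_eq_dirac 0]; simp

namespace IsParabolicKernel

theorem time_sub_le (hk : IsParabolicKernel d k A) {ℓ c s t : ℝ} (hs : s ∈ Ico c (c + ℓ))
    (ht : 2 * ℓ ≤ |t - c|) :
    ∫⁻ y, ‖k (t - s, y) - k (t - c, y)‖ₑ ≤
      (Ici (c + 2 * ℓ)).indicator (fun t => ENNReal.ofReal (4 * A * ℓ * (t - c) ^ (-2 : ℝ))) t := by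
  have hA := hk.nonneg
  have hℓ : 0 < ℓ := by linarith [hs.1, hs.2]
  rcases le_abs.1 ht with h | h
  · rw [indicator_of_mem (by simp only [mem_Ici]; linarith)]
    have h0 : 0 < t - c := by linarith
    have h1 : 0 < t - s := by linarith [hs.2]
    have h2 := hk.time (t - s) (t - c) h1 (by linarith [hs.1])
    simp_rw [enorm_sub_rev (k (t - s, _))]
    refine h2.trans (ofReal_le_ofReal ?_)
    have e : ((t - c) / 2) ^ (-2 : ℝ) = 4 * (t - c) ^ (-2 : ℝ) := by
      rw [Real.div_rpow h0.le zero_le_two, Real.rpow_neg zero_le_two]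
      norm_num
      ring
    have h3 : (t - s) ^ (-2 : ℝ) ≤ ((t - c) / 2) ^ (-2 : ℝ) :=
      Real.rpow_le_rpow_of_nonpos (by positivity) (by linarith [hs.2]) (by norm_num)
    calc _ ≤ A * ℓ * ((t - c) / 2) ^ (-2 : ℝ) := by
          gcongr
          linarith [hs.2]
      _ = _ := by rw [e]; ring
  · have h1 : t - s ≤ 0 := by linarith [hs.1]
    have h2 : t - c ≤ 0 := by linarith
    simp [hk.eq_zero _ h1, hk.eq_zero _ h2]

theorem lintegral_time_bound (hk : IsParabolicKernel d k A) {ℓ c : ℝ} (hℓ : 0 < ℓ) :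
    ∫⁻ t, (Ici (c + 2 * ℓ)).indicator
      (fun t => ENNReal.ofReal (4 * A * ℓ * (t - c) ^ (-2 : ℝ))) t ≤ ENNReal.ofReal (2 * A) := by
  have hA := hk.nonneg
  refine (lintegral_Ici_indicator_rpow_le (by positivity) (by norm_num) (by positivity)).trans
    (ofReal_le_ofReal (le_of_eq ?_))
  norm_num
  rw [show (-1 : ℝ) = ((-1 : ℤ) : ℝ) by norm_num, Real.rpow_intCast, zpow_neg_one]
  field_simp
  ring

theorem hormander_time (hk : IsParabolicKernel d k A) :
    HormanderCondition timeGrid (volume : Measure (EuclideanSpace ℝ (Fin d))) k 4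
      (ENNReal.ofReal (2 * A)) := by
  intro n i
  have hℓ : (0 : ℝ) < ((4 : ℕ) : ℝ) ^ n := by positivity
  have hsize : timeGrid.size n = ENNReal.ofReal (((4 : ℕ) : ℝ) ^ n) := rfl
  have hcell : ∀ s ∈ timeGrid.cell n i, s ∈ Ico (i * ((4 : ℕ) : ℝ) ^ n)
      (i * ((4 : ℕ) : ℝ) ^ n + ((4 : ℕ) : ℝ) ^ n) :=
    fun s hs => (mem_Ico_iff_floor_div_eq hℓ).1 hs
  rw [hsize]
  generalize ((4 : ℕ) : ℝ) ^ n = ℓ at hℓ hcell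
  generalize (i : ℝ) * ℓ = c at hcell
  refine ⟨c, Ioo (c - 2 * ℓ) (c + 2 * ℓ), measurableSet_Ioo, le_of_eq ?_, fun s hs => ?_⟩
  · rw [Real.volume_Ioo, show c + 2 * ℓ - (c - 2 * ℓ) = 4 * ℓ by ring, ofReal_mul (by norm_num)]
    simp
  · refine le_trans ?_ (hk.lintegral_time_bound hℓ (c := c))
    refine le_trans (setLIntegral_mono_ae' measurableSet_Ioo.compl (.of_forall fun t ht => ?_))
      (setLIntegral_le_lintegral _ _)
    refine hk.time_sub_le (hcell s hs) ?_
    by_contra h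
    rw [not_le, abs_lt] at h
    exact ht ⟨by linarith [h.1], by linarith [h.2]⟩

theorem lintegral_compl_ball_le (hk : IsParabolicKernel d k A) {lam : ℝ} (hlam : 0 < lam) (u : ℝ)
    {x z : EuclideanSpace ℝ (Fin d)} (hxz : ‖x - z‖ ≤ d * lam) :
    ∫⁻ y in (Metric.ball z ((d + 1) * lam))ᶜ, ‖k (u, y - x)‖ₑ ≤
      ENNReal.ofReal (A / lam ^ 2) := by
  have h1 : ∀ y ∈ (Metric.ball z ((d + 1) * lam))ᶜ, ‖k (u, y - x)‖ₑ ≤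
      ENNReal.ofReal (lam ^ 2)⁻¹ * (ENNReal.ofReal (‖y - x‖ ^ 2) * ‖k (u, y - x)‖ₑ) := by
    intro y hy
    have hy' : (d + 1) * lam ≤ ‖y - z‖ := by
      simpa [Metric.mem_ball, dist_eq_norm] using hy
    have h2 : lam ≤ ‖y - x‖ := by
      have := norm_add_le (y - x) (x - z)
      rw [sub_add_sub_cancel] at this
      linarith
    rw [← mul_assoc, ← ofReal_mul (by positivity)]
    refine le_mul_of_one_le_left' ?_
    rw [one_le_ofReal]
    have : lam ^ 2 ≤ ‖y - x‖ ^ 2 := by gcongr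
    rwa [inv_mul_eq_div, one_le_div (by positivity)]
  calc _ ≤ ∫⁻ y, ENNReal.ofReal (lam ^ 2)⁻¹ *
        (ENNReal.ofReal (‖y - x‖ ^ 2) * ‖k (u, y - x)‖ₑ) :=
        (setLIntegral_mono_ae' measurableSet_ball.compl (.of_forall h1)).trans
          (setLIntegral_le_lintegral _ _)
    _ = ENNReal.ofReal (lam ^ 2)⁻¹ * ∫⁻ y, ENNReal.ofReal (‖y‖ ^ 2) * ‖k (u, y)‖ₑ := by
        rw [lintegral_const_mul' _ _ ofReal_ne_top,
          lintegral_sub_right_eq_self (fun y => ENNReal.ofReal (‖y‖ ^ 2) * ‖k (u, y)‖ₑ) x]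
    _ ≤ ENNReal.ofReal (lam ^ 2)⁻¹ * ENNReal.ofReal A := by gcongr; exact hk.moment u
    _ = _ := by rw [← ofReal_mul (by positivity)]; congr 1; ring

theorem space_sub_le (hk : IsParabolicKernel d k A) {ℓ c s t lam : ℝ} (hs : s ∈ Ico c (c + ℓ))
    {x z : EuclideanSpace ℝ (Fin d)} (hxz : ‖x - z‖ ≤ d * lam) (ht : 2 * ℓ ≤ |t - c|) :
    ∫⁻ y, ‖k (t - s, y - x) - k (t - c, y - z)‖ₑ ≤
      (Ici (c + 2 * ℓ)).indicator (fun t => ENNReal.ofReal (4 * A * ℓ * (t - c) ^ (-2 : ℝ))) t +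
      (Ici (c + 2 * ℓ)).indicator
        (fun t => ENNReal.ofReal (A * (d * lam) * (t - c) ^ (-(3 / 2) : ℝ))) t := by
  have hA := hk.nonneg
  have hm := hk.measurable
  have hℓ : 0 < ℓ := by linarith [hs.1, hs.2]
  calc _ ≤ ∫⁻ y, (‖k (t - s, y - x) - k (t - c, y - x)‖ₑ +
        ‖k (t - c, y - x) - k (t - c, y - z)‖ₑ) := lintegral_mono fun y => by
        have := enorm_add_le (k (t - s, y - x) - k (t - c, y - x)) (k (t - c, y - x) - k (t - c, y - z))
        rwa [sub_add_sub_cancel] at this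
    _ = (∫⁻ y, ‖k (t - s, y) - k (t - c, y)‖ₑ) +
        ∫⁻ y, ‖k (t - c, y - (x - z)) - k (t - c, y)‖ₑ := by
        rw [lintegral_add_left (by fun_prop),
          lintegral_sub_right_eq_self (fun y => ‖k (t - s, y) - k (t - c, y)‖ₑ) x,
          ← lintegral_sub_right_eq_self (fun y => ‖k (t - c, y - (x - z)) - k (t - c, y)‖ₑ) z]
        congr 2
        funext y
        rw [sub_sub, add_sub_cancel]
    _ ≤ _ := by
        refine add_le_add (hk.time_sub_le hs ht) ?_
        rcases le_abs.1 ht with h | h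
        · rw [indicator_of_mem (by simp only [mem_Ici]; linarith)]
          have h0 : 0 < t - c := by linarith
          refine (hk.space _ h0 _).trans (ofReal_le_ofReal ?_)
          gcongr
        · have h2 : t - c ≤ 0 := by linarith
          simp [hk.eq_zero _ h2]

theorem lintegral_space_bound (hk : IsParabolicKernel d k A) {lam c : ℝ} (hlam : 0 < lam) :
    ∫⁻ t, (Ici (c + 2 * lam ^ 2)).indicator
      (fun t => ENNReal.ofReal (A * (d * lam) * (t - c) ^ (-(3 / 2) : ℝ))) t ≤
      ENNReal.ofReal (2 * d * A) := by
  have hA := hk.nonneg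
  refine (lintegral_Ici_indicator_rpow_le (by positivity) (by norm_num) (by positivity)).trans
    (ofReal_le_ofReal ?_)
  have h1 : (2 * lam ^ 2) ^ (-(3 / 2) + 1 : ℝ) ≤ lam⁻¹ := by
    calc (2 * lam ^ 2) ^ (-(3 / 2) + 1 : ℝ) ≤ (lam ^ 2) ^ (-(3 / 2) + 1 : ℝ) :=
          Real.rpow_le_rpow_of_nonpos (by positivity) (by nlinarith [sq_nonneg lam]) (by norm_num)
      _ = lam⁻¹ := by
          rw [← Real.rpow_natCast, ← Real.rpow_mul hlam.le]
          norm_num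
          rw [show (-1 : ℝ) = ((-1 : ℤ) : ℝ) by norm_num, Real.rpow_intCast, zpow_neg_one]
  calc _ = A * (d * lam) * (2 * (2 * lam ^ 2) ^ (-(3 / 2) + 1 : ℝ)) := by ring
    _ ≤ A * (d * lam) * (2 * lam⁻¹) := by gcongr
    _ = _ := by field_simp

theorem hormander_parabolic [NeZero d] (hk : IsParabolicKernel d k A) :
    HormanderCondition (timeGrid.prod (spaceGrid d)) (volume : Measure (Fin 0 → ℝ))
      (fun p => k p.1)
      (4 * (ENNReal.ofReal ((d + 1) ^ d) * volume (Metric.ball (0 : EuclideanSpace ℝ (Fin d)) 1)))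
      (ENNReal.ofReal (2 * A) + ENNReal.ofReal (2 * d * A) + ENNReal.ofReal (8 * A)) := by
  rintro n ⟨i, j⟩
  have hA := hk.nonneg
  have hm := hk.measurable
  have hlam : (0 : ℝ) < ((2 : ℕ) : ℝ) ^ n := by positivity
  have h42 : ((4 : ℕ) : ℝ) ^ n = (((2 : ℕ) : ℝ) ^ n) ^ 2 := by
    rw [← zpow_natCast, ← zpow_mul, mul_comm, zpow_mul]; norm_num
  have hsize : (timeGrid.prod (spaceGrid d)).size n =
      ENNReal.ofReal ((((2 : ℕ) : ℝ) ^ n) ^ 2) * ENNReal.ofReal (((2 : ℕ) : ℝ) ^ n) ^ d := by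
    rw [← h42]; rfl
  set z : EuclideanSpace ℝ (Fin d) := WithLp.toLp 2 fun m => j m * ((2 : ℕ) : ℝ) ^ n with hz
  have hcell : ∀ s ∈ (timeGrid.prod (spaceGrid d)).cell n (i, j),
      s.1 ∈ Ico (i * (((2 : ℕ) : ℝ) ^ n) ^ 2)
        (i * (((2 : ℕ) : ℝ) ^ n) ^ 2 + (((2 : ℕ) : ℝ) ^ n) ^ 2) ∧
      ‖s.2 - z‖ ≤ d * ((2 : ℕ) : ℝ) ^ n := by
    intro s hs
    have hs' : ⌊s.1 / ((4 : ℕ) : ℝ) ^ n⌋ = i ∧ (fun m => ⌊s.2 m / ((2 : ℕ) : ℝ) ^ n⌋) = j :=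
      Prod.ext_iff.1 hs
    rw [h42] at hs'
    refine ⟨(mem_Ico_iff_floor_div_eq (by positivity)).1 hs'.1, norm_sub_le_card_mul fun m => ?_⟩
    have h1 := (mem_Ico_iff_floor_div_eq hlam).1 (congrFun hs'.2 m)
    have hzm : z m = j m * ((2 : ℕ) : ℝ) ^ n := rfl
    rw [hzm, abs_of_nonneg (sub_nonneg.2 h1.1), sub_le_iff_le_add']
    exact h1.2.le
  rw [hsize]
  clear_value z
  generalize ((2 : ℕ) : ℝ) ^ n = lam at hlam hcell
  generalize (i : ℝ) * lam ^ 2 = c at hcell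
  have hℓ : 0 < lam ^ 2 := by positivity
  set I := Ioo (c - 2 * lam ^ 2) (c + 2 * lam ^ 2)
  set B := Metric.ball z ((d + 1) * lam)
  have hI : volume I = ENNReal.ofReal (4 * lam ^ 2) := by
    rw [Real.volume_Ioo]; congr 1; ring
  refine ⟨(c, z), I ×ˢ B, measurableSet_Ioo.prod measurableSet_ball, le_of_eq ?_,
    fun s hs => ?_⟩
  · rw [Measure.prod_prod, hI, Measure.addHaar_ball _ _ (by positivity), finrank_euclideanSpace,
      Fintype.card_fin, mul_pow, ofReal_mul (by norm_num), ofReal_mul (by positivity),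
      ← ENNReal.ofReal_pow hlam.le, ofReal_ofNat]
    ring
  · obtain ⟨hs1, hs2⟩ := hcell s hs
    simp only [lintegral_const, volume_univ_fin_zero, mul_one]
    have hsub : (I ×ˢ B)ᶜ ⊆ Iᶜ ×ˢ univ ∪ I ×ˢ Bᶜ := by
      rintro ⟨t, y⟩ h
      by_cases ht : t ∈ I
      · exact Or.inr ⟨ht, fun hy => h ⟨ht, hy⟩⟩
      · exact Or.inl ⟨ht, mem_univ _⟩
    have hmeas : Measurable fun p : ℝ × EuclideanSpace ℝ (Fin d) => ‖k (p - s) - k (p - (c, z))‖ₑ := by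
      fun_prop
    refine (lintegral_mono_set hsub).trans ((lintegral_union_le _ _ _).trans (add_le_add ?_ ?_))
    · rw [← Measure.prod_restrict, Measure.restrict_univ, lintegral_prod _ hmeas.aemeasurable]
      refine le_trans (setLIntegral_mono_ae' measurableSet_Ioo.compl (.of_forall fun t ht =>
        hk.space_sub_le (ℓ := lam ^ 2) (c := c) (t := t) hs1 hs2 ?_)) ?_
      · by_contra h
        rw [not_le, abs_lt] at h
        exact ht ⟨by linarith [h.1], by linarith [h.2]⟩
      · refine (setLIntegral_le_lintegral _ _).trans ?_
        rw [lintegral_add_left]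
        · exact add_le_add (hk.lintegral_time_bound hℓ) (hk.lintegral_space_bound hlam)
        · exact Measurable.indicator (by fun_prop) measurableSet_Ici
    · rw [← Measure.prod_restrict, lintegral_prod _ hmeas.aemeasurable]
      have hb : ∀ t, ∫⁻ y in Bᶜ, ‖k ((t, y) - s) - k ((t, y) - (c, z))‖ₑ ≤
          ENNReal.ofReal (2 * (A / lam ^ 2)) := by
        intro t
        calc _ ≤ ∫⁻ y in Bᶜ, (‖k (t - s.1, y - s.2)‖ₑ + ‖k (t - c, y - z)‖ₑ) :=
              lintegral_mono fun y => enorm_sub_le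
          _ = (∫⁻ y in Bᶜ, ‖k (t - s.1, y - s.2)‖ₑ) + ∫⁻ y in Bᶜ, ‖k (t - c, y - z)‖ₑ :=
              lintegral_add_left (by fun_prop) _
          _ ≤ ENNReal.ofReal (A / lam ^ 2) + ENNReal.ofReal (A / lam ^ 2) :=
              add_le_add (hk.lintegral_compl_ball_le hlam _ hs2)
                (hk.lintegral_compl_ball_le hlam _ (by simp; positivity))
          _ = _ := by rw [← ofReal_add (by positivity) (by positivity)]; congr 1; ring
      refine (lintegral_mono hb).trans (le_of_eq ?_)
      rw [lintegral_const, Measure.restrict_apply_univ, hI, ← ofReal_mul (by positivity)]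
      congr 1
      field_simp
      ring

end IsParabolicKernel

end ParabolicHormander

section Plancherel

open FourierTransform SchwartzMap TemperedDistribution
open scoped ContDiff

variable {V : Type*} [NormedAddCommGroup V] [InnerProductSpace ℝ V] [FiniteDimensional ℝ V]
  [MeasurableSpace V] [BorelSpace V]

theorem continuous_fourier_of_integrable {g : V → ℂ} (hg : Integrable g) : Continuous (𝓕 g) :=
  VectorFourier.fourierIntegral_continuous continuous_fourierChar continuous_inner hg

/-- The Fourier transform on `L²` is given by the Fourier integral on `L¹ ∩ L²`. -/
theorem fourier_toLp_ae_eq {g : V → ℂ} (hg : Integrable g) (hg₂ : MemLp g 2) :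
    (𝓕 (hg₂.toLp g) : Lp (α := V) ℂ 2) =ᵐ[volume] 𝓕 g := by
  refine ae_eq_of_integral_contDiff_smul_eq ?_ ?_ ?_
  · exact (Lp.memLp _).locallyIntegrable (by norm_num)
  · exact (continuous_fourier_of_integrable hg).locallyIntegrable
  · intro φ hφ hφc
    have hc : HasCompactSupport (fun x => (φ x : ℂ)) := hφc.comp_left Complex.ofReal_zero
    have hd : ContDiff ℝ ∞ (fun x => (φ x : ℂ)) := Complex.ofRealCLM.contDiff.comp hφ
    have hψ : ∀ x, hc.toSchwartzMap hd x = (φ x : ℂ) := fun x => by simp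
    set ψ : 𝓢(V, ℂ) := hc.toSchwartzMap hd
    have h := DFunLike.congr_fun (Lp.fourier_toTemperedDistribution_eq (hg₂.toLp g)) ψ
    rw [TemperedDistribution.fourier_apply] at h
    rw [Lp.toTemperedDistribution_apply, Lp.toTemperedDistribution_apply] at h
    have e : ∫ x, (𝓕 ψ) x • (hg₂.toLp g) x = ∫ x, ψ x • (𝓕 g) x := by
      have h1 := VectorFourier.integral_bilin_fourierIntegral_eq_flip
        (ContinuousLinearMap.mul ℂ ℂ) (L := innerₗ V) (μ := volume) (ν := volume)
        continuous_fourierChar continuous_inner ψ.integrable hg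
      rw [show ((innerₗ V).flip) = innerₗ V from flip_innerₗ V] at h1
      refine Eq.trans ?_ h1
      refine integral_congr_ae ?_
      filter_upwards [hg₂.coeFn_toLp] with x hx
      rw [hx, SchwartzMap.fourier_coe]
      rfl
    rw [e] at h
    simp only [hψ] at h
    simpa using! h.symm

/-- **Plancherel's theorem** for the Fourier integral on `L¹ ∩ L²`. -/
theorem lintegral_enorm_fourier_sq {g : V → ℂ} (hg : Integrable g) (hg₂ : MemLp g 2) :
    ∫⁻ ξ, ‖𝓕 g ξ‖ₑ ^ (2:ℝ) = ∫⁻ x, ‖g x‖ₑ ^ (2:ℝ) := by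
  have h := Lp.norm_fourier_eq (hg₂.toLp g)
  rw [Lp.norm_def, Lp.norm_def, ENNReal.toReal_eq_toReal_iff' (Lp.eLpNorm_ne_top _)
    (Lp.eLpNorm_ne_top _), eLpNorm_congr_ae (fourier_toLp_ae_eq hg hg₂),
    eLpNorm_congr_ae hg₂.coeFn_toLp, eLpNorm_eq_lintegral_rpow_enorm_toReal (by norm_num) (by norm_num),
    eLpNorm_eq_lintegral_rpow_enorm_toReal (by norm_num) (by norm_num)] at h
  simpa using ENNReal.rpow_left_injective (by norm_num) h

end Plancherel

section HeatGradient

variable {d : ℕ}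

local notation "E" => EuclideanSpace ℝ (Fin d)

/-- The derivative of the heat kernel in the direction `w`. -/
def heatGradient (d : ℕ) (w : EuclideanSpace ℝ (Fin d)) (u : ℝ) (x : EuclideanSpace ℝ (Fin d)) :
    ℝ :=
  -(heatKernel d u x / (2 * u)) * inner ℝ x w

/-- The derivative of `heatGradient d w u` at `x`. -/
def heatHessianCLM (d : ℕ) (w : EuclideanSpace ℝ (Fin d)) (u : ℝ) (x : EuclideanSpace ℝ (Fin d)) :
    EuclideanSpace ℝ (Fin d) →L[ℝ] ℝ :=
  -(heatKernel d u x / (2 * u)) • innerSL ℝ w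
    + (inner ℝ x w * heatKernel d u x / (4 * u ^ 2)) • innerSL ℝ x

theorem heatHessianCLM_apply (v w : E) (u : ℝ) (x : E) :
    heatHessianCLM d w u x v = heatHessian d v w u x := by
  simp only [heatHessianCLM, heatHessian, add_apply, neg_smul,
    neg_apply, smul_apply, innerSL_apply_apply, smul_eq_mul,
    real_inner_comm v w]
  ring

theorem hasFDerivAt_heatGradient (w : E) {u : ℝ} (hu : 0 < u) (x : E) :
    HasFDerivAt (heatGradient d w u) (heatHessianCLM d w u x) x := by
  have h1 := ((hasFDerivAt_heatKernel (d := d) hu x).mul_const (-(1 / (2 * u))))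
  have h2 : HasFDerivAt (fun y : E => inner ℝ y w) (innerSL ℝ w) x := by
    have := (innerSL ℝ w).hasFDerivAt (x := x)
    refine this.congr_of_eventuallyEq (.of_forall fun y => ?_)
    simp [real_inner_comm]
  have h3 := h1.mul h2
  have ef : heatGradient d w u
      = (fun y => heatKernel d u y * -(1 / (2 * u))) * fun y => inner ℝ y w := by
    ext y
    simp only [heatGradient, Pi.mul_apply]
    ring
  have eL : heatHessianCLM d w u x = (heatKernel d u x * -(1 / (2 * u))) • (innerSL ℝ) w +
      inner ℝ x w • -(1 / (2 * u)) • -(heatKernel d u x / (2 * u)) • (innerSL ℝ) x := by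
    rw [heatHessianCLM, smul_smul, smul_smul]
    congr 2
    · ring
    · ring
  rw [ef, eL]
  exact h3

theorem continuous_heatKernel_space (u : ℝ) : Continuous (heatKernel d u) := by
  unfold heatKernel
  fun_prop

theorem continuous_heatGradient_space (w : E) (u : ℝ) : Continuous (heatGradient d w u) := by
  unfold heatGradient
  have := continuous_heatKernel_space (d := d) u
  fun_prop

theorem continuous_heatHessianCLM_space (w : E) (u : ℝ) : Continuous (heatHessianCLM d w u) := by
  unfold heatHessianCLM
  have := continuous_heatKernel_space (d := d) u
  fun_prop

theorem heatKernel_le_gaussEnvelope {u : ℝ} (hu : 0 < u) (x : E) :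
    heatKernel d u x ≤ 6144 * gaussEnvelope d u x := by
  simpa using one_add_pow_mul_heatKernel_le (x := x) hu (k := 0) (by norm_num)

theorem norm_mul_heatKernel_le {u : ℝ} (hu : 0 < u) (x : E) :
    heatKernel d u x / (2 * u) * ‖x‖ ≤ 6144 * (1 + u⁻¹) * gaussEnvelope d u x := by
  have h := one_add_pow_mul_heatKernel_le (x := x) hu (k := 1) (by norm_num)
  have hG := heatKernel_nonneg (d := d) hu.le x
  have hx : ‖x‖ / (2 * u) ≤ (1 + u⁻¹) * (1 + ‖x‖ ^ 2 / u) := by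
    have : ‖x‖ / (2 * u) ≤ u⁻¹ * 1 + ‖x‖ ^ 2 / u := by
      rw [← sub_nonneg]
      have : u⁻¹ * 1 + ‖x‖ ^ 2 / u - ‖x‖ / (2 * u) = (2 + 2 * ‖x‖ ^ 2 - ‖x‖) / (2 * u) := by
        field_simp
      rw [this]
      apply div_nonneg _ (by positivity)
      nlinarith [sq_nonneg (‖x‖ - 1)]
    have h0 : 0 ≤ ‖x‖ ^ 2 / u := by positivity
    have h1 : 0 < u⁻¹ := by positivity
    nlinarith
  calc heatKernel d u x / (2 * u) * ‖x‖ = ‖x‖ / (2 * u) * heatKernel d u x := by ring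
    _ ≤ (1 + u⁻¹) * (1 + ‖x‖ ^ 2 / u) * heatKernel d u x := by gcongr
    _ = (1 + u⁻¹) * ((1 + ‖x‖ ^ 2 / u) ^ 1 * heatKernel d u x) := by ring
    _ ≤ (1 + u⁻¹) * (6144 * gaussEnvelope d u x) := by
        have : 0 < 1 + u⁻¹ := by positivity
        gcongr
    _ = _ := by ring

theorem norm_fderiv_heatKernel_le {u : ℝ} (hu : 0 < u) (x : E) :
    ‖-(heatKernel d u x / (2 * u)) • innerSL ℝ x‖ ≤ 6144 * (1 + u⁻¹) * gaussEnvelope d u x := by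
  have hG := heatKernel_nonneg (d := d) hu.le x
  rw [norm_smul, innerSL_apply_norm, norm_neg, Real.norm_of_nonneg (by positivity)]
  exact norm_mul_heatKernel_le hu x

theorem abs_heatGradient_le {w : E} {u : ℝ} (hu : 0 < u) (hw : ‖w‖ ≤ 1) (x : E) :
    |heatGradient d w u x| ≤ 6144 * (1 + u⁻¹) * gaussEnvelope d u x := by
  have h : heatGradient d w u x = (-(heatKernel d u x / (2 * u)) • innerSL ℝ x) w := by
    simp [heatGradient]
  rw [h, ← Real.norm_eq_abs]
  refine ((ContinuousLinearMap.le_opNorm _ _).trans ?_).trans (norm_fderiv_heatKernel_le hu x)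
  exact mul_le_of_le_one_right (norm_nonneg _) hw

theorem norm_heatHessianCLM_le {w : E} {u : ℝ} (hu : 0 < u) (hw : ‖w‖ ≤ 1) (x : E) :
    ‖heatHessianCLM d w u x‖ ≤ 6144 * u⁻¹ * gaussEnvelope d u x := by
  have := gaussEnvelope_nonneg (d := d) hu.le x
  refine ContinuousLinearMap.opNorm_le_of_unit_norm (by positivity) fun v hv => ?_
  rw [heatHessianCLM_apply, Real.norm_eq_abs]
  exact abs_heatHessian_le hu hv.le hw

theorem integrable_gaussEnvelope {u : ℝ} (hu : 0 < u) : Integrable (gaussEnvelope d u) := by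
  have hm : Continuous (gaussEnvelope d u) := by unfold gaussEnvelope; fun_prop
  refine ⟨hm.aestronglyMeasurable, ?_⟩
  rw [hasFiniteIntegral_iff_ofReal (.of_forall (gaussEnvelope_nonneg hu.le)),
    lintegral_gaussEnvelope hu]
  exact ofReal_lt_top

end HeatGradient

section FourierHeat

open FourierTransform

variable {V : Type*} [NormedAddCommGroup V] [InnerProductSpace ℝ V] [FiniteDimensional ℝ V]
  [MeasurableSpace V] [BorelSpace V]

theorem fourier_smul_apply (c : ℂ) (f : V → ℂ) (ξ : V) : 𝓕 (c • f) ξ = c * 𝓕 f ξ := by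
  simp only [Real.fourier_eq, Pi.smul_apply, smul_eq_mul, ← integral_const_mul, Circle.smul_def]
  refine integral_congr_ae (.of_forall fun x => ?_)
  ring

theorem norm_fourier_fderiv_apply_le {f : V → ℝ} {f' : V → V →L[ℝ] ℝ} (hf : Integrable f)
    (hd : ∀ x, HasFDerivAt f (f' x) x) (hf' : Integrable f') (v ξ : V) :
    ‖𝓕 (fun x => (f' x v : ℂ)) ξ‖ ≤ 2 * π * ‖v‖ * ‖ξ‖ * ‖𝓕 (fun x => (f x : ℂ)) ξ‖ := by
  set g : V → ℂ := fun x => (f x : ℂ)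
  have hg : ∀ x, HasFDerivAt g (Complex.ofRealCLM ∘L f' x) x :=
    fun x => Complex.ofRealCLM.hasFDerivAt.comp x (hd x)
  have hfd : fderiv ℝ g = fun x => Complex.ofRealCLM ∘L f' x := funext fun x => (hg x).fderiv
  have hgi : Integrable g := hf.ofReal
  have hgi' : Integrable (fderiv ℝ g) := by
    rw [hfd]
    exact ((ContinuousLinearMap.compL ℝ V ℝ ℂ) Complex.ofRealCLM).integrable_comp hf'
  have h := Real.fourier_fderiv hgi (fun x => (hg x).differentiableAt) hgi'
  have h2 := Real.fourier_continuousLinearMap_apply (a := v) (v := ξ) hgi'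
  have h3 : (fun x => (f' x v : ℂ)) = fun x => fderiv ℝ g x v := by
    rw [hfd]; rfl
  rw [h3, ← h2, h, VectorFourier.fourierSMulRight_apply]
  simp only [norm_smul, norm_neg, norm_mul, Complex.norm_I, Complex.norm_real, neg_smul,
    Real.norm_of_nonneg pi_pos.le, RCLike.norm_ofNat, mul_one, neg_apply]
  have : ‖inner ℝ ξ v‖ ≤ ‖v‖ * ‖ξ‖ := by
    rw [mul_comm]; exact norm_inner_le_norm _ _
  have h0 : 0 ≤ 2 * π := by positivity
  calc 2 * π * (‖inner ℝ ξ v‖ * ‖𝓕 g ξ‖) ≤ 2 * π * (‖v‖ * ‖ξ‖ * ‖𝓕 g ξ‖) := by gcongr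
    _ = _ := by ring

variable {d : ℕ}

local notation "E" => EuclideanSpace ℝ (Fin d)

theorem norm_fourier_heatKernel {u : ℝ} (hu : 0 < u) (ξ : E) :
    ‖𝓕 (fun x : E => (heatKernel d u x : ℂ)) ξ‖ = Real.exp (-(4 * π ^ 2 * u * ‖ξ‖ ^ 2)) := by
  have h := fourier_gaussian_innerProductSpace (b := ((1 / (4 * u) : ℝ) : ℂ)) (V := E)
    (by rw [Complex.ofReal_re]; positivity) ξ
  have e : (fun x : E => (heatKernel d u x : ℂ)) = (((4 * π * u) ^ (-(d : ℝ) / 2) : ℝ) : ℂ) •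
      fun x : E => Complex.exp (-((1 / (4 * u) : ℝ) : ℂ) * ‖x‖ ^ 2) := by
    ext x
    simp only [heatKernel, Pi.smul_apply, smul_eq_mul, Complex.ofReal_mul]
    congr 1
    rw [Complex.ofReal_exp]
    congr 1
    push_cast
    ring
  rw [e, fourier_smul_apply, h, norm_mul, norm_mul, Complex.norm_real,
    Real.norm_of_nonneg (by positivity), finrank_euclideanSpace_fin]
  have e1 : ((π : ℂ) / ((1 / (4 * u) : ℝ) : ℂ)) ^ ((d : ℂ) / 2)
      = (((4 * π * u) ^ ((d : ℝ) / 2) : ℝ) : ℂ) := by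
    rw [Complex.ofReal_cpow (by positivity)]
    congr 1
    · push_cast
      field_simp
    · push_cast; rfl
  have e2 : Complex.exp (-(π : ℂ) ^ 2 * (‖ξ‖ : ℂ) ^ 2 / ((1 / (4 * u) : ℝ) : ℂ))
      = ((Real.exp (-(4 * π ^ 2 * u * ‖ξ‖ ^ 2)) : ℝ) : ℂ) := by
    rw [Complex.ofReal_exp]
    congr 1
    push_cast
    field_simp
  rw [e1, e2, Complex.norm_real, Complex.norm_real, Real.norm_of_nonneg (by positivity),
    Real.norm_of_nonneg (by positivity), ← mul_assoc, ← Real.rpow_add (by positivity)]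
  ring_nf
  simp

theorem norm_fourier_heatHessian_le {v w : E} {u : ℝ} (hu : 0 < u) (hv : ‖v‖ ≤ 1) (hw : ‖w‖ ≤ 1)
    (ξ : E) :
    ‖𝓕 (fun x : E => (heatHessian d v w u x : ℂ)) ξ‖
      ≤ 4 * π ^ 2 * ‖ξ‖ ^ 2 * Real.exp (-(4 * π ^ 2 * ‖ξ‖ ^ 2) * u) := by
  have hi := integrable_gaussEnvelope (d := d) hu
  have h1 := norm_fourier_fderiv_apply_le (f := heatKernel d u)
    (f' := fun x => -(heatKernel d u x / (2 * u)) • innerSL ℝ x)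
    ((hi.const_mul 6144).mono' (continuous_heatKernel_space u).aestronglyMeasurable
      (.of_forall fun x => by
        rw [Real.norm_of_nonneg (heatKernel_nonneg hu.le x)]
        exact heatKernel_le_gaussEnvelope hu x))
    (hasFDerivAt_heatKernel hu)
    ((hi.const_mul _).mono' (by
        have := continuous_heatKernel_space (d := d) u
        exact (by fun_prop : Continuous _).aestronglyMeasurable)
      (.of_forall (norm_fderiv_heatKernel_le hu))) w ξ
  have h2 := norm_fourier_fderiv_apply_le (f := heatGradient d w u) (f' := heatHessianCLM d w u)
    ((hi.const_mul _).mono' (continuous_heatGradient_space w u).aestronglyMeasurable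
      (.of_forall (abs_heatGradient_le hu hw)))
    (hasFDerivAt_heatGradient w hu)
    ((hi.const_mul _).mono' (continuous_heatHessianCLM_space w u).aestronglyMeasurable
      (.of_forall (norm_heatHessianCLM_le hu hw))) v ξ
  have e : (fun x : E => (((-(heatKernel d u x / (2 * u)) • innerSL ℝ x) w : ℝ) : ℂ))
      = fun x => (heatGradient d w u x : ℂ) := by
    ext x; simp [heatGradient]
  simp only [e] at h1
  simp only [heatHessianCLM_apply] at h2
  rw [norm_fourier_heatKernel hu] at h1
  have h0 : 0 < π := pi_pos
  calc _ ≤ _ := h2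
    _ ≤ 2 * π * 1 * ‖ξ‖ * (2 * π * 1 * ‖ξ‖ * Real.exp (-(4 * π ^ 2 * u * ‖ξ‖ ^ 2))) := by
        gcongr
        exact h1.trans (by gcongr)
    _ = _ := by ring_nf

/-- An upper bound for the spatial Fourier transform of the second derivatives of the heat
kernel, integrable in time with integral at most one. -/
def heatSymbol (ξ : EuclideanSpace ℝ (Fin d)) (u : ℝ) : ℝ≥0∞ :=
  (Ioi (0:ℝ)).indicator (fun u => ENNReal.ofReal
    (4 * π ^ 2 * ‖ξ‖ ^ 2 * Real.exp (-(4 * π ^ 2 * ‖ξ‖ ^ 2) * u))) u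

theorem measurable_heatSymbol : Measurable fun q : E × ℝ => heatSymbol q.1 q.2 := by
  have h : (fun q : E × ℝ => heatSymbol q.1 q.2)
      = (Prod.snd ⁻¹' (Ioi (0:ℝ))).indicator (fun q : E × ℝ => ENNReal.ofReal
        (4 * π ^ 2 * ‖q.1‖ ^ 2 * Real.exp (-(4 * π ^ 2 * ‖q.1‖ ^ 2) * q.2))) := by
    ext q
    simp [heatSymbol, indicator]
  rw [h]
  exact Measurable.indicator (by fun_prop) (measurable_snd measurableSet_Ioi)

theorem lintegral_heatSymbol_le (ξ : E) : ∫⁻ u, heatSymbol ξ u ≤ 1 := by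
  unfold heatSymbol
  rw [lintegral_indicator measurableSet_Ioi]
  set a := 4 * π ^ 2 * ‖ξ‖ ^ 2
  have ha : 0 ≤ a := by positivity
  rcases ha.eq_or_lt with h0 | h0
  · simp [← h0]
  · rw [← ofReal_integral_eq_lintegral_ofReal ((integrableOn_exp_mul_Ioi (by linarith) 0).const_mul a)
      (.of_forall fun x => by positivity), integral_const_mul, integral_exp_mul_Ioi (by linarith)]
    simp [h0.ne']

theorem enorm_fourier_truncatedKernel_le {v w : E} {ε : ℝ} (hε : 0 < ε) (hv : ‖v‖ ≤ 1)
    (hw : ‖w‖ ≤ 1) (u : ℝ) (ξ : E) :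
    ‖𝓕 (fun x : E => (truncatedKernel d v w ε (u, x) : ℂ)) ξ‖ₑ ≤ heatSymbol ξ u := by
  by_cases hu : 0 < u
  · have e : (fun x : E => (truncatedKernel d v w ε (u, x) : ℂ))
        = ((timeCutoff ε u : ℝ) : ℂ) • fun x : E => (heatHessian d v w u x : ℂ) := by
      ext x
      simp [truncatedKernel, hu]
    rw [e, fourier_smul_apply, heatSymbol, indicator_of_mem (show u ∈ Ioi 0 from hu),
      ← ofReal_norm, norm_mul, Complex.norm_real,
      Real.norm_of_nonneg (timeCutoff_nonneg hε hu.le)]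
    refine ENNReal.ofReal_le_ofReal ?_
    exact (mul_le_of_le_one_left (norm_nonneg _) (timeCutoff_le_one hε hu.le)).trans
      (norm_fourier_heatHessian_le hu hv hw ξ)
  · have e : (fun x : E => (truncatedKernel d v w ε (u, x) : ℂ)) = fun _ => 0 := by
      ext x
      simp [truncatedKernel, hu]
    rw [e, Real.fourier_eq]
    simp

end FourierHeat

section SquareBound

open FourierTransform

variable {d : ℕ}

local notation "E" => EuclideanSpace ℝ (Fin d)

instance Measure.prod.instIsNegInvariantRealEuclidean (d : ℕ) :
    ((volume : Measure ℝ).prod (volume : Measure (EuclideanSpace ℝ (Fin d)))).IsNegInvariant :=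
  Measure.prod.instIsNegInvariant _ _

/-- The Fourier transform of a translate, at the level of integrals of characters. -/
theorem integral_fourierChar_smul_translate (g : E → ℂ) (z ξ : E) (c : ℂ) :
    ∫ y, 𝐞 (-inner ℝ y ξ) • (g (y - z) * c) = 𝓕 g ξ * (𝐞 (-inner ℝ z ξ) • c) := by
  rw [Real.fourier_eq, ← integral_mul_const,
    ← integral_sub_right_eq_self (fun y => 𝐞 (-inner ℝ y ξ) • g y * (𝐞 (-inner ℝ z ξ) • c)) z]
  refine integral_congr_ae (.of_forall fun y => ?_)
  have : 𝐞 (-inner ℝ y ξ) = 𝐞 (-inner ℝ (y - z) ξ) * 𝐞 (-inner ℝ z ξ) := by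
    rw [← AddChar.map_add_eq_mul, inner_sub_left]
    congr 1
    ring
  simp only [this, Circle.smul_def, smul_eq_mul, Circle.coe_mul]
  ring

/-- The spatial Fourier transform turns a space-time convolution into a convolution in time. -/
theorem fourier_kernelConv {k f : ℝ × E → ℝ} {t : ℝ}
    (h : Integrable (fun q : E × (ℝ × E) => k ((t, q.1) - q.2) * f q.2)
      ((volume : Measure E).prod ((volume : Measure ℝ).prod (volume : Measure E)))) (ξ : E) :
    𝓕 (fun y => (kernelConv (volume.prod volume) k f (t, y) : ℂ)) ξ
      = ∫ s, 𝓕 (fun x => (k (t - s, x) : ℂ)) ξ * 𝓕 (fun z => (f (s, z) : ℂ)) ξ := by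
  set m : Measure (ℝ × E) := (volume : Measure ℝ).prod (volume : Measure E)
  have hΦ : Integrable (fun q : E × (ℝ × E) =>
      𝐞 (-inner ℝ q.1 ξ) • ((k ((t, q.1) - q.2) : ℂ) * (f q.2 : ℂ)))
      ((volume : Measure E).prod m) := by
    have h1 : Integrable (fun q : E × (ℝ × E) => ((k ((t, q.1) - q.2) * f q.2 : ℝ) : ℂ))
      ((volume : Measure E).prod m) := h.ofReal
    refine h1.norm.mono' ?_ (.of_forall fun q => ?_)
    · refine AEStronglyMeasurable.smul ?_ ?_
      · exact (by fun_prop : Continuous fun q : E × (ℝ × E) =>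
          ((𝐞 (-inner ℝ q.1 ξ) : Circle) : ℂ)).aestronglyMeasurable
      · exact h1.aestronglyMeasurable.congr (.of_forall fun q => by simp)
    · rw [Circle.norm_smul, Complex.ofReal_mul]
  have e1 : ∀ y, 𝐞 (-inner ℝ y ξ) • ((kernelConv m k f (t, y) : ℝ) : ℂ)
      = ∫ w, 𝐞 (-inner ℝ y ξ) • ((k ((t, y) - w) : ℂ) * (f w : ℂ)) ∂m := by
    intro y
    rw [kernelConv, ← integral_complex_ofReal, Circle.smul_def, ← integral_smul]
    simp [Circle.smul_def]
  rw [Real.fourier_eq]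
  simp only [e1]
  rw [integral_integral_swap hΦ]
  have e2 : ∀ w : ℝ × E, ∫ y, 𝐞 (-inner ℝ y ξ) • ((k ((t, y) - w) : ℂ) * (f w : ℂ))
      = 𝓕 (fun x => (k (t - w.1, x) : ℂ)) ξ * (𝐞 (-inner ℝ w.2 ξ) • (f w : ℂ)) := fun w =>
    integral_fourierChar_smul_translate (fun x => (k (t - w.1, x) : ℂ)) w.2 ξ (f w)
  have hi := hΦ.integral_prod_right
  simp only [e2] at hi ⊢
  rw [integral_prod _ hi]
  refine integral_congr_ae (.of_forall fun s => ?_)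
  simp only [integral_const_mul, Real.fourier_eq]

theorem stronglyMeasurable_fourier_slice {f : ℝ × E → ℝ} (hf : Measurable f) :
    StronglyMeasurable fun q : E × ℝ => 𝓕 (fun z => (f (q.2, z) : ℂ)) q.1 := by
  simp only [Real.fourier_eq]
  refine StronglyMeasurable.integral_prod_right (f := fun (q : E × ℝ) (z : E) =>
    𝐞 (-inner ℝ z q.1) • (f (q.2, z) : ℂ)) ?_
  refine StronglyMeasurable.smul ?_ ?_
  · exact (by fun_prop : Continuous fun p : (E × ℝ) × E =>
      ((𝐞 (-inner ℝ p.2 p.1.1) : Circle) : ℂ)).stronglyMeasurable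
  · exact (by fun_prop : Measurable fun p : (E × ℝ) × E =>
      (f (p.1.2, p.2) : ℂ)).stronglyMeasurable

/-- The integrand of a convolution of integrable functions is integrable. -/
theorem integrable_kernelConv_integrand {S : Type*} [AddCommGroup S] [MeasurableSpace S]
    [MeasurableAdd₂ S] [MeasurableNeg S] {m : Measure S} [SigmaFinite m] [m.IsAddLeftInvariant]
    [m.IsNegInvariant] {k f : S → ℝ} (hk : Measurable k) (hki : Integrable k m)
    (hf : Measurable f) (hfi : Integrable f m) :
    Integrable (fun p : S × S => k (p.1 - p.2) * f p.2) (m.prod m) := by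
  have hm : Measurable fun p : S × S => k (p.1 - p.2) * f p.2 := by fun_prop
  refine ⟨hm.aestronglyMeasurable, ?_⟩
  rw [hasFiniteIntegral_iff_enorm, lintegral_prod_symm _ hm.enorm.aemeasurable]
  have : ∀ w, ∫⁻ x, ‖k (x - w) * f w‖ₑ ∂m = (∫⁻ x, ‖k x‖ₑ ∂m) * ‖f w‖ₑ := by
    intro w
    simp only [enorm_mul]
    rw [lintegral_mul_const _ (by fun_prop), lintegral_sub_right_eq_self (fun x => ‖k x‖ₑ) w]
  simp only [this]
  rw [lintegral_const_mul _ hf.enorm]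
  exact ENNReal.mul_lt_top hki.2 hfi.2

/-- Plancherel's theorem on almost every time slice. -/
theorem ae_lintegral_sq_slice_eq {g : ℝ × E → ℝ} (hg : Measurable g)
    (hg₁ : Integrable g ((volume : Measure ℝ).prod (volume : Measure E)))
    (hg₂ : ∫⁻ x, ‖g x‖ₑ ^ (2:ℝ) ∂((volume : Measure ℝ).prod (volume : Measure E)) < ∞) :
    ∀ᵐ t : ℝ, ∫⁻ y, ‖g (t, y)‖ₑ ^ (2:ℝ)
      = ∫⁻ ξ, ‖𝓕 (fun y => (g (t, y) : ℂ)) ξ‖ₑ ^ (2:ℝ) := by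
  rw [lintegral_prod _ (hg.enorm.pow_const _).aemeasurable] at hg₂
  have hm2 : Measurable fun t : ℝ => ∫⁻ y, ‖g (t, y)‖ₑ ^ (2:ℝ) :=
    (hg.enorm.pow_const _).lintegral_prod_right'
  filter_upwards [hg₁.prod_right_ae, ae_lt_top hm2 hg₂.ne] with t h1 h2
  have h1' : Integrable fun y => (g (t, y) : ℂ) := h1.ofReal
  have h3 : MemLp (fun y => g (t, y)) 2 := by
    refine ⟨(hg.comp measurable_prodMk_left).aestronglyMeasurable, ?_⟩
    rw [eLpNorm_lt_top_iff_lintegral_rpow_enorm_lt_top (by norm_num) (by norm_num)]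
    simpa using h2
  have h3' : MemLp (fun y => (g (t, y) : ℂ)) 2 := h3.ofReal
  rw [lintegral_enorm_fourier_sq h1' h3']
  refine lintegral_congr fun y => ?_
  simp [enorm_eq_nnnorm]

theorem integrable_kernelConv {S : Type*} [AddCommGroup S] [MeasurableSpace S]
    [MeasurableAdd₂ S] [MeasurableNeg S] {m : Measure S} [SigmaFinite m] [m.IsAddLeftInvariant]
    [m.IsNegInvariant] {k f : S → ℝ} (hk : Measurable k) (hki : Integrable k m)
    (hf : Measurable f) (hfi : Integrable f m) : Integrable (kernelConv m k f) m :=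
  (integrable_kernelConv_integrand hk hki hf hfi).integral_prod_left

theorem lintegral_sq_kernelConv_lt_top {S : Type*} [AddCommGroup S] [MeasurableSpace S]
    [MeasurableAdd₂ S] [MeasurableNeg S] {m : Measure S} [SigmaFinite m] [m.IsAddLeftInvariant]
    [m.IsNegInvariant] {k f : S → ℝ} (hk : Measurable k) (hki : Integrable k m)
    (hf : Measurable f) (hfi : ∫⁻ x, ‖f x‖ₑ ^ (2:ℝ) ∂m < ∞) :
    ∫⁻ x, ‖kernelConv m k f x‖ₑ ^ (2:ℝ) ∂m < ∞ := by
  have h := lintegral_rpow_lowerConv_le (m := m) (q := 2) (by norm_num) hk.enorm hf.enorm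
  have h2 : (∫⁻ y, lowerConv m (fun w => ‖k w‖ₑ) (fun w => ‖f w‖ₑ) y ^ (2:ℝ) ∂m) < ∞ := by
    rw [← ENNReal.rpow_lt_top_iff_of_pos (y := 1 / 2) (by norm_num)]
    refine h.trans_lt (ENNReal.mul_lt_top hki.2 ?_)
    exact ENNReal.rpow_lt_top_of_nonneg (by norm_num) hfi.ne
  refine lt_of_le_of_lt (lintegral_mono fun x => ?_) h2
  exact ENNReal.rpow_le_rpow (enorm_kernelConv_le m k f x) (by norm_num)

theorem ae_enorm_fourier_kernelConv_le {v w : E} {ε : ℝ} (hε : 0 < ε) (hv : ‖v‖ ≤ 1) (hw : ‖w‖ ≤ 1)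
    {f : ℝ × E → ℝ} (hf : Measurable f)
    (hf₁ : Integrable f ((volume : Measure ℝ).prod (volume : Measure E))) :
    ∀ᵐ t : ℝ, ∀ ξ : E, ‖𝓕 (fun y =>
        (kernelConv (volume.prod volume) (truncatedKernel d v w ε) f (t, y) : ℂ)) ξ‖ₑ
      ≤ lowerConv volume (heatSymbol ξ) (fun s => ‖𝓕 (fun z => (f (s, z) : ℂ)) ξ‖ₑ) t := by
  have hInt := integrable_kernelConv_integrand
    (measurable_truncatedKernel (d := d) (v := v) (w := w) (ε := ε))
    (integrable_truncatedKernel hε hv hw) hf hf₁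
  have h1 : Integrable (fun q : ℝ × (E × (ℝ × E)) =>
      truncatedKernel d v w ε ((q.1, q.2.1) - q.2.2) * f q.2.2)
      ((volume : Measure ℝ).prod ((volume : Measure E).prod (volume.prod volume))) := by
    have := (measurePreserving_prodAssoc (volume : Measure ℝ) (volume : Measure E)
      ((volume : Measure ℝ).prod (volume : Measure E))).symm
    exact this.integrable_comp_of_integrable hInt
  filter_upwards [h1.prod_right_ae] with t ht ξ
  rw [fourier_kernelConv ht ξ]
  refine (enorm_integral_le_lintegral_enorm _).trans (lintegral_mono fun s => ?_)
  simp only [enorm_mul]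
  gcongr
  exact enorm_fourier_truncatedKernel_le hε hv hw (t - s) ξ

theorem measurable_enorm_fourier_slice {f : ℝ × E → ℝ} (hf : Measurable f) :
    Measurable fun q : E × ℝ => ‖𝓕 (fun z => (f (q.2, z) : ℂ)) q.1‖ₑ :=
  (stronglyMeasurable_fourier_slice hf).measurable.enorm

/-- Convolution in the second variable with a family of kernels of integral at most one is a
contraction of `L²`. -/
theorem lintegral_sq_lowerConv_le {X : Type*} [MeasurableSpace X] {ν : Measure X} [SFinite ν]
    {σ F : X × ℝ → ℝ≥0∞} (hσ : Measurable σ) (hF : Measurable F) (h₁ : ∀ ξ, ∫⁻ u, σ (ξ, u) ≤ 1) :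
    ∫⁻ t, ∫⁻ ξ, lowerConv volume (fun u => σ (ξ, u)) (fun s => F (ξ, s)) t ^ (2:ℝ) ∂ν
      ≤ ∫⁻ s, ∫⁻ ξ, F (ξ, s) ^ (2:ℝ) ∂ν := by
  have hLm : Measurable fun q : ℝ × X =>
      lowerConv volume (fun u => σ (q.2, u)) (fun s => F (q.2, s)) q.1 := by
    refine Measurable.lintegral_prod_right' (f := fun p : (ℝ × X) × ℝ =>
      σ (p.1.2, p.1.1 - p.2) * F (p.1.2, p.2)) ?_
    fun_prop
  rw [lintegral_lintegral_swap (hLm.pow_const _).aemeasurable,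
    lintegral_lintegral_swap (f := fun s ξ => F (ξ, s) ^ (2:ℝ)) (by fun_prop)]
  refine lintegral_mono fun ξ => ?_
  have h := lintegral_rpow_lowerConv_le (m := (volume : Measure ℝ)) (q := 2) (by norm_num)
    (k := fun u => σ (ξ, u)) (f := fun s => F (ξ, s)) (by fun_prop) (by fun_prop)
  have h2 := h.trans (mul_le_of_le_one_left zero_le (h₁ ξ))
  exact (ENNReal.rpow_le_rpow_iff (by norm_num)).1 h2

theorem lintegral_sq_kernelConv_le {v w : E} {ε : ℝ} (hε : 0 < ε) (hv : ‖v‖ ≤ 1) (hw : ‖w‖ ≤ 1)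
    {f : ℝ × E → ℝ} (hf : Measurable f)
    (hf₁ : Integrable f ((volume : Measure ℝ).prod (volume : Measure E)))
    (hf₂ : ∫⁻ x, ‖f x‖ₑ ^ (2:ℝ) ∂((volume : Measure ℝ).prod (volume : Measure E)) < ∞) :
    ∫⁻ x, ‖kernelConv (volume.prod volume) (truncatedKernel d v w ε) f x‖ₑ ^ (2:ℝ)
        ∂((volume : Measure ℝ).prod (volume : Measure E))
      ≤ ∫⁻ x, ‖f x‖ₑ ^ (2:ℝ) ∂((volume : Measure ℝ).prod (volume : Measure E)) := by
  have hk := measurable_truncatedKernel (d := d) (v := v) (w := w) (ε := ε)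
  have hki := integrable_truncatedKernel (d := d) hε hv hw
  have hKm := measurable_kernelConv (m := (volume : Measure ℝ).prod (volume : Measure E)) hk hf
  rw [lintegral_prod _ (hKm.enorm.pow_const _).aemeasurable,
    lintegral_prod _ (hf.enorm.pow_const _).aemeasurable,
    lintegral_congr_ae (ae_lintegral_sq_slice_eq hf hf₁ hf₂),
    lintegral_congr_ae (ae_lintegral_sq_slice_eq hKm (integrable_kernelConv hk hki hf hf₁)
      (lintegral_sq_kernelConv_lt_top hk hki hf hf₂))]
  refine (lintegral_mono_ae ?_).trans
    (lintegral_sq_lowerConv_le measurable_heatSymbol (measurable_enorm_fourier_slice hf)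
      lintegral_heatSymbol_le)
  filter_upwards [ae_enorm_fourier_kernelConv_le hε hv hw hf hf₁] with t ht
  exact lintegral_mono fun ξ => ENNReal.rpow_le_rpow (ht ξ) (by norm_num)

theorem mixedBound_two_truncatedKernel {v w : E} {ε : ℝ} (hε : 0 < ε) (hv : ‖v‖ ≤ 1)
    (hw : ‖w‖ ≤ 1) :
    MixedBound (volume : Measure ℝ) (volume : Measure E) (truncatedKernel d v w ε) 2 2 1 := by
  refine MixedBound.of_bounded (by norm_num) (by norm_num) measurable_truncatedKernel
    (integrable_truncatedKernel hε hv hw) ?_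
  rintro f hf ⟨M, hM⟩ hs hE
  have hKm := measurable_kernelConv (m := (volume : Measure ℝ).prod (volume : Measure E))
    (measurable_truncatedKernel (d := d) (v := v) (w := w) (ε := ε)) hf
  rw [mixedEnergy_self (by norm_num) hf.enorm] at hE ⊢
  rw [mixedEnergy_self (by norm_num) hKm.enorm, one_mul]
  refine lintegral_sq_kernelConv_le hε hv hw hf ?_ hE
  rw [← integrableOn_iff_integrable_of_support_subset (subset_refl _)]
  exact Measure.integrableOn_of_bounded hs.ne hf.aestronglyMeasurable (.of_forall hM)

end SquareBound

section TrivialFactor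

variable {S Y : Type*} [MeasurableSpace S] [MeasurableSpace Y] {μ : Measure S} {ν : Measure Y}
  [SigmaFinite μ] [AddCommGroup S] [AddCommGroup Y] {q r : ℝ} {k : S → ℝ} {C : ℝ≥0∞}

theorem kernelConv_comp_fst [IsProbabilityMeasure ν] (f : S → ℝ) (x : S × Y) :
    kernelConv (μ.prod ν) (fun p => k p.1) (fun p => f p.1) x = kernelConv μ k f x.1 := by
  unfold kernelConv
  simpa using integral_fun_fst (μ := μ) (ν := ν) fun s => k (x.1 - s) * f s

theorem mixedEnergy_comp_fst [IsProbabilityMeasure ν] (hq : 0 < q) (F : S → ℝ≥0∞) :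
    mixedEnergy μ ν r q (fun p => F p.1) = ∫⁻ s, F s ^ r ∂μ := by
  have : ∀ s, sliceNorm ν q (fun p : S × Y => F p.1) s = F s := fun s => by
    simp [sliceNorm, ← ENNReal.rpow_mul, hq.ne']
  simp [mixedEnergy, this]

theorem mixedBound_fst_iff [IsProbabilityMeasure ν] [Unique Y] (hq : 0 < q) :
    MixedBound μ ν (fun p => k p.1) r q C ↔ ∀ f : S → ℝ, Measurable f →
      ∫⁻ x, ‖f x‖ₑ ^ r ∂μ < ∞ →
      ∫⁻ x, ‖kernelConv μ k f x‖ₑ ^ r ∂μ ≤ C * ∫⁻ x, ‖f x‖ₑ ^ r ∂μ := by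
  constructor
  · intro h f hf hfi
    have h1 := h (fun p => f p.1) (hf.comp measurable_fst)
      (by rwa [mixedEnergy_comp_fst hq (fun x => ‖f x‖ₑ)])
    simp only [kernelConv_comp_fst] at h1
    rwa [mixedEnergy_comp_fst hq (fun x => ‖f x‖ₑ),
      mixedEnergy_comp_fst hq (fun x => ‖kernelConv μ k f x‖ₑ)] at h1
  · intro h f hf hfi
    obtain ⟨g, hg, rfl⟩ : ∃ g : S → ℝ, Measurable g ∧ f = fun p => g p.1 :=
      ⟨fun s => f (s, default), hf.comp measurable_prodMk_right, by
        ext ⟨s, y⟩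
        rw [Unique.eq_default y]⟩
    simp only [kernelConv_comp_fst]
    rw [mixedEnergy_comp_fst hq (fun x => ‖g x‖ₑ)] at hfi ⊢
    rw [mixedEnergy_comp_fst hq (fun x => ‖kernelConv μ k g x‖ₑ)]
    exact h g hg hfi

theorem mixedBound_self_iff [SigmaFinite ν] [MeasurableSub₂ (S × Y)] {k : S × Y → ℝ}
    (hk : Measurable k) (hr : 0 < r) :
    MixedBound μ ν k r r C ↔ ∀ f : S × Y → ℝ, Measurable f →
      ∫⁻ x, ‖f x‖ₑ ^ r ∂μ.prod ν < ∞ →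
      ∫⁻ x, ‖kernelConv (μ.prod ν) k f x‖ₑ ^ r ∂μ.prod ν ≤ C * ∫⁻ x, ‖f x‖ₑ ^ r ∂μ.prod ν := by
  refine forall₂_congr fun f hf => ?_
  rw [mixedEnergy_self hr hf.enorm, mixedEnergy_self hr (measurable_kernelConv hk hf).enorm]

end TrivialFactor

section HeatBounds

variable {d : ℕ}

local notation "E" => EuclideanSpace ℝ (Fin d)

instance : IsProbabilityMeasure (volume : Measure (Fin 0 → ℝ)) := ⟨volume_univ_fin_zero⟩

/-- A bound for `truncatedKernel d v w ε` on `L^r(L^q)`, uniform in `v`, `w` and `ε`. -/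
def UniformHeatBound (d : ℕ) (r q : ℝ) : Prop :=
  ∃ C : ℝ≥0∞, C ≠ ∞ ∧ ∀ (v w : EuclideanSpace ℝ (Fin d)) (ε : ℝ), 0 < ε → ‖v‖ ≤ 1 → ‖w‖ ≤ 1 →
    MixedBound (volume : Measure ℝ) (volume : Measure (EuclideanSpace ℝ (Fin d)))
      (truncatedKernel d v w ε) r q C

theorem UniformHeatBound.dual {r q r' q' : ℝ} (hr : r.HolderConjugate r')
    (hq : q.HolderConjugate q') (h : UniformHeatBound d r q) : UniformHeatBound d r' q' := by
  obtain ⟨C, hC, h⟩ := h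
  refine ⟨C ^ (r' / r), ENNReal.rpow_ne_top_of_nonneg
    (div_nonneg hr.symm.nonneg hr.nonneg) hC, fun v w ε hε hv hw => ?_⟩
  exact (h v w ε hε hv hw).dual hr hq measurable_truncatedKernel
    (integrable_truncatedKernel hε hv hw)

theorem integrable_truncatedKernel_fst {v w : E} {ε : ℝ} (hε : 0 < ε) (hv : ‖v‖ ≤ 1)
    (hw : ‖w‖ ≤ 1) : Integrable (fun p : (ℝ × E) × (Fin 0 → ℝ) => truncatedKernel d v w ε p.1)
      (((volume : Measure ℝ).prod (volume : Measure E)).prod (volume : Measure (Fin 0 → ℝ))) :=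
  (integrable_truncatedKernel hε hv hw).comp_fst _

theorem uniformHeatBound_of_lt_two [NeZero d] {p : ℝ} (hp : 1 < p) (hp2 : p < 2) :
    UniformHeatBound d p p := by
  have h₃ : ENNReal.ofReal (2 * parabolicConstant d)
      + ENNReal.ofReal (2 * d * parabolicConstant d)
      + ENNReal.ofReal (8 * parabolicConstant d) ≠ ∞ :=
    ENNReal.add_ne_top.2 ⟨ENNReal.add_ne_top.2 ⟨ofReal_ne_top, ofReal_ne_top⟩, ofReal_ne_top⟩
  have hball : (volume (Metric.ball (0 : E) 1)) ≠ ∞ := measure_ball_lt_top.ne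
  refine ⟨_, czConstant_ne_top (D := 4 * 2 ^ d) (C₁ := 1)
    (C₂ := 4 * (ENNReal.ofReal ((d + 1) ^ d) * volume (Metric.ball (0 : E) 1)))
    (C₃ := ENNReal.ofReal (2 * parabolicConstant d) + ENNReal.ofReal (2 * d * parabolicConstant d)
      + ENNReal.ofReal (8 * parabolicConstant d))
    ?_ one_ne_top ?_ h₃ hp hp2, fun v w ε hε hv hw => ?_⟩
  · exact ENNReal.mul_ne_top (by norm_num) (ENNReal.pow_ne_top (by norm_num))
  · exact ENNReal.mul_ne_top (by norm_num) (ENNReal.mul_ne_top ofReal_ne_top hball)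
  rw [mixedBound_self_iff measurable_truncatedKernel (by linarith),
    ← mixedBound_fst_iff (ν := (volume : Measure (Fin 0 → ℝ))) (q := 2) (by norm_num)]
  refine MixedBound.of_hormander (timeGrid.prod (spaceGrid d)) ?_ hp hp2
    (k := fun p => truncatedKernel d v w ε p.1)
    (measurable_truncatedKernel.comp measurable_fst) (integrable_truncatedKernel_fst hε hv hw)
    ?_ h₃ (isParabolicKernel_truncatedKernel hε hv hw).hormander_parabolic
  · exact ENNReal.mul_ne_top (by norm_num) (ENNReal.pow_ne_top (by norm_num))
  · rw [mixedBound_fst_iff (by norm_num),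
      ← mixedBound_self_iff measurable_truncatedKernel (by norm_num)]
    exact mixedBound_two_truncatedKernel hε hv hw

theorem uniformHeatBound_self [NeZero d] {p : ℝ} (hp : 1 < p) : UniformHeatBound d p p := by
  rcases lt_trichotomy p 2 with h | rfl | h
  · exact uniformHeatBound_of_lt_two hp h
  · exact ⟨1, one_ne_top, fun v w ε hε hv hw => mixedBound_two_truncatedKernel hε hv hw⟩
  · have hc := Real.HolderConjugate.conjExponent hp
    have h2 : p.conjExponent < 2 := by
      rw [Real.conjExponent, div_lt_iff₀ (by linarith)]
      linarith
    exact (uniformHeatBound_of_lt_two hc.symm.lt h2).dual hc.symm hc.symm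

theorem uniformHeatBound_of_lt [NeZero d] {r p : ℝ} (hr : 1 < r) (hrp : r < p) :
    UniformHeatBound d r p := by
  obtain ⟨C, hC, h⟩ := uniformHeatBound_self (d := d) (hr.trans hrp)
  refine ⟨_, czConstant_ne_top (D := 4) (C₁ := C) (C₂ := 4)
    (C₃ := ENNReal.ofReal (2 * parabolicConstant d)) (by norm_num) hC (by norm_num)
    ofReal_ne_top hr hrp, fun v w ε hε hv hw => ?_⟩
  exact MixedBound.of_hormander timeGrid (by norm_num) hr hrp measurable_truncatedKernel
    (integrable_truncatedKernel hε hv hw) (h v w ε hε hv hw) ofReal_ne_top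
    (isParabolicKernel_truncatedKernel hε hv hw).hormander_time

theorem uniformHeatBound [NeZero d] {r p : ℝ} (hr : 1 < r) (hp : 1 < p) :
    UniformHeatBound d r p := by
  rcases lt_trichotomy r p with h | rfl | h
  · exact uniformHeatBound_of_lt hr h
  · exact uniformHeatBound_self hr
  · have hcr := Real.HolderConjugate.conjExponent hr
    have hcp := Real.HolderConjugate.conjExponent hp
    have h2 : r.conjExponent < p.conjExponent := by
      rw [Real.conjExponent, Real.conjExponent, div_lt_div_iff₀ (by linarith) (by linarith)]
      linarith
    exact (uniformHeatBound_of_lt hcr.symm.lt h2).dual hcr.symm hcp.symm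

end HeatBounds

section DifferentiationUnderIntegral

variable {d : ℕ}

local notation "E" => EuclideanSpace ℝ (Fin d)

theorem gaussEnvelope_le {u : ℝ} (hu : 0 < u) (x : E) :
    gaussEnvelope d u x ≤ (4 * π * u) ^ (-(d : ℝ) / 2) := by
  unfold gaussEnvelope
  refine mul_le_of_le_one_right (by positivity) (Real.exp_le_one_iff.2 ?_)
  rw [neg_div]
  exact neg_nonpos.2 (by positivity)

theorem continuous_gaussEnvelope_space (u : ℝ) : Continuous (gaussEnvelope d u) := by
  unfold gaussEnvelope
  fun_prop

theorem abs_le_one_add_abs_rpow {p : ℝ} (hp : 1 ≤ p) (a : ℝ) : |a| ≤ 1 + |a| ^ p := by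
  rcases le_total |a| 1 with h | h
  · have : 0 ≤ |a| ^ p := by positivity
    linarith
  · have := Real.rpow_le_rpow_of_exponent_le h hp
    rw [Real.rpow_one] at this
    linarith

theorem integrable_mul_gaussEnvelope {p u : ℝ} (hp : 1 ≤ p) (hu : 0 < u) {h : E → ℝ}
    (hh : Measurable h) (hhp : ∫⁻ z, ‖h z‖ₑ ^ p < ∞) (y : E) :
    Integrable fun z => |h z| * gaussEnvelope d u (y - z) := by
  have hp0 : 0 ≤ p := zero_le_one.trans hp
  have h1 : Integrable fun z => |h z| ^ p := by
    refine ⟨by fun_prop, ?_⟩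
    rw [hasFiniteIntegral_iff_enorm]
    refine lt_of_le_of_lt (lintegral_mono fun z => le_of_eq ?_) hhp
    rw [Real.enorm_rpow_of_nonneg (abs_nonneg _) hp0, enorm_abs]
  have h2 : Integrable fun z => gaussEnvelope d u (y - z) :=
    (integrable_gaussEnvelope hu).comp_sub_left y
  have hc := (continuous_gaussEnvelope_space (d := d) u).comp (continuous_sub_left y)
  refine (h2.add (h1.mul_const ((4 * π * u) ^ (-(d : ℝ) / 2)))).mono'
    (hh.abs.mul hc.measurable).aestronglyMeasurable (.of_forall fun z => ?_)
  have he := gaussEnvelope_nonneg (d := d) hu.le (y - z)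
  rw [Real.norm_eq_abs, abs_of_nonneg (by positivity), Pi.add_apply]
  have hle := gaussEnvelope_le hu (y - z)
  have ha := abs_le_one_add_abs_rpow hp (h z)
  have hb : 0 ≤ |h z| ^ p := by positivity
  nlinarith

theorem gaussEnvelope_le_of_norm_sub_le {u : ℝ} (hu : 0 < u) {x y : E} (hxy : ‖x - y‖ ≤ 1) :
    gaussEnvelope d u x ≤ 2 ^ ((d : ℝ) / 2) * Real.exp (1 / (8 * u)) * gaussEnvelope d (2 * u) y := by
  have h1 : ‖y‖ ^ 2 ≤ 2 * ‖x‖ ^ 2 + 2 := by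
    have : ‖y‖ ≤ ‖x‖ + 1 := by
      calc ‖y‖ = ‖x - (x - y)‖ := by congr 1; abel
        _ ≤ ‖x‖ + ‖x - y‖ := norm_sub_le _ _
        _ ≤ _ := by linarith
    nlinarith [norm_nonneg y, norm_nonneg x, sq_nonneg (‖x‖ - 1)]
  have h2 : (4 * π * u) ^ (-(d : ℝ) / 2)
      = 2 ^ ((d : ℝ) / 2) * (4 * π * (2 * u)) ^ (-(d : ℝ) / 2) := by
    have : 4 * π * (2 * u) = 2 * (4 * π * u) := by ring
    rw [this, Real.mul_rpow (x := 2) (by positivity) (by positivity), ← mul_assoc, neg_div,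
      ← Real.rpow_add two_pos]
    simp
  have h3 : Real.exp (-‖x‖ ^ 2 / (8 * u))
      ≤ Real.exp (1 / (8 * u)) * Real.exp (-‖y‖ ^ 2 / (8 * (2 * u))) := by
    rw [← Real.exp_add]
    refine Real.exp_le_exp.2 ?_
    rw [← sub_nonneg]
    have : 1 / (8 * u) + -‖y‖ ^ 2 / (8 * (2 * u)) - -‖x‖ ^ 2 / (8 * u)
        = (2 * ‖x‖ ^ 2 + 2 - ‖y‖ ^ 2) / (16 * u) := by field_simp; ring
    rw [this]
    exact div_nonneg (by linarith) (by positivity)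
  calc gaussEnvelope d u x
      = 2 ^ ((d : ℝ) / 2) * (4 * π * (2 * u)) ^ (-(d : ℝ) / 2) * Real.exp (-‖x‖ ^ 2 / (8 * u)) := by
        rw [gaussEnvelope, h2]
    _ ≤ 2 ^ ((d : ℝ) / 2) * (4 * π * (2 * u)) ^ (-(d : ℝ) / 2)
        * (Real.exp (1 / (8 * u)) * Real.exp (-‖y‖ ^ 2 / (8 * (2 * u)))) := by gcongr
    _ = _ := by rw [gaussEnvelope]; ring

theorem integrable_mul_of_abs_le_gaussEnvelope {p u A : ℝ} (hp : 1 ≤ p) (hu : 0 < u) {h : E → ℝ}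
    (hh : Measurable h) (hhp : ∫⁻ z, ‖h z‖ₑ ^ p < ∞) {k : E → ℝ} (hk : Continuous k)
    (hkA : ∀ x, |k x| ≤ A * gaussEnvelope d u x) (y : E) :
    Integrable fun z => k (y - z) * h z := by
  refine ((integrable_mul_gaussEnvelope hp hu hh hhp y).const_mul A).mono'
    ((hk.comp (continuous_sub_left y)).measurable.mul hh).aestronglyMeasurable
    (.of_forall fun z => ?_)
  rw [norm_mul, Real.norm_eq_abs, Real.norm_eq_abs]
  nlinarith [hkA (y - z), abs_nonneg (h z)]

/-- Differentiation under the integral sign in a convolution with a kernel of Gaussian decay. -/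
theorem hasFDerivAt_convolution_of_le_gaussEnvelope {p u A : ℝ} (hp : 1 ≤ p) (hu : 0 < u)
    {h : E → ℝ} (hh : Measurable h) (hhp : ∫⁻ z, ‖h z‖ₑ ^ p < ∞)
    {k : E → ℝ} {k' : E → E →L[ℝ] ℝ} (hk : Continuous k) (hk' : Continuous k')
    (hd : ∀ x, HasFDerivAt k (k' x) x)
    (hkA : ∀ x, |k x| ≤ A * gaussEnvelope d u x)
    (hkA' : ∀ x, ‖k' x‖ ≤ A * gaussEnvelope d u x) (y : E) :
    HasFDerivAt (fun y' => ∫ z, k (y' - z) * h z) (∫ z, h z • k' (y - z)) y := by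
  have hA : ∀ x, A * gaussEnvelope d u x ≤ |A| * gaussEnvelope d u x := fun x =>
    mul_le_mul_of_nonneg_right (le_abs_self A) (gaussEnvelope_nonneg hu.le x)
  refine hasFDerivAt_integral_of_dominated_of_fderiv_le
    (bound := fun z => |A| * (2 ^ ((d : ℝ) / 2) * Real.exp (1 / (8 * u)))
      * (|h z| * gaussEnvelope d (2 * u) (y - z)))
    (F' := fun y' z => h z • k' (y' - z))
    (Metric.ball_mem_nhds y one_pos) (.of_forall fun y' => ?_)
    (integrable_mul_of_abs_le_gaussEnvelope hp hu hh hhp hk hkA y) ?_ (.of_forall fun z y' hy' => ?_)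
    ((integrable_mul_gaussEnvelope hp (by positivity) hh hhp y).const_mul _)
    (.of_forall fun z y' _ => ?_)
  · exact ((hk.comp (continuous_sub_left y')).measurable.mul hh).aestronglyMeasurable
  · exact hh.aestronglyMeasurable.smul (hk'.comp (continuous_sub_left y)).aestronglyMeasurable
  · rw [norm_smul, Real.norm_eq_abs]
    have h1 : ‖(y' - z) - (y - z)‖ ≤ 1 := by
      rw [sub_sub_sub_cancel_right, ← dist_eq_norm]
      exact (Metric.mem_ball.1 hy').le
    have h2 := gaussEnvelope_le_of_norm_sub_le hu h1
    calc |h z| * ‖k' (y' - z)‖ ≤ |h z| * (|A| * gaussEnvelope d u (y' - z)) := by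
          gcongr
          exact (hkA' _).trans (hA _)
      _ ≤ |h z| * (|A| * (2 ^ ((d : ℝ) / 2) * Real.exp (1 / (8 * u))
          * gaussEnvelope d (2 * u) (y - z))) := by gcongr
      _ = _ := by ring
  · have h1 := (hd (y' - z)).comp y' ((hasFDerivAt_id y').sub_const z)
    exact h1.mul_const (h z)

theorem differentiableAt_of_apply_basis {D : E → E →L[ℝ] ℝ} {y : E}
    (h : ∀ i, DifferentiableAt ℝ (fun y' => D y' (EuclideanSpace.single i 1)) y) :
    DifferentiableAt ℝ D y := by
  have he : D = fun y' => ∑ i, D y' (EuclideanSpace.single i 1)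
      • innerSL ℝ (EuclideanSpace.single i (1 : ℝ)) := by
    ext y' x
    conv_lhs => rw [← (EuclideanSpace.basisFun (Fin d) ℝ).sum_repr x]
    simp [mul_comm, EuclideanSpace.inner_single_left]
  rw [he]
  exact DifferentiableAt.fun_sum fun i _ => (h i).smul_const _

/-- Second derivatives of the heat extension of an `L^p` function. -/
theorem iteratedFDeriv_two_heat_convolution {p u : ℝ} (hp : 1 ≤ p) (hu : 0 < u) {h : E → ℝ}
    (hh : Measurable h) (hhp : ∫⁻ z, ‖h z‖ₑ ^ p < ∞) (y : E) (m : Fin 2 → E) (hm : ‖m 1‖ ≤ 1) :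
    iteratedFDeriv ℝ 2 (fun y' => ∫ z, heatKernel d u (y' - z) * h z) y m
      = ∫ z, heatHessian d (m 0) (m 1) u (y - z) * h z := by
  set A : ℝ := 6144 * (1 + u⁻¹) with hAdef
  have hu' : 0 < u⁻¹ := inv_pos.2 hu
  have hAle : ∀ {B : ℝ} (x : E), B ≤ A → B * gaussEnvelope d u x ≤ A * gaussEnvelope d u x :=
    fun x hB => mul_le_mul_of_nonneg_right hB (gaussEnvelope_nonneg hu.le x)
  have hcG := continuous_heatKernel_space (d := d) u
  set k' : E → E →L[ℝ] ℝ := fun x => -(heatKernel d u x / (2 * u)) • innerSL ℝ x with hk'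
  have hck' : Continuous k' := by
    rw [hk']
    fun_prop
  set D : E → E →L[ℝ] ℝ := fun y' => ∫ z, h z • k' (y' - z) with hD
  have hfirst : ∀ y', HasFDerivAt (fun y' => ∫ z, heatKernel d u (y' - z) * h z) (D y') y' :=
    fun y' => hasFDerivAt_convolution_of_le_gaussEnvelope hp hu hh hhp hcG hck'
      (hasFDerivAt_heatKernel hu)
      (fun x => by
        rw [abs_of_nonneg (heatKernel_nonneg hu.le x)]
        exact (heatKernel_le_gaussEnvelope hu x).trans (hAle x (by rw [hAdef]; linarith)))
      (fun x => norm_fderiv_heatKernel_le hu x) y'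
  have hDint : ∀ y', Integrable fun z => h z • k' (y' - z) := fun y' => by
    refine ((integrable_mul_gaussEnvelope hp hu hh hhp y').const_mul A).mono'
      (hh.aestronglyMeasurable.smul (hck'.comp (continuous_sub_left y')).aestronglyMeasurable)
      (.of_forall fun z => ?_)
    rw [norm_smul, Real.norm_eq_abs]
    have := norm_fderiv_heatKernel_le (d := d) hu (y' - z)
    nlinarith [abs_nonneg (h z)]
  have hDw : ∀ w y', D y' w = ∫ z, heatGradient d w u (y' - z) * h z := fun w y' => by
    rw [hD]
    simp only
    rw [ContinuousLinearMap.integral_apply (hDint y')]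
    refine integral_congr_ae (.of_forall fun z => ?_)
    simp only [hk', heatGradient, smul_apply, innerSL_apply_apply, smul_eq_mul]
    ring
  have hsecond : ∀ w, ‖w‖ ≤ 1 → HasFDerivAt (fun y' => D y' w)
      (∫ z, h z • heatHessianCLM d w u (y - z)) y := fun w hw => by
    have e : (fun y' => D y' w) = fun y' => ∫ z, heatGradient d w u (y' - z) * h z :=
      funext (hDw w)
    rw [e]
    exact hasFDerivAt_convolution_of_le_gaussEnvelope hp hu hh hhp
      (continuous_heatGradient_space w u) (continuous_heatHessianCLM_space w u)
      (hasFDerivAt_heatGradient w hu) (abs_heatGradient_le hu hw)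
      (fun x => (norm_heatHessianCLM_le hu hw x).trans (hAle x (by rw [hAdef]; linarith))) y
  have hDdiff : DifferentiableAt ℝ D y := differentiableAt_of_apply_basis fun i =>
    (hsecond _ (by simp)).differentiableAt
  have hfd : fderiv ℝ (fun y' => ∫ z, heatKernel d u (y' - z) * h z) = D :=
    funext fun y' => (hfirst y').fderiv
  rw [iteratedFDeriv_two_apply, hfd]
  have h1 : HasFDerivAt (fun y' => D y' (m 1)) ((fderiv ℝ D y).flip (m 1)) y := by
    have := hDdiff.hasFDerivAt.clm_apply (hasFDerivAt_const (m 1) y)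
    simpa using this
  have h2 := h1.unique (hsecond (m 1) hm)
  have h3 := congrArg (fun L : E →L[ℝ] ℝ => L (m 0)) h2
  simp only [ContinuousLinearMap.flip_apply] at h3
  rw [h3, ContinuousLinearMap.integral_apply]
  · refine integral_congr_ae (.of_forall fun z => ?_)
    simp [heatHessianCLM_apply, mul_comm]
  · refine ((integrable_mul_gaussEnvelope hp hu hh hhp y).const_mul A).mono'
      (hh.aestronglyMeasurable.smul
        ((continuous_heatHessianCLM_space (m 1) u).comp (continuous_sub_left y)).aestronglyMeasurable)
      (.of_forall fun z => ?_)
    rw [norm_smul, Real.norm_eq_abs]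
    have := (norm_heatHessianCLM_le (d := d) hu hm (y - z)).trans
      (hAle _ (by rw [hAdef]; linarith))
    nlinarith [abs_nonneg (h z)]

end DifferentiationUnderIntegral

section MixedSums

variable {S Y ι : Type*} [MeasurableSpace S] [MeasurableSpace Y]

theorem mixedEnergy_sum_le {μ : Measure S} {ν : Measure Y} [SFinite ν] {r q : ℝ} (hq : 1 ≤ q)
    (hr : 1 ≤ r) (s : Finset ι) {F : ι → S × Y → ℝ≥0∞} (hF : ∀ i, Measurable (F i)) :
    mixedEnergy μ ν r q (fun x => ∑ i ∈ s, F i x)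
      ≤ (s.card : ℝ≥0∞) ^ (r - 1) * ∑ i ∈ s, mixedEnergy μ ν r q (F i) := by
  have h1 : ∀ a, sliceNorm ν q (fun x => ∑ i ∈ s, F i x) a ≤ ∑ i ∈ s, sliceNorm ν q (F i) a := by
    intro a
    have h := Finset.le_sum_of_subadditive_on_pred (fun G : S × Y → ℝ≥0∞ => sliceNorm ν q G a)
      Measurable (by simp [sliceNorm, zero_lt_one.trans_le hq])
      (fun F G hF hG => sliceNorm_add_le hq hF hG a) (fun F G hF hG => hF.add hG) F
      (s := s) (fun i _ => hF i)
    have he : (fun x => ∑ i ∈ s, F i x) = ∑ i ∈ s, F i := by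
      ext x
      rw [Finset.sum_apply]
    rw [he]
    exact h
  calc mixedEnergy μ ν r q (fun x => ∑ i ∈ s, F i x)
      ≤ ∫⁻ a, (s.card : ℝ≥0∞) ^ (r - 1) * ∑ i ∈ s, sliceNorm ν q (F i) a ^ r ∂μ :=
        lintegral_mono fun a => (ENNReal.rpow_le_rpow (h1 a) (by linarith)).trans
          (ENNReal.rpow_sum_le_const_mul_sum_rpow s _ hr)
    _ = _ := by
        have hm : ∀ i ∈ s, Measurable fun a => sliceNorm ν q (F i) a ^ r := fun i _ =>
          (measurable_sliceNorm (hF i)).pow_const r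
        rw [lintegral_const_mul _ (Finset.measurable_fun_sum s hm), lintegral_finsetSum s hm]
        rfl

end MixedSums

section MaximalRegularity

open Filter Topology

variable {d : ℕ}

local notation "E" => EuclideanSpace ℝ (Fin d)

theorem ContinuousMultilinearMap.norm_le_sum_basis
    (M : ContinuousMultilinearMap ℝ (fun _ : Fin 2 => E) ℝ) :
    ‖M‖ ≤ ∑ ρ : Fin 2 → Fin d, ‖M fun i => EuclideanSpace.single (ρ i) (1 : ℝ)‖ := by
  refine ContinuousMultilinearMap.opNorm_le_bound (by positivity) fun m => ?_
  have hm : m = fun i => ∑ j, m i j • EuclideanSpace.single j (1 : ℝ) := by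
    ext1 i
    conv_lhs => rw [← (EuclideanSpace.basisFun (Fin d) ℝ).sum_repr (m i)]
    simp
  conv_lhs => rw [hm, ContinuousMultilinearMap.map_sum]
  rw [Finset.sum_mul]
  refine (norm_sum_le _ _).trans (Finset.sum_le_sum fun ρ _ => ?_)
  rw [ContinuousMultilinearMap.map_smul_univ M (fun i => m i (ρ i))
    (fun i => EuclideanSpace.single (ρ i) (1 : ℝ)), norm_smul, norm_prod, mul_comm]
  gcongr with i
  exact PiLp.norm_apply_le (m i) (ρ i)

theorem tendsto_timeCutoff {u : ℝ} (hu : 0 < u) :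
    Tendsto (fun n : ℕ => timeCutoff (1 / ((n : ℝ) + 1)) u) atTop (𝓝 1) := by
  have h := tendsto_one_div_add_atTop_nhds_zero_nat (𝕜 := ℝ)
  have h1 : Tendsto (fun n : ℕ => u / ((u + 1 / ((n : ℝ) + 1)) * (1 + 1 / ((n : ℝ) + 1) * u)))
      atTop (𝓝 (u / ((u + 0) * (1 + 0 * u)))) :=
    tendsto_const_nhds.div ((tendsto_const_nhds.add h).mul
      (tendsto_const_nhds.add (h.mul_const u))) (by simp [hu.ne'])
  simpa [timeCutoff, hu.ne'] using h1

/-- The truncated singular integrals converge pointwise wherever the iterated integral exists. -/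
theorem tendsto_kernelConv_truncatedKernel {v w : E} {t : ℝ} {y : E} {g : ℝ × E → ℝ}
    (hg : ∀ x, x.1 ≤ 0 → g x = 0)
    (hInt : ∀ n : ℕ, Integrable (fun x => truncatedKernel d v w (1 / ((n : ℝ) + 1)) ((t, y) - x) * g x)
      (volume.prod volume))
    (hΦ : IntegrableOn (fun s => ∫ z, heatHessian d v w (t - s) (y - z) * g (s, z)) (Ioo 0 t)) :
    Tendsto (fun n : ℕ => kernelConv (volume.prod volume)
        (truncatedKernel d v w (1 / ((n : ℝ) + 1))) g (t, y)) atTop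
      (𝓝 (∫ s in Ioo 0 t, ∫ z, heatHessian d v w (t - s) (y - z) * g (s, z))) := by
  have he : ∀ n : ℕ, kernelConv (volume.prod volume)
      (truncatedKernel d v w (1 / ((n : ℝ) + 1))) g (t, y)
      = ∫ s in Ioo 0 t, timeCutoff (1 / ((n : ℝ) + 1)) (t - s)
        * ∫ z, heatHessian d v w (t - s) (y - z) * g (s, z) := by
    intro n
    rw [kernelConv, integral_prod _ (hInt n), ← setIntegral_eq_integral_of_forall_compl_eq_zero
      (s := Ioo 0 t)]
    · refine setIntegral_congr_fun measurableSet_Ioo fun s hs => ?_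
      simp only [Prod.mk_sub_mk, truncatedKernel, sub_pos.2 hs.2, if_true]
      rw [← integral_const_mul]
      simp only [mul_assoc]
    · intro s hs
      by_cases h0 : s ≤ 0
      · simp [hg (s, _) h0]
      · have : ¬ 0 < t - s := fun h => hs ⟨not_le.1 h0, sub_pos.1 h⟩
        simp [truncatedKernel, this]
  simp_rw [he]
  refine tendsto_integral_of_dominated_convergence
    (fun s => ‖∫ z, heatHessian d v w (t - s) (y - z) * g (s, z)‖) (fun n => ?_) hΦ.norm
    (fun n => ?_) ?_
  · exact (measurable_timeCutoff.comp (measurable_const.sub measurable_id)).aestronglyMeasurable.mul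
      hΦ.aestronglyMeasurable
  · filter_upwards [ae_restrict_mem measurableSet_Ioo] with s hs
    have hn : (0 : ℝ) < 1 / ((n : ℝ) + 1) := by positivity
    rw [norm_mul, Real.norm_eq_abs, abs_of_nonneg (timeCutoff_nonneg hn (sub_pos.2 hs.2).le)]
    exact mul_le_of_le_one_left (norm_nonneg _) (timeCutoff_le_one hn (sub_pos.2 hs.2).le)
  · filter_upwards [ae_restrict_mem measurableSet_Ioo] with s hs
    simpa using (tendsto_timeCutoff (sub_pos.2 hs.2)).mul_const
      (∫ z, heatHessian d v w (t - s) (y - z) * g (s, z))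

/-- Pointwise control of `A2` by the truncated singular integrals. -/
theorem enorm_A2_le {p : ℝ} (hp : 1 ≤ p) {f : ℝ → E → ℝ}
    (hf : Measurable fun q : ℝ × E => f q.1 q.2) {g : ℝ × E → ℝ} {t : ℝ} {y : E}
    (hg : ∀ x, x.1 ≤ 0 → g x = 0)
    (hfg : ∀ᵐ s ∂volume.restrict (Ioo 0 t), (∫⁻ z, ‖f s z‖ₑ ^ p < ∞) ∧ ∀ z, g (s, z) = f s z)
    (hInt : ∀ (ρ : Fin 2 → Fin d) (n : ℕ), Integrable (fun x =>
      truncatedKernel d (EuclideanSpace.single (ρ 0) 1) (EuclideanSpace.single (ρ 1) 1)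
        (1 / ((n : ℝ) + 1)) ((t, y) - x) * g x) (volume.prod volume)) :
    ‖A2 d f t y‖ₑ ≤ ∑ ρ : Fin 2 → Fin d, liminf (fun n : ℕ => ‖kernelConv (volume.prod volume)
      (truncatedKernel d (EuclideanSpace.single (ρ 0) 1) (EuclideanSpace.single (ρ 1) 1)
        (1 / ((n : ℝ) + 1))) g (t, y)‖ₑ) atTop := by
  by_cases hi : IntegrableOn (fun s => iteratedFDeriv ℝ 2
      (fun y' => ∫ z, heatKernel d (t - s) (y' - z) * f s z) y) (Ioo 0 t)
  · have hM : ‖A2 d f t y‖ₑ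
        ≤ ∑ ρ : Fin 2 → Fin d, ‖A2 d f t y fun i => EuclideanSpace.single (ρ i) (1 : ℝ)‖ₑ := by
      have h := ENNReal.ofReal_le_ofReal (ContinuousMultilinearMap.norm_le_sum_basis (A2 d f t y))
      rw [ENNReal.ofReal_sum_of_nonneg fun _ _ => norm_nonneg _] at h
      simpa only [ofReal_norm] using h
    refine hM.trans (Finset.sum_le_sum fun ρ _ => le_of_eq ?_)
    set m : Fin 2 → E := fun i => EuclideanSpace.single (ρ i) (1 : ℝ) with hm
    have hae : (fun s => iteratedFDeriv ℝ 2
        (fun y' => ∫ z, heatKernel d (t - s) (y' - z) * f s z) y m)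
        =ᵐ[volume.restrict (Ioo 0 t)]
        fun s => ∫ z, heatHessian d (m 0) (m 1) (t - s) (y - z) * g (s, z) := by
      filter_upwards [hfg, ae_restrict_mem measurableSet_Ioo] with s hs hst
      have hfs : Measurable (f s) := hf.comp measurable_prodMk_left
      rw [iteratedFDeriv_two_heat_convolution hp (sub_pos.2 hst.2) hfs hs.1 y m (by simp [hm])]
      simp only [hs.2]
    have hΦ : IntegrableOn (fun s => ∫ z, heatHessian d (m 0) (m 1) (t - s) (y - z) * g (s, z))
        (Ioo 0 t) :=
      ((ContinuousMultilinearMap.apply ℝ (fun _ : Fin 2 => E) ℝ m).integrable_comp hi).congr hae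
    have hA : A2 d f t y m
        = ∫ s in Ioo 0 t, ∫ z, heatHessian d (m 0) (m 1) (t - s) (y - z) * g (s, z) := by
      rw [A2, ContinuousMultilinearMap.integral_apply hi]
      exact integral_congr_ae hae
    rw [hA]
    exact (tendsto_kernelConv_truncatedKernel hg (hInt ρ) hΦ).enorm.liminf_eq.symm
  · have h0 : A2 d f t y = 0 := integral_undef hi
    have h1 : ‖A2 d f t y‖ₑ = 0 := by
      rw [← ofReal_norm, h0, norm_zero, ENNReal.ofReal_zero]
    rw [h1]
    exact zero_le

end MaximalRegularity

/-- Maximal `L^r(0,T;L^p)` regularity for the heat flow: for every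
`d ≥ 1` and `1 < p, r < ∞` there is `C = C(d,p,r)`, independent of `T ∈ (0,∞]`,
such that `‖A₂ f‖_{L^r(0,T;L^p)} ≤ C ‖f‖_{L^r(0,T;L^p)}` for all
`f ∈ L^r(0,T;L^p(ℝ^d))`. -/
theorem heat_maximal_regularity
    (d : ℕ) (hd : 1 ≤ d) (p r : ℝ) (hp : 1 < p) (hr : 1 < r) :
    ∃ C : ℝ, 0 < C ∧
      ∀ T : ℝ≥0∞, 0 < T →
        ∀ f : ℝ → EuclideanSpace ℝ (Fin d) → ℝ,
          Measurable (fun q : ℝ × EuclideanSpace ℝ (Fin d) => f q.1 q.2) →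
          (∫⁻ t in {t : ℝ | 0 < t ∧ ENNReal.ofReal t < T},
              (eLpNorm (f t) (ENNReal.ofReal p) volume) ^ r) < ∞ →
          (∫⁻ t in {t : ℝ | 0 < t ∧ ENNReal.ofReal t < T},
              (eLpNorm (A2 d f t) (ENNReal.ofReal p) volume) ^ r) ^ (1 / r)
            ≤ ENNReal.ofReal C
              * (∫⁻ t in {t : ℝ | 0 < t ∧ ENNReal.ofReal t < T},
                  (eLpNorm (f t) (ENNReal.ofReal p) volume) ^ r) ^ (1 / r) := by
  have : NeZero d := ⟨by omega⟩
  have hp0 : 0 < p := by linarith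
  have hr0 : 0 < r := by linarith
  obtain ⟨C₀, hC₀, hbound⟩ := uniformHeatBound (d := d) hr hp
  set κ : ℝ≥0∞ := ((Finset.univ : Finset (Fin 2 → Fin d)).card : ℝ≥0∞) with hκ
  set K : ℝ≥0∞ := (κ ^ (r - 1) * (κ * C₀)) ^ (1 / r) with hK
  have hκtop : κ ≠ ∞ := natCast_ne_top _
  have hKtop : K ≠ ∞ :=
    ENNReal.rpow_ne_top_of_nonneg (by positivity) (ENNReal.mul_ne_top
      (ENNReal.rpow_ne_top_of_nonneg (by linarith) hκtop) (ENNReal.mul_ne_top hκtop hC₀))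
  refine ⟨K.toReal + 1, by positivity, fun T _ f hf hfin => ?_⟩
  have hnorm : ∀ {F : Type} [NormedAddCommGroup F] (h : EuclideanSpace ℝ (Fin d) → F),
      eLpNorm h (ENNReal.ofReal p) volume = (∫⁻ z, ‖h z‖ₑ ^ p) ^ (1 / p) := fun h => by
    rw [eLpNorm_eq_lintegral_rpow_enorm_toReal (by simpa using hp0) ofReal_ne_top,
      ENNReal.toReal_ofReal hp0.le]
  set J : Set ℝ := {t : ℝ | 0 < t ∧ ENNReal.ofReal t < T} with hJ
  have hJm : MeasurableSet J :=
    (measurableSet_lt measurable_const measurable_id).inter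
      (measurableSet_lt ENNReal.measurable_ofReal measurable_const)
  have hslice : Measurable fun s => ∫⁻ z, ‖f s z‖ₑ ^ p :=
    (hf.enorm.pow_const p).lintegral_prod_right'
  set S : Set ℝ := J ∩ {s | ∫⁻ z, ‖f s z‖ₑ ^ p < ∞} with hS
  have hSm : MeasurableSet S := hJm.inter (measurableSet_lt hslice measurable_const)
  have hgood : ∀ᵐ s ∂volume.restrict J, ∫⁻ z, ‖f s z‖ₑ ^ p < ∞ := by
    simp only [hnorm] at hfin
    filter_upwards [ae_lt_top ((hslice.pow_const _).pow_const _) hfin.ne] with s hs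
    by_contra hcon
    rw [not_lt, top_le_iff] at hcon
    rw [hcon, ENNReal.top_rpow_of_pos (by positivity), ENNReal.top_rpow_of_pos hr0] at hs
    exact lt_irrefl _ hs
  set g : ℝ × EuclideanSpace ℝ (Fin d) → ℝ :=
    (S ×ˢ univ).indicator fun x => f x.1 x.2 with hg
  have hgm : Measurable g := hf.indicator (hSm.prod MeasurableSet.univ)
  have hgS : ∀ s ∈ S, ∀ z, g (s, z) = f s z := fun s hs z => by
    simp [hg, hs]
  have hgS' : ∀ s ∉ S, ∀ z, g (s, z) = 0 := fun s hs z => by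
    simp [hg, hs]
  have hg0 : ∀ x : ℝ × EuclideanSpace ℝ (Fin d), x.1 ≤ 0 → g x = 0 := fun x hx =>
    hgS' x.1 (fun h => absurd h.1.1 (not_lt.2 hx)) x.2
  have hgE : mixedEnergy volume volume r p (fun x => ‖g x‖ₑ)
      ≤ ∫⁻ t in J, eLpNorm (f t) (ENNReal.ofReal p) volume ^ r := by
    rw [mixedEnergy, ← lintegral_indicator hJm]
    refine lintegral_mono fun s => ?_
    by_cases hs : s ∈ S
    · rw [indicator_of_mem hs.1, hnorm]
      simp only [sliceNorm, hgS s hs, le_refl]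
    · simp [sliceNorm, hgS' s hs, hp0, hr0]
  have hgfin := hgE.trans_lt hfin
  set e : Fin d → EuclideanSpace ℝ (Fin d) := fun i => EuclideanSpace.single i 1 with he
  have hen : ∀ i, ‖e i‖ ≤ 1 := fun i => by simp [he]
  set L : (Fin 2 → Fin d) → ℕ → ℝ × EuclideanSpace ℝ (Fin d) → ℝ≥0∞ := fun ρ n x =>
    ‖kernelConv (volume.prod volume)
      (truncatedKernel d (e (ρ 0)) (e (ρ 1)) (1 / ((n : ℝ) + 1))) g x‖ₑ with hL
  have hLm : ∀ ρ n, Measurable (L ρ n) := fun ρ n =>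
    (measurable_kernelConv measurable_truncatedKernel hgm).enorm
  have hLE : ∀ ρ, mixedEnergy volume volume r p
      (fun x => Filter.liminf (fun n => L ρ n x) Filter.atTop)
      ≤ C₀ * mixedEnergy volume volume r p (fun x => ‖g x‖ₑ) := fun ρ => by
    refine (mixedEnergy_liminf_le hp0 hr0 (hLm ρ)).trans ?_
    refine Filter.liminf_le_of_frequently_le' (Filter.Frequently.of_forall fun n => ?_)
    exact hbound _ _ _ (by positivity) (hen _) (hen _) g hgm hgfin
  have hpt : ∀ᵐ x ∂(volume : Measure ℝ).prod (volume : Measure (EuclideanSpace ℝ (Fin d))),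
      x.1 ∈ J → ‖A2 d f x.1 x.2‖ₑ
        ≤ ∑ ρ, Filter.liminf (fun n => L ρ n x) Filter.atTop := by
    have hInt : ∀ᵐ x ∂(volume : Measure ℝ).prod (volume : Measure (EuclideanSpace ℝ (Fin d))),
        ∀ (ρ : Fin 2 → Fin d) (n : ℕ), Integrable (fun z =>
          truncatedKernel d (e (ρ 0)) (e (ρ 1)) (1 / ((n : ℝ) + 1)) (x - z) * g z)
          (volume.prod volume) :=
      ae_all_iff.2 fun ρ => ae_all_iff.2 fun n => ae_integrable_kernelConv hp hr
        measurable_truncatedKernel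
        (integrable_truncatedKernel (by positivity) (hen _) (hen _)) hgm hgfin
    filter_upwards [hInt] with x hx hxJ
    refine enorm_A2_le hp.le hf hg0 ?_ hx
    have hsub : Ioo 0 x.1 ⊆ J := fun s hs =>
      ⟨hs.1, (ENNReal.ofReal_le_ofReal hs.2.le).trans_lt hxJ.2⟩
    filter_upwards [ae_restrict_of_ae_restrict_of_subset hsub hgood,
      ae_restrict_mem measurableSet_Ioo] with s hs hs'
    exact ⟨hs, hgS s ⟨hsub hs', hs⟩⟩
  have hmain : ∫⁻ t in J, eLpNorm (A2 d f t) (ENNReal.ofReal p) volume ^ r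
      ≤ κ ^ (r - 1) * (κ * C₀) * ∫⁻ t in J, eLpNorm (f t) (ENNReal.ofReal p) volume ^ r := by
    calc ∫⁻ t in J, eLpNorm (A2 d f t) (ENNReal.ofReal p) volume ^ r
        ≤ ∫⁻ t in J, sliceNorm volume p
            (fun x => ∑ ρ, Filter.liminf (fun n => L ρ n x) Filter.atTop) t ^ r := by
          refine lintegral_mono_ae ?_
          filter_upwards [ae_restrict_of_ae (Measure.ae_ae_of_ae_prod hpt),
            ae_restrict_mem hJm] with t ht htJ
          rw [hnorm]
          refine ENNReal.rpow_le_rpow (ENNReal.rpow_le_rpow (lintegral_mono_ae ?_)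
            (by positivity)) hr0.le
          filter_upwards [ht] with y hy
          exact ENNReal.rpow_le_rpow (hy htJ) hp0.le
      _ ≤ mixedEnergy volume volume r p
            (fun x => ∑ ρ, Filter.liminf (fun n => L ρ n x) Filter.atTop) :=
          setLIntegral_le_lintegral _ _
      _ ≤ κ ^ (r - 1) * ∑ ρ, mixedEnergy volume volume r p
            (fun x => Filter.liminf (fun n => L ρ n x) Filter.atTop) :=
          mixedEnergy_sum_le hp.le hr.le _ fun ρ => Measurable.liminf (hLm ρ)
      _ ≤ κ ^ (r - 1) * ∑ _ρ : Fin 2 → Fin d,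
            C₀ * ∫⁻ t in J, eLpNorm (f t) (ENNReal.ofReal p) volume ^ r := by
          gcongr with ρ
          exact (hLE ρ).trans (by gcongr)
      _ = _ := by
          rw [Finset.sum_const, nsmul_eq_mul]
          ring
  calc (∫⁻ t in J, eLpNorm (A2 d f t) (ENNReal.ofReal p) volume ^ r) ^ (1 / r)
      ≤ (κ ^ (r - 1) * (κ * C₀)
          * ∫⁻ t in J, eLpNorm (f t) (ENNReal.ofReal p) volume ^ r) ^ (1 / r) :=
        ENNReal.rpow_le_rpow hmain (by positivity)
    _ = K * (∫⁻ t in J, eLpNorm (f t) (ENNReal.ofReal p) volume ^ r) ^ (1 / r) := by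
        rw [ENNReal.mul_rpow_of_nonneg _ _ (by positivity)]
    _ ≤ _ := by
        gcongr
        rw [← ENNReal.ofReal_toReal hKtop]
        exact ENNReal.ofReal_le_ofReal (by rw [ENNReal.toReal_ofReal toReal_nonneg]; linarith)
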